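/- Let Ω ⊂ ℝⁿ be open and let (u_k) be an increasing sequence of weakly super-1-harmonic functions on Ω that is bounded in BV_loc(Ω) and in L^∞_loc(Ω). Then the pointwise a.e. limit u := lim_k u_k belongs to BV_loc(Ω) ∩ L^∞_loc(Ω), u_k converges locally weakly* to u in BV_loc(Ω) and L^∞_loc(Ω) with u_k ≤ u a.e., and u is weakly super-1-harmonic on Ω. -/

import Mathlib

open MeasureTheory Set Filter Topology Metric
open scoped RealInnerProductSpace ENNReal

noncomputable section

/-- Euclidean space `ℝⁿ`. -/
abbrev Eu (n : ℕ) : Type := EuclideanSpace ℝ (Fin n)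

/-- `(n-1)`-dimensional Hausdorff measure on `ℝⁿ`. -/
def hm (n : ℕ) : Measure (Eu n) := μH[(n : ℝ) - 1]

/-- Smooth test functions compactly supported in `Ω`. -/
def IsTest {n : ℕ} (Ω : Set (Eu n)) (φ : Eu n → ℝ) : Prop :=
  ContDiff ℝ (⊤ : ℕ∞) φ ∧ HasCompactSupport φ ∧ tsupport φ ⊆ Ω

/-- `σ ∈ L^∞(Ω, ℝⁿ)` with `‖σ‖ ≤ C` a.e. on `Ω`. -/
def Bdd {n : ℕ} (Ω : Set (Eu n)) (σ : Eu n → Eu n) (C : ℝ) : Prop :=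
  AEStronglyMeasurable σ (volume.restrict Ω) ∧ ∀ᵐ x ∂(volume.restrict Ω), ‖σ x‖ ≤ C

/-- `σ ∈ L^∞_loc(Ω, ℝⁿ)`. -/
def LocBdd {n : ℕ} (Ω : Set (Eu n)) (σ : Eu n → Eu n) : Prop :=
  AEStronglyMeasurable σ (volume.restrict Ω) ∧
  ∀ K : Set (Eu n), K ⊆ Ω → IsCompact K → ∃ C : ℝ, ∀ᵐ x ∂(volume.restrict K), ‖σ x‖ ≤ C

/-- scalar `u ∈ L^∞_loc(Ω)`. -/
def LocBddFun {n : ℕ} (Ω : Set (Eu n)) (u : Eu n → ℝ) : Prop :=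
  AEStronglyMeasurable u (volume.restrict Ω) ∧
  ∀ K : Set (Eu n), K ⊆ Ω → IsCompact K → ∃ C : ℝ, ∀ᵐ x ∂(volume.restrict K), |u x| ≤ C

/-- scalar `u ∈ L^∞(Ω)` with bound `C`. -/
def BddFun {n : ℕ} (Ω : Set (Eu n)) (u : Eu n → ℝ) (C : ℝ) : Prop :=
  AEStronglyMeasurable u (volume.restrict Ω) ∧ ∀ᵐ x ∂(volume.restrict Ω), |u x| ≤ C

/-- A measure carried by `Ω` which is finite on compact subsets of `Ω` (Radon on `Ω`). -/
def LocFinOn {n : ℕ} (Ω : Set (Eu n)) (μ : Measure (Eu n)) : Prop :=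
  (∀ K : Set (Eu n), K ⊆ Ω → IsCompact K → μ K < ⊤) ∧ μ Ωᶜ = 0

/-- A finite measure carried by `Ω`. -/
def FinOn {n : ℕ} (Ω : Set (Eu n)) (μ : Measure (Eu n)) : Prop :=
  μ univ < ⊤ ∧ μ Ωᶜ = 0

/-- The (signed) measure `μp - μn` represents `-Div σ` on `Ω`: for every test function `φ`
compactly supported in `Ω` one has `∫_Ω σ·∇φ dx = ∫ φ dμp - ∫ φ dμn`. -/
def RepNegDiv {n : ℕ} (Ω : Set (Eu n)) (σ : Eu n → Eu n) (μp μn : Measure (Eu n)) : Prop :=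
  ∀ φ : Eu n → ℝ, IsTest Ω φ →
    ∫ x in Ω, ⟪σ x, gradient φ x⟫ = (∫ x, φ x ∂μp) - ∫ x, φ x ∂μn

/-- `Div σ ≤ 0` in the sense of distributions on `Ω`. -/
def DivNonpos {n : ℕ} (Ω : Set (Eu n)) (σ : Eu n → Eu n) : Prop :=
  ∀ φ : Eu n → ℝ, IsTest Ω φ → (∀ x, 0 ≤ φ x) → 0 ≤ ∫ x in Ω, ⟪σ x, gradient φ x⟫

/-- The set `A` has Lebesgue density zero at the point `x`. -/
def DensityZeroAt {n : ℕ} (A : Set (Eu n)) (x : Eu n) : Prop :=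
  Tendsto (fun r : ℝ => volume (A ∩ ball x r) / volume (ball x r)) (𝓝[>] 0) (𝓝 0)

/-- The upper (approximate) representative `u⁺`: Lebesgue value at approximate continuity
points, larger jump value at approximate jump points. -/
def upperRep {n : ℕ} (u : Eu n → ℝ) (x : Eu n) : ℝ :=
  sInf {t : ℝ | DensityZeroAt {y | t < u y} x}

/-- The lower (approximate) representative `u⁻`. -/
def lowerRep {n : ℕ} (u : Eu n → ℝ) (x : Eu n) : ℝ :=
  sSup {t : ℝ | DensityZeroAt {y | u y < t} x}

/-- The precise (mean-value) representative `u* = (u⁺ + u⁻)/2`. -/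
def preciseRep {n : ℕ} (u : Eu n → ℝ) (x : Eu n) : ℝ := (upperRep u x + lowerRep u x) / 2

/-- `Du = θ·ν` is the gradient measure of `u` on `Ω` with total variation `ν` and
polar vector `θ` (so `ν = |Du|`). -/
def HasGradMeasure {n : ℕ} (Ω : Set (Eu n)) (u : Eu n → ℝ) (ν : Measure (Eu n))
    (θ : Eu n → Eu n) : Prop :=
  (∀ᵐ x ∂ν, ‖θ x‖ = 1) ∧ ν Ωᶜ = 0 ∧
  ∀ φ : Eu n → ℝ, IsTest Ω φ → ∫ x in Ω, u x • gradient φ x = - ∫ x, φ x • θ x ∂ν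

/-- `u ∈ BV_loc(Ω)`. -/
def MemBVLoc {n : ℕ} (Ω : Set (Eu n)) (u : Eu n → ℝ) : Prop :=
  LocallyIntegrableOn u Ω ∧
  ∃ ν θ, LocFinOn Ω ν ∧ HasGradMeasure Ω u ν θ

/-- `g` is the weak (Sobolev) gradient of `u ∈ W^{1,1}(Ω)`. -/
def HasSobGrad {n : ℕ} (Ω : Set (Eu n)) (u : Eu n → ℝ) (g : Eu n → Eu n) : Prop :=
  IntegrableOn g Ω ∧
  ∀ φ : Eu n → ℝ, IsTest Ω φ → ∫ x in Ω, u x • gradient φ x = - ∫ x in Ω, φ x • g x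

/-- `u ∈ W^{1,1}(Ω)`. -/
def MemW11 {n : ℕ} (Ω : Set (Eu n)) (u : Eu n → ℝ) : Prop :=
  IntegrableOn u Ω ∧ ∃ g, HasSobGrad Ω u g

/-- `u ∈ W^{1,1}_loc(Ω)` with weak gradient `g`. -/
def HasSobGradLoc {n : ℕ} (Ω : Set (Eu n)) (u : Eu n → ℝ) (g : Eu n → Eu n) : Prop :=
  LocallyIntegrableOn g Ω ∧
  ∀ φ : Eu n → ℝ, IsTest Ω φ → ∫ x in Ω, u x • gradient φ x = - ∫ x in Ω, φ x • g x

def MemW11Loc {n : ℕ} (Ω : Set (Eu n)) (u : Eu n → ℝ) : Prop :=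
  LocallyIntegrableOn u Ω ∧ ∃ g, HasSobGradLoc Ω u g

/-- `T` is the interior trace of `u` on `∂Ω`, characterized `H^{n-1}`-a.e. on `∂Ω`
by convergence of interior mean values. -/
def IsIntTrace {n : ℕ} (Ω : Set (Eu n)) (u T : Eu n → ℝ) : Prop :=
  ∀ᵐ x ∂((hm n).restrict (frontier Ω)),
    Tendsto (fun r : ℝ => (∫ y in Ω ∩ ball x r, |u y - T x|) / (volume (ball x r)).toReal)
      (𝓝[>] 0) (𝓝 0)

/-- The domain assumption `H^{n-1}(∂Ω) = P(Ω) < ∞`, in the equivalent form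
`𝟙_Ω ∈ BV(ℝⁿ)` with `|D𝟙_Ω| = H^{n-1}⌞∂Ω`. -/
def DomainAssum {n : ℕ} (Ω : Set (Eu n)) : Prop :=
  hm n (frontier Ω) < ⊤ ∧
  ∃ θ, HasGradMeasure (univ : Set (Eu n)) (Ω.indicator fun _ => (1 : ℝ))
    ((hm n).restrict (frontier Ω)) θ

/-- `g` is the normal trace `σ_n*` of `σ` on `∂Ω`, characterized by the Gauss–Green
formula for `W^{1,1} ∩ L^∞` functions; here `μ = -Div σ ≥ 0`. -/
def IsNormalTrace {n : ℕ} (Ω : Set (Eu n)) (σ : Eu n → Eu n) (μ : Measure (Eu n))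
    (g : Eu n → ℝ) : Prop :=
  ∀ (v : Eu n → ℝ) (gv : Eu n → Eu n) (T : Eu n → ℝ),
    MemW11 Ω v → (∃ C, BddFun Ω v C) → HasSobGrad Ω v gv → IsIntTrace Ω v T →
    ∀ φ : Eu n → ℝ, IsTest (univ : Set (Eu n)) φ →
      (- ∫ x in Ω, v x * ⟪σ x, gradient φ x⟫) + (∫ x, φ x * preciseRep v x ∂μ)
        = (∫ x in Ω, φ x * ⟪σ x, gv x⟫) + ∫ x in frontier Ω, φ x * T x * g x ∂(hm n)

/-- Weakly super-1-harmonic: there is `σ ∈ L^∞` with `|σ| ≤ 1` a.e., `Div σ ≤ 0`,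
and `⟨σ, Du⁺⟩ = |Du|` as measures on `Ω`. -/
def SuperOneHarmonic {n : ℕ} (Ω : Set (Eu n)) (u : Eu n → ℝ) : Prop :=
  MemBVLoc Ω u ∧ LocBddFun Ω u ∧
  ∃ σ : Eu n → Eu n, ∃ μ : Measure (Eu n),
    Bdd Ω σ 1 ∧ DivNonpos Ω σ ∧ RepNegDiv Ω σ μ 0 ∧ LocFinOn Ω μ ∧
    ∃ ν θ, LocFinOn Ω ν ∧ HasGradMeasure Ω u ν θ ∧
      ∀ φ : Eu n → ℝ, IsTest Ω φ →
        (- ∫ x in Ω, u x * ⟪σ x, gradient φ x⟫) + (∫ x, φ x * upperRep u x ∂μ)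
          = ∫ x, φ x ∂ν

section

variable {n : ℕ}

/-! ### Gradients, divergences and test functions -/

/-- The `i`-th standard basis vector. -/
abbrev stdVec (i : Fin n) : Eu n := EuclideanSpace.single i (1 : ℝ)

/-- The divergence of a vector field. -/
def dv (X : Eu n → Eu n) (x : Eu n) : ℝ :=
  ∑ i, fderiv ℝ (fun y => X y i) x (stdVec i)

lemma inner_gradient_eq (φ : Eu n → ℝ) (x v : Eu n) :
    ⟪gradient φ x, v⟫ = fderiv ℝ φ x v := by
  simp [gradient]

lemma inner_gradient_eq' (φ : Eu n → ℝ) (x v : Eu n) :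
    ⟪v, gradient φ x⟫ = fderiv ℝ φ x v := by
  rw [real_inner_comm, inner_gradient_eq]

lemma gradient_coord (φ : Eu n → ℝ) (x : Eu n) (i : Fin n) :
    gradient φ x i = fderiv ℝ φ x (stdVec i) := by
  rw [← inner_gradient_eq, EuclideanSpace.inner_single_right]; simp

lemma norm_gradient_eq (φ : Eu n → ℝ) (x : Eu n) : ‖gradient φ x‖ = ‖fderiv ℝ φ x‖ := by
  simp [gradient]

lemma continuous_gradient {φ : Eu n → ℝ} (hφ : ContDiff ℝ (⊤ : ℕ∞) φ) :
    Continuous (gradient φ) :=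
  (InnerProductSpace.toDual ℝ (Eu n)).symm.continuous.comp (hφ.continuous_fderiv (by simp))

lemma tsupport_gradient_subset (φ : Eu n → ℝ) : tsupport (gradient φ) ⊆ tsupport φ := by
  refine (closure_mono ?_).trans (tsupport_fderiv_subset ℝ (f := φ))
  intro x hx h
  apply hx
  simp [gradient, h]

lemma gradient_eq_zero_of_notMem {φ : Eu n → ℝ} {x : Eu n} (hx : x ∉ tsupport φ) :
    gradient φ x = 0 :=
  image_eq_zero_of_notMem_tsupport fun h => hx (tsupport_gradient_subset φ h)

lemma gradient_add {φ ψ : Eu n → ℝ} (hφ : ContDiff ℝ (⊤ : ℕ∞) φ) (hψ : ContDiff ℝ (⊤ : ℕ∞) ψ)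
    (x : Eu n) : gradient (fun y => φ y + ψ y) x = gradient φ x + gradient ψ x := by
  have h1 := (hφ.differentiable (by simp)) x
  have h2 := (hψ.differentiable (by simp)) x
  simp only [gradient]
  rw [fderiv_fun_add h1 h2, map_add]

lemma gradient_const_mul {φ : Eu n → ℝ} (hφ : ContDiff ℝ (⊤ : ℕ∞) φ) (c : ℝ)
    (x : Eu n) : gradient (fun y => c * φ y) x = c • gradient φ x := by
  have h1 := (hφ.differentiable (by simp)) x
  simp only [gradient]
  rw [fderiv_const_mul h1, map_smul]

lemma gradient_mul {φ ψ : Eu n → ℝ} (hφ : ContDiff ℝ (⊤ : ℕ∞) φ) (hψ : ContDiff ℝ (⊤ : ℕ∞) ψ)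
    (x : Eu n) : gradient (fun y => φ y * ψ y) x = φ x • gradient ψ x + ψ x • gradient φ x := by
  have h1 := (hφ.differentiable (by simp)) x
  have h2 := (hψ.differentiable (by simp)) x
  simp only [gradient]
  rw [fderiv_fun_mul h1 h2, map_add, map_smul, map_smul]

lemma gradient_comp {f : ℝ → ℝ} {w : Eu n → ℝ} (hf : ContDiff ℝ (⊤ : ℕ∞) f)
    (hw : ContDiff ℝ (⊤ : ℕ∞) w) (x : Eu n) :
    gradient (fun y => f (w y)) x = deriv f (w x) • gradient w x := by
  have h1 := ((hf.differentiable (by simp)) (w x)).hasDerivAt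
  have h2 := ((hw.differentiable (by simp)) x).hasFDerivAt
  have h3 := h1.comp_hasFDerivAt x h2
  simp only [gradient]
  rw [show (fun y => f (w y)) = f ∘ w from rfl, h3.fderiv, map_smul]

namespace IsTest

variable {Ω Ω' : Set (Eu n)} {φ ψ : Eu n → ℝ}

lemma continuous (h : IsTest Ω φ) : Continuous φ := h.1.continuous

lemma mono (h : IsTest Ω φ) (hΩ : Ω ⊆ Ω') : IsTest Ω' φ := ⟨h.1, h.2.1, h.2.2.trans hΩ⟩

lemma add (h : IsTest Ω φ) (h' : IsTest Ω ψ) : IsTest Ω (fun x => φ x + ψ x) :=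
  ⟨h.1.add h'.1, h.2.1.add h'.2.1,
    (tsupport_add φ ψ).trans (union_subset h.2.2 h'.2.2)⟩

lemma const_mul (h : IsTest Ω φ) (c : ℝ) : IsTest Ω (fun x => c * φ x) :=
  ⟨contDiff_const.mul h.1, h.2.1.mul_left,
    (tsupport_mul_subset_right (f := fun _ => c) (g := φ)).trans h.2.2⟩

lemma neg (h : IsTest Ω φ) : IsTest Ω (fun x => - φ x) := by
  simpa using h.const_mul (-1)

lemma sub (h : IsTest Ω φ) (h' : IsTest Ω ψ) : IsTest Ω (fun x => φ x - ψ x) := by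
  simpa [sub_eq_add_neg] using h.add h'.neg

lemma mul_smooth (h : IsTest Ω φ) (hψ : ContDiff ℝ (⊤ : ℕ∞) ψ) :
    IsTest Ω (fun x => φ x * ψ x) :=
  ⟨h.1.mul hψ, h.2.1.mul_right, (tsupport_mul_subset_left (f := φ) (g := ψ)).trans h.2.2⟩

lemma exists_bound (h : IsTest Ω φ) : ∃ C : ℝ, 0 ≤ C ∧ ∀ x, |φ x| ≤ C := by
  obtain ⟨C, hC⟩ := h.2.1.exists_bound_of_continuous h.continuous
  exact ⟨C, (norm_nonneg _).trans (hC 0), hC⟩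

lemma hasCompactSupport_gradient (h : IsTest Ω φ) : HasCompactSupport (gradient φ) :=
  h.2.1.of_isClosed_subset (isClosed_tsupport _) (tsupport_gradient_subset φ)

lemma exists_bound_gradient (h : IsTest Ω φ) : ∃ C : ℝ, 0 ≤ C ∧ ∀ x, ‖gradient φ x‖ ≤ C := by
  obtain ⟨C, hC⟩ := h.hasCompactSupport_gradient.exists_bound_of_continuous
    (continuous_gradient h.1)
  exact ⟨C, (norm_nonneg _).trans (hC 0), hC⟩

end IsTest

/-- Cut-off functions. -/
lemma exists_cutoff {Ω K : Set (Eu n)} (hΩ : IsOpen Ω) (hK : IsCompact K) (hKΩ : K ⊆ Ω) :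
    ∃ χ : Eu n → ℝ, IsTest Ω χ ∧ (∀ x, 0 ≤ χ x) ∧ (∀ x, χ x ≤ 1) ∧
      ∃ U, IsOpen U ∧ K ⊆ U ∧ U ⊆ Ω ∧ ∀ x ∈ U, χ x = 1 := by
  obtain ⟨L, hL, hKL, hLΩ⟩ := exists_compact_between hK hΩ hKΩ
  obtain ⟨L', hL', hLL', hL'Ω⟩ := exists_compact_between hL hΩ hLΩ
  obtain ⟨f, hf1, hf2, hf3⟩ := exists_contMDiff_support_eq_eq_one_iff
    (n := (⊤ : ℕ∞)) (modelWithCornersSelf ℝ (Eu n)) (s := interior L') (t := L)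
    isOpen_interior hL.isClosed hLL'
  have hts : tsupport f ⊆ L' := by
    rw [tsupport, hf3.1]
    exact closure_minimal interior_subset hL'.isClosed
  refine ⟨f, ⟨hf1.contDiff, HasCompactSupport.of_support_subset_isCompact hL'
    ((subset_tsupport _).trans hts), hts.trans hL'Ω⟩, fun x => ?_, fun x => ?_,
    interior L, isOpen_interior, hKL, interior_subset.trans hLΩ, fun x hx => ?_⟩
  · exact (hf2 (mem_range_self x)).1
  · exact (hf2 (mem_range_self x)).2
  · exact (hf3.2 x).1 (interior_subset hx)

lemma Integrable.mul_of_tsupport_subset {w g : Eu n → ℝ} {K : Set (Eu n)} (hK : IsCompact K)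
    (hw : IntegrableOn w K) (hg : Continuous g) (hgK : Function.support g ⊆ K) :
    Integrable (fun x => w x * g x) := by
  have h1 : IntegrableOn (fun x => w x * g x) K := hw.mul_continuousOn hg.continuousOn hK
  refine (integrableOn_iff_integrable_of_support_subset ?_).1 h1
  intro x hx
  apply hgK
  intro h
  simp [h] at hx

/-! ### Vector fields -/

/-- Smooth compactly supported vector fields bounded pointwise by `φ`. -/
def Fld (φ : Eu n → ℝ) (X : Eu n → Eu n) : Prop :=
  ContDiff ℝ (⊤ : ℕ∞) X ∧ HasCompactSupport X ∧ ∀ x, ‖X x‖ ≤ φ x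

lemma coord_smooth {X : Eu n → Eu n} (hX : ContDiff ℝ (⊤ : ℕ∞) X) (i : Fin n) :
    ContDiff ℝ (⊤ : ℕ∞) (fun y => X y i) := by
  exact (EuclideanSpace.proj (𝕜 := ℝ) i).contDiff.comp hX

lemma coord_support {X : Eu n → Eu n} (i : Fin n) :
    tsupport (fun y => X y i) ⊆ tsupport X := by
  apply closure_mono
  intro x hx h
  apply hx
  simp [h]

lemma coord_compact {X : Eu n → Eu n} (hX : HasCompactSupport X) (i : Fin n) :
    HasCompactSupport (fun y => X y i) :=
  hX.of_isClosed_subset (isClosed_tsupport _) (coord_support i)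

lemma continuous_dv {X : Eu n → Eu n} (hX : ContDiff ℝ (⊤ : ℕ∞) X) : Continuous (dv X) := by
  refine continuous_finsetSum _ fun i _ => ?_
  exact ((coord_smooth hX i).continuous_fderiv (by simp)).clm_apply continuous_const

lemma dv_eq_zero_of_notMem {X : Eu n → Eu n} {x : Eu n} (hx : x ∉ tsupport X) : dv X x = 0 := by
  refine Finset.sum_eq_zero fun i _ => ?_
  have : x ∉ tsupport (fderiv ℝ (fun y => X y i)) := fun h =>
    hx (coord_support i (tsupport_fderiv_subset ℝ h))
  rw [image_eq_zero_of_notMem_tsupport this]; rfl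

lemma support_dv_subset (X : Eu n → Eu n) : Function.support (dv X) ⊆ tsupport X := by
  intro x hx
  by_contra h
  exact hx (dv_eq_zero_of_notMem h)

lemma dv_add {X Y : Eu n → Eu n} (hX : ContDiff ℝ (⊤ : ℕ∞) X) (hY : ContDiff ℝ (⊤ : ℕ∞) Y)
    (x : Eu n) : dv (fun y => X y + Y y) x = dv X x + dv Y x := by
  simp only [dv, ← Finset.sum_add_distrib]
  refine Finset.sum_congr rfl fun i _ => ?_
  have h1 := (coord_smooth hX i).differentiable (by simp) x
  have h2 := (coord_smooth hY i).differentiable (by simp) x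
  have : (fun y => (X y + Y y) i) = fun y => X y i + Y y i := by ext y; simp
  rw [this, fderiv_fun_add h1 h2]; rfl

lemma dv_smul {X : Eu n → Eu n} (hX : ContDiff ℝ (⊤ : ℕ∞) X) (c : ℝ)
    (x : Eu n) : dv (fun y => c • X y) x = c * dv X x := by
  simp only [dv, Finset.mul_sum]
  refine Finset.sum_congr rfl fun i _ => ?_
  have h1 := (coord_smooth hX i).differentiable (by simp) x
  have : (fun y => (c • X y) i) = fun y => c * X y i := by ext y; simp
  rw [this, fderiv_const_mul h1]; rfl

lemma dv_smul_const {ψ : Eu n → ℝ} (hψ : ContDiff ℝ (⊤ : ℕ∞) ψ) (v x : Eu n) :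
    dv (fun y => ψ y • v) x = ⟪gradient ψ x, v⟫ := by
  have h1 := hψ.differentiable (by simp) x
  rw [PiLp.inner_apply]
  simp only [dv]
  refine Finset.sum_congr rfl fun i _ => ?_
  have : (fun y => (ψ y • v) i) = fun y => v i * ψ y := by ext y; simp [mul_comm]
  rw [this, fderiv_const_mul h1, gradient_coord]
  simp

namespace Fld

variable {φ ψ : Eu n → ℝ} {X Y : Eu n → Eu n}

lemma tsupport_subset (h : Fld φ X) : tsupport X ⊆ tsupport φ := by
  apply closure_mono
  intro x hx h0
  have := h.2.2 x
  rw [h0] at this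
  exact hx (norm_le_zero_iff.1 this)

lemma integrable (h : Fld φ X) {w : Eu n → ℝ} (hφ : HasCompactSupport φ)
    (hw : IntegrableOn w (tsupport φ)) : Integrable (fun x => w x * dv X x) :=
  Integrable.mul_of_tsupport_subset hφ hw (continuous_dv h.1)
    ((support_dv_subset X).trans h.tsupport_subset)

lemma add (h : Fld φ X) (h' : Fld ψ Y) : Fld (fun x => φ x + ψ x) (fun x => X x + Y x) :=
  ⟨h.1.add h'.1, h.2.1.add h'.2.1, fun x => (norm_add_le _ _).trans (add_le_add (h.2.2 x) (h'.2.2 x))⟩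

lemma const_smul (h : Fld φ X) {c : ℝ} (hc : 0 ≤ c) :
    Fld (fun x => c * φ x) (fun x => c • X x) :=
  ⟨h.1.const_smul c, h.2.1.smul_left (f := fun _ => c), fun x => by
    rw [norm_smul, Real.norm_of_nonneg hc]; exact mul_le_mul_of_nonneg_left (h.2.2 x) hc⟩

lemma mono (h : Fld φ X) (hφψ : ∀ x, φ x ≤ ψ x) : Fld ψ X :=
  ⟨h.1, h.2.1, fun x => (h.2.2 x).trans (hφψ x)⟩

end Fld

/-- Integration by parts against a smooth compactly supported field. -/
lemma integral_mul_dv {w : Eu n → ℝ} {X : Eu n → Eu n} (hw : ContDiff ℝ (⊤ : ℕ∞) w)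
    (hX : ContDiff ℝ (⊤ : ℕ∞) X) (hXc : HasCompactSupport X) :
    ∫ x, w x * dv X x = - ∫ x, ⟪gradient w x, X x⟫ := by
  have key : ∀ i, ∫ x, w x * fderiv ℝ (fun y => X y i) x (stdVec i)
      = - ∫ x, fderiv ℝ w x (stdVec i) * X x i := by
    intro i
    have c1 : Continuous fun x => fderiv ℝ w x (stdVec i) :=
      (hw.continuous_fderiv (by simp)).clm_apply continuous_const
    have c2 : Continuous fun x => fderiv ℝ (fun y => X y i) x (stdVec i) :=
      ((coord_smooth hX i).continuous_fderiv (by simp)).clm_apply continuous_const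
    have s2 : HasCompactSupport fun x => fderiv ℝ (fun y => X y i) x (stdVec i) := by
      exact (coord_compact hXc i).fderiv_apply ℝ (stdVec i)
    apply integral_mul_fderiv_eq_neg_fderiv_mul_of_integrable
    · exact (c1.mul (coord_smooth hX i).continuous).integrable_of_hasCompactSupport
        (coord_compact hXc i).mul_left
    · exact (hw.continuous.mul c2).integrable_of_hasCompactSupport s2.mul_left
    · exact (hw.continuous.mul (coord_smooth hX i).continuous).integrable_of_hasCompactSupport
        (coord_compact hXc i).mul_left
    · exact fun x _ => hw.differentiable (by simp) x
    · exact fun x _ => (coord_smooth hX i).differentiable (by simp) x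
  have e1 : ∀ x, ⟪gradient w x, X x⟫ = ∑ i, fderiv ℝ w x (stdVec i) * X x i := by
    intro x
    rw [PiLp.inner_apply]
    refine Finset.sum_congr rfl fun i _ => ?_
    rw [gradient_coord]; simp [mul_comm]
  simp only [e1, dv, Finset.mul_sum]
  rw [integral_finsetSum, integral_finsetSum, ← Finset.sum_neg_distrib]
  · exact Finset.sum_congr rfl fun i _ => key i
  · intro i _
    have c1 : Continuous fun x => fderiv ℝ w x (stdVec i) :=
      (hw.continuous_fderiv (by simp)).clm_apply continuous_const
    exact (c1.mul (coord_smooth hX i).continuous).integrable_of_hasCompactSupport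
        (coord_compact hXc i).mul_left
  · intro i _
    have c2 : Continuous fun x => fderiv ℝ (fun y => X y i) x (stdVec i) :=
      ((coord_smooth hX i).continuous_fderiv (by simp)).clm_apply continuous_const
    have s2 : HasCompactSupport fun x => fderiv ℝ (fun y => X y i) x (stdVec i) := by
      exact (coord_compact hXc i).fderiv_apply ℝ (stdVec i)
    exact (hw.continuous.mul c2).integrable_of_hasCompactSupport s2.mul_left

/-- The variation of `w` weighted by `φ`. -/
def TV (w φ : Eu n → ℝ) : ℝ≥0∞ :=
  ⨆ X : {X : Eu n → Eu n // Fld φ X}, ENNReal.ofReal (∫ x, w x * dv X.1 x)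

lemma le_TV {w φ : Eu n → ℝ} {X : Eu n → Eu n} (hX : Fld φ X) :
    ENNReal.ofReal (∫ x, w x * dv X x) ≤ TV w φ :=
  le_iSup (fun X : {X : Eu n → Eu n // Fld φ X} => ENNReal.ofReal (∫ x, w x * dv X.1 x)) ⟨X, hX⟩

lemma TV_le {w φ : Eu n → ℝ} {c : ℝ≥0∞}
    (h : ∀ X, Fld φ X → ENNReal.ofReal (∫ x, w x * dv X x) ≤ c) : TV w φ ≤ c :=
  iSup_le fun X => h X.1 X.2

lemma lt_TV_iff {w φ : Eu n → ℝ} {c : ℝ≥0∞} :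
    c < TV w φ ↔ ∃ X, Fld φ X ∧ c < ENNReal.ofReal (∫ x, w x * dv X x) := by
  simp [TV, lt_iSup_iff]

lemma integral_le_TV_toReal {w φ : Eu n → ℝ} {X : Eu n → Eu n} (hX : Fld φ X)
    (hfin : TV w φ ≠ ⊤) : ∫ x, w x * dv X x ≤ (TV w φ).toReal := by
  have := le_TV (w := w) hX
  rcases le_total (∫ x, w x * dv X x) 0 with h | h
  · exact h.trans ENNReal.toReal_nonneg
  · exact (ENNReal.ofReal_le_iff_le_toReal hfin).1 this

lemma integral_mul_dv_congr {w w' φ : Eu n → ℝ} {X : Eu n → Eu n} (hX : Fld φ X)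
    (h : ∀ᵐ x, x ∈ tsupport φ → w x = w' x) :
    ∫ x, w x * dv X x = ∫ x, w' x * dv X x := by
  refine integral_congr_ae ?_
  filter_upwards [h] with x hx
  by_cases hs : x ∈ tsupport φ
  · simp [hx hs]
  · simp [dv_eq_zero_of_notMem fun h => hs (hX.tsupport_subset h)]

lemma TV_congr {w w' φ : Eu n → ℝ} (h : ∀ᵐ x, x ∈ tsupport φ → w x = w' x) :
    TV w φ = TV w' φ := by
  unfold TV
  exact iSup_congr fun X => by rw [integral_mul_dv_congr X.2 h]

lemma TV_mono {w φ ψ : Eu n → ℝ} (h : ∀ x, φ x ≤ ψ x) : TV w φ ≤ TV w ψ :=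
  TV_le fun _ hX => le_TV (hX.mono h)

lemma TV_const_mul {w φ : Eu n → ℝ} {c : ℝ} (hc : 0 ≤ c) :
    TV (fun x => c * w x) φ = ENNReal.ofReal c * TV w φ := by
  unfold TV
  rw [ENNReal.mul_iSup]
  refine iSup_congr fun X => ?_
  simp_rw [mul_assoc]
  rw [integral_const_mul, ENNReal.ofReal_mul hc]

lemma TV_weight_const_mul {w φ : Eu n → ℝ} {c : ℝ} (hc : 0 ≤ c) :
    TV w (fun x => c * φ x) = ENNReal.ofReal c * TV w φ := by
  have key : ∀ (c : ℝ) (φ : Eu n → ℝ), 0 < c →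
      ENNReal.ofReal c * TV w φ ≤ TV w (fun x => c * φ x) := by
    intro c φ hc
    unfold TV
    rw [ENNReal.mul_iSup]
    refine iSup_le fun X => ?_
    rw [← ENNReal.ofReal_mul hc.le, ← integral_const_mul]
    refine le_trans (le_of_eq ?_) (le_TV (X.2.const_smul hc.le))
    congr 2; ext x; rw [dv_smul X.2.1]; ring
  rcases hc.eq_or_lt with rfl | hc
  · simp only [ENNReal.ofReal_zero, zero_mul, ← nonpos_iff_eq_zero]
    refine TV_le fun X hX => ?_
    have : X = fun _ => 0 := by
      ext1 x
      have := hX.2.2 x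
      simpa using this
    have : ∀ x, dv X x = 0 := fun x => by
      apply dv_eq_zero_of_notMem; subst this; simp [tsupport]
    simp [this]
  · refine le_antisymm ?_ (key c φ hc)
    have h := key c⁻¹ (fun x => c * φ x) (inv_pos.2 hc)
    have e : (fun x => c⁻¹ * (c * φ x)) = φ := by ext x; field_simp
    rw [e] at h
    calc TV w (fun x => c * φ x)
        = ENNReal.ofReal c * (ENNReal.ofReal c⁻¹ * TV w (fun x => c * φ x)) := by
          rw [← mul_assoc, ← ENNReal.ofReal_mul hc.le, mul_inv_cancel₀ hc.ne']; simp
      _ ≤ _ := by gcongr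

lemma TV_le_of_smooth {w φ : Eu n → ℝ} (hw : ContDiff ℝ (⊤ : ℕ∞) w) (hφ : Continuous φ)
    (hφc : HasCompactSupport φ) : TV w φ ≤ ENNReal.ofReal (∫ x, φ x * ‖gradient w x‖) := by
  refine TV_le fun X hX => ENNReal.ofReal_le_ofReal ?_
  rw [integral_mul_dv hw hX.1 hX.2.1, ← integral_neg]
  refine integral_mono ?_ ?_ fun x => ?_
  · refine Continuous.integrable_of_hasCompactSupport ?_ ?_
    · exact ((continuous_gradient hw).inner hX.1.continuous).neg
    · refine hX.2.1.mono fun x hx => ?_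
      intro h; apply hx; simp [h]
  · exact (hφ.mul (continuous_gradient hw).norm).integrable_of_hasCompactSupport hφc.mul_right
  · have := abs_real_inner_le_norm (gradient w x) (X x)
    calc -⟪gradient w x, X x⟫ ≤ ‖gradient w x‖ * ‖X x‖ := (neg_le_abs _).trans this
      _ ≤ ‖gradient w x‖ * φ x := by gcongr; exact hX.2.2 x
      _ = _ := mul_comm _ _

/-- Lower semicontinuity of the weighted variation. -/
lemma TV_lsc {ι : Type*} {l : Filter ι} {w : Eu n → ℝ} {wj : ι → Eu n → ℝ} {φ : Eu n → ℝ}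
    (hφ : HasCompactSupport φ)
    (hw : IntegrableOn w (tsupport φ)) (hwj : ∀ᶠ j in l, IntegrableOn (wj j) (tsupport φ))
    (hlim : Tendsto (fun j => ∫ x in tsupport φ, |wj j x - w x|) l (𝓝 0))
    {c : ℝ≥0∞} (hc : c < TV w φ) : ∀ᶠ j in l, c < TV (wj j) φ := by
  obtain ⟨X, hX, hcX⟩ := lt_TV_iff.1 hc
  have hcont := continuous_dv hX.1
  have hsupp : HasCompactSupport (dv X) :=
    HasCompactSupport.intro hX.2.1.isCompact fun x hx => dv_eq_zero_of_notMem hx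
  obtain ⟨M, hM⟩ := hsupp.exists_bound_of_continuous hcont
  have hconv : Tendsto (fun j => ∫ x, wj j x * dv X x) l (𝓝 (∫ x, w x * dv X x)) := by
    rw [tendsto_iff_dist_tendsto_zero]
    have h0 : Tendsto (fun j => (∫ x in tsupport φ, |wj j x - w x|) * M) l (𝓝 0) := by
      simpa using hlim.mul_const M
    refine tendsto_of_tendsto_of_tendsto_of_le_of_le' tendsto_const_nhds h0
      (Eventually.of_forall fun _ => dist_nonneg) ?_
    filter_upwards [hwj] with j hj
    rw [Real.dist_eq, ← integral_sub (hX.integrable hφ hj) (hX.integrable hφ hw)]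
    have e : ∫ x, (wj j x * dv X x - w x * dv X x)
        = ∫ x in tsupport φ, (wj j x * dv X x - w x * dv X x) := by
      rw [setIntegral_eq_integral_of_forall_compl_eq_zero]
      intro x hx
      simp [dv_eq_zero_of_notMem fun h => hx (hX.tsupport_subset h)]
    rw [e, ← integral_mul_const]
    refine (abs_integral_le_integral_abs).trans ?_
    refine integral_mono_of_nonneg (Eventually.of_forall fun _ => abs_nonneg _)
      ((hj.sub hw).abs.mul_const M) (Eventually.of_forall fun x => ?_)
    simp only []
    rw [← sub_mul, abs_mul]
    gcongr
    exact hM x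
  filter_upwards [(ENNReal.tendsto_ofReal hconv).eventually (lt_mem_nhds hcX)] with j hj
  exact hj.trans_le (le_TV hX)

lemma TV_add_le {w φ ψ : Eu n → ℝ} (hφ : HasCompactSupport φ) (hψ : HasCompactSupport ψ)
    (hφ0 : ∀ x, 0 ≤ φ x) (hψ0 : ∀ x, 0 ≤ ψ x)
    (hw : IntegrableOn w (tsupport φ)) (hw' : IntegrableOn w (tsupport ψ)) :
    TV w φ + TV w ψ ≤ TV w (fun x => φ x + ψ x) := by
  have hz : ∀ φ : Eu n → ℝ, (∀ x, 0 ≤ φ x) → Fld φ (fun _ => (0 : Eu n)) := fun φ h =>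
    ⟨contDiff_const, HasCompactSupport.zero, fun x => by simpa using h x⟩
  have : Nonempty {X : Eu n → Eu n // Fld φ X} := ⟨⟨_, hz φ hφ0⟩⟩
  have : Nonempty {X : Eu n → Eu n // Fld ψ X} := ⟨⟨_, hz ψ hψ0⟩⟩
  have zero0 : ∀ x, dv (fun _ => (0 : Eu n)) x = 0 := fun x =>
    dv_eq_zero_of_notMem (by simp [tsupport, Function.support])
  conv_lhs => unfold TV
  refine ENNReal.iSup_add_iSup_le fun X Y => ?_
  have add_le : ∀ X Y : Eu n → Eu n, Fld φ X → Fld ψ Y →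
      ENNReal.ofReal ((∫ x, w x * dv X x) + ∫ x, w x * dv Y x) ≤ TV w (fun x => φ x + ψ x) := by
    intro X Y hX hY
    refine le_trans (le_of_eq ?_) (le_TV (hX.add hY))
    rw [← integral_add (hX.integrable hφ hw) (hY.integrable hψ hw')]
    congr 2; ext x; rw [dv_add hX.1 hY.1]; ring
  rcases le_total (∫ x, w x * dv X.1 x) 0 with h1 | h1
  · rw [ENNReal.ofReal_of_nonpos h1, zero_add]
    simpa [zero0] using add_le _ _ (hz φ hφ0) Y.2
  rcases le_total (∫ x, w x * dv Y.1 x) 0 with h2 | h2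
  · rw [ENNReal.ofReal_of_nonpos h2, add_zero]
    simpa [zero0] using add_le _ _ X.2 (hz ψ hψ0)
  · rw [← ENNReal.ofReal_add h1 h2]; exact add_le _ _ X.2 Y.2

lemma TV_le_add {Ω : Set (Eu n)} (hΩ : IsOpen Ω) {w φ ψ : Eu n → ℝ}
    (hφ : IsTest Ω φ) (hψ : IsTest Ω ψ)
    (hφ0 : ∀ x, 0 ≤ φ x) (hψ0 : ∀ x, 0 ≤ ψ x)
    (hw : ∀ K ⊆ Ω, IsCompact K → IntegrableOn w K)
    (hfin : ∀ χ, IsTest Ω χ → (∀ x, 0 ≤ χ x) → TV w χ ≠ ⊤) :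
    TV w (fun x => φ x + ψ x) ≤ TV w φ + TV w ψ := by
  refine TV_le fun X hX => ?_
  have hs := hφ.add hψ
  obtain ⟨χ, hχ, hχ0, hχ1, U, hU, hKU, hUΩ, hχU⟩ := exists_cutoff hΩ hs.2.1.isCompact hs.2.2
  have hest : ∀ η : ℝ, 0 < η → ∫ x, w x * dv X x ≤
      (TV w φ).toReal + (TV w ψ).toReal + η * (TV w χ).toReal := by
    intro η hη
    have hD : ∀ x, 0 < φ x + ψ x + η := fun x => by linarith [hφ0 x, hψ0 x]
    have hDs : ContDiff ℝ (⊤ : ℕ∞) (fun x => φ x + ψ x + η) := hs.1.add contDiff_const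
    have hpiece : ∀ g ζ : Eu n → ℝ, ContDiff ℝ (⊤ : ℕ∞) g → (∀ x, 0 ≤ g x) →
        (∀ x ∈ tsupport X, g x ≤ ζ x) → (∀ x, 0 ≤ ζ x) →
        Fld ζ (fun x => (g x / (φ x + ψ x + η)) • X x) := by
      intro g ζ hg hg0 hgζ hζ0
      have hsm : ContDiff ℝ (⊤ : ℕ∞) (fun x => g x / (φ x + ψ x + η)) :=
        hg.div hDs fun x => (hD x).ne'
      refine ⟨hsm.smul hX.1, hX.2.1.mono fun x hx h => hx (by simp [h]), fun x => ?_⟩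
      by_cases hx : x ∈ tsupport X
      · have h1 : φ x + ψ x ≤ φ x + ψ x + η := by linarith
        rw [norm_smul, Real.norm_of_nonneg (div_nonneg (hg0 x) (hD x).le)]
        calc g x / (φ x + ψ x + η) * ‖X x‖ ≤ g x / (φ x + ψ x + η) * (φ x + ψ x + η) := by
              gcongr
              · exact div_nonneg (hg0 x) (hD x).le
              · exact (hX.2.2 x).trans h1
          _ = g x := div_mul_cancel₀ _ (hD x).ne'
          _ ≤ ζ x := hgζ x hx
      · simpa [image_eq_zero_of_notMem_tsupport hx] using hζ0 x
    have F1 := hpiece φ φ hφ.1 hφ0 (fun _ _ => le_rfl) hφ0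
    have F2 := hpiece ψ ψ hψ.1 hψ0 (fun _ _ => le_rfl) hψ0
    have F3 := hpiece (fun _ => η) (fun x => η * χ x) contDiff_const (fun _ => hη.le)
      (fun x hx => by rw [hχU x (hKU (hX.tsupport_subset hx))]; simp)
      (fun x => mul_nonneg hη.le (hχ0 x))
    have hwint : ∀ ζ, IsTest Ω ζ → ∀ Y, Fld ζ Y → Integrable (fun x => w x * dv Y x) :=
      fun ζ hζ Y hY => hY.integrable hζ.2.1 (hw _ hζ.2.2 hζ.2.1)
    have hsum : ∀ x, w x * dv X x = w x * dv (fun x => (φ x / (φ x + ψ x + η)) • X x) x +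
        w x * dv (fun x => (ψ x / (φ x + ψ x + η)) • X x) x +
        w x * dv (fun x => (η / (φ x + ψ x + η)) • X x) x := by
      intro x
      rw [← mul_add, ← mul_add, ← dv_add F1.1 F2.1, ← dv_add (F1.1.add F2.1) F3.1]
      congr 2
      ext1 y
      rw [← add_smul, ← add_smul]
      have := (hD y).ne'
      rw [show φ y / (φ y + ψ y + η) + ψ y / (φ y + ψ y + η) + η / (φ y + ψ y + η) = 1 by
        field_simp, one_smul]
    have hηχ := hχ.const_mul η
    have i1 := hwint _ hφ _ F1
    have i2 := hwint _ hψ _ F2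
    have i3 := hwint _ hηχ _ F3
    rw [integral_congr_ae (Eventually.of_forall hsum), integral_add (i1.fun_add i2) i3,
      integral_add i1 i2]
    have e1 := integral_le_TV_toReal F1 (hfin _ hφ hφ0)
    have e2 := integral_le_TV_toReal F2 (hfin _ hψ hψ0)
    have e3 := integral_le_TV_toReal F3 (hfin _ hηχ fun x => mul_nonneg hη.le (hχ0 x))
    rw [TV_weight_const_mul hη.le, ENNReal.toReal_mul, ENNReal.toReal_ofReal hη.le] at e3
    linarith
  have hlim : ∫ x, w x * dv X x ≤ (TV w φ).toReal + (TV w ψ).toReal := by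
    refine le_of_forall_pos_le_add fun ε hε => ?_
    have hpos : 0 < (TV w χ).toReal + 1 := by positivity
    have := hest (ε / ((TV w χ).toReal + 1)) (by positivity)
    have h2 : ε / ((TV w χ).toReal + 1) * (TV w χ).toReal ≤ ε := by
      rw [div_mul_eq_mul_div, div_le_iff₀ hpos]; nlinarith
    linarith
  have hne : TV w φ + TV w ψ ≠ ⊤ := ENNReal.add_ne_top.2 ⟨hfin _ hφ hφ0, hfin _ hψ hψ0⟩
  refine ENNReal.ofReal_le_of_le_toReal ?_
  rwa [ENNReal.toReal_add (hfin _ hφ hφ0) (hfin _ hψ hψ0)]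

lemma LocFinOn.integrable {Ω : Set (Eu n)} {ν : Measure (Eu n)} (hν : LocFinOn Ω ν)
    {φ : Eu n → ℝ} (hφ : Continuous φ) (hc : HasCompactSupport φ) (hs : tsupport φ ⊆ Ω) :
    Integrable φ ν := by
  obtain ⟨C, hC⟩ := hc.exists_bound_of_continuous hφ
  have h1 : IntegrableOn φ (tsupport φ) ν :=
    Measure.integrableOn_of_bounded (hν.1 _ hs hc.isCompact).ne hφ.aestronglyMeasurable (M := C)
      (Eventually.of_forall hC)
  exact (integrableOn_iff_integrable_of_support_subset (subset_tsupport φ)).1 h1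

lemma LocFinOn.integrable_test {Ω : Set (Eu n)} {ν : Measure (Eu n)} (hν : LocFinOn Ω ν)
    {φ : Eu n → ℝ} (hφ : IsTest Ω φ) : Integrable φ ν :=
  hν.integrable hφ.continuous hφ.2.1 hφ.2.2

lemma setIntegral_eq_of_tsupport {E : Type*} [NormedAddCommGroup E] [NormedSpace ℝ E]
    {Ω : Set (Eu n)} {f : Eu n → E} {φ : Eu n → ℝ}
    (hφ : tsupport φ ⊆ Ω) (h : ∀ x, x ∉ tsupport φ → f x = 0) :
    ∫ x in Ω, f x = ∫ x, f x :=
  setIntegral_eq_integral_of_forall_compl_eq_zero fun x hx => h x fun h' => hx (hφ h')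

lemma integrable_smul_polar {ν : Measure (Eu n)} {θ : Eu n → Eu n} {φ : Eu n → ℝ}
    (hθ : ∀ᵐ x ∂ν, ‖θ x‖ = 1) (hφ : Integrable φ ν)
    (hm : AEStronglyMeasurable (fun x => φ x • θ x) ν) : Integrable (fun x => φ x • θ x) ν := by
  refine hφ.mono hm ?_
  filter_upwards [hθ] with x hx
  rw [norm_smul, hx, mul_one]

lemma integrable_smul_gradient {Ω : Set (Eu n)} {u φ : Eu n → ℝ}
    (hu : ∀ K ⊆ Ω, IsCompact K → IntegrableOn u K) (hφ : IsTest Ω φ) :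
    Integrable (fun x => u x • gradient φ x) := by
  have h1 : IntegrableOn (fun x => u x • gradient φ x) (tsupport φ) :=
    (hu _ hφ.2.2 hφ.2.1).smul_continuousOn (continuous_gradient hφ.1).continuousOn hφ.2.1
  refine (integrableOn_iff_integrable_of_support_subset fun x hx => ?_).1 h1
  by_contra h
  exact hx (by simp [gradient_eq_zero_of_notMem h])

/-- If the polar vector is not measurable, then the distributional gradient vanishes. -/
lemma HasGradMeasure.eq_zero_of_not_measurable {Ω : Set (Eu n)} {u : Eu n → ℝ}
    {ν : Measure (Eu n)} {θ : Eu n → Eu n}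
    (hu : ∀ K ⊆ Ω, IsCompact K → IntegrableOn u K)
    (h : HasGradMeasure Ω u ν θ) {φ₀ : Eu n → ℝ} (hφ₀ : IsTest Ω φ₀)
    (hm : ¬ AEStronglyMeasurable (fun x => φ₀ x • θ x) ν) {ψ : Eu n → ℝ} (hψ : IsTest Ω ψ) :
    ∫ x in Ω, u x • gradient ψ x = 0 := by
  have zero : ∀ φ, IsTest Ω φ → ¬ AEStronglyMeasurable (fun x => φ x • θ x) ν →
      ∫ x in Ω, u x • gradient φ x = 0 := by
    intro φ hφ hm
    rw [h.2.2 φ hφ, integral_undef fun hi => hm hi.1, neg_zero]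
  by_cases hmψ : AEStronglyMeasurable (fun x => ψ x • θ x) ν
  · have h1 : ¬ AEStronglyMeasurable (fun x => (φ₀ x + ψ x) • θ x) ν := by
      intro h2
      apply hm
      refine (h2.sub hmψ).congr (Eventually.of_forall fun x => ?_)
      simp [add_smul]
    have h3 := zero _ (hφ₀.add hψ) h1
    have h4 := zero _ hφ₀ hm
    have i1 := (integrable_smul_gradient hu hφ₀).integrableOn (s := Ω)
    have i2 := (integrable_smul_gradient hu hψ).integrableOn (s := Ω)
    simp only [gradient_add hφ₀.1 hψ.1, smul_add] at h3
    rw [integral_add i1 i2, h4, zero_add] at h3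
    exact h3
  · exact zero _ hψ hmψ

lemma Fld.coord_isTest {Ω : Set (Eu n)} {φ : Eu n → ℝ} {X : Eu n → Eu n} (hX : Fld φ X)
    (hφ : tsupport φ ⊆ Ω) (i : Fin n) : IsTest Ω (fun x => X x i) :=
  ⟨coord_smooth hX.1 i, coord_compact hX.2.1 i,
    (coord_support i).trans (hX.tsupport_subset.trans hφ)⟩

lemma integral_mul_dv_eq_sum {Ω : Set (Eu n)} {u φ : Eu n → ℝ} {X : Eu n → Eu n}
    (hu : ∀ K ⊆ Ω, IsCompact K → IntegrableOn u K) (hX : Fld φ X) (hφ : tsupport φ ⊆ Ω) :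
    ∫ x, u x * dv X x =
      ∑ i, ⟪∫ x in Ω, u x • gradient (fun y => X y i) x, stdVec i⟫ := by
  have hi := fun i => integrable_smul_gradient hu (hX.coord_isTest hφ i)
  have e : ∀ i, ⟪∫ x in Ω, u x • gradient (fun y => X y i) x, stdVec i⟫
      = ∫ x, u x * fderiv ℝ (fun y => X y i) x (stdVec i) := by
    intro i
    rw [setIntegral_eq_of_tsupport (hX.coord_isTest hφ i).2.2
      (fun x hx => by simp [gradient_eq_zero_of_notMem hx]), real_inner_comm,
      ← integral_inner (hi i)]
    refine integral_congr_ae (Eventually.of_forall fun x => ?_)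
    simp only [inner_smul_right, inner_gradient_eq']
  simp_rw [e]
  rw [← integral_finsetSum]
  · simp only [dv, Finset.mul_sum]
  · intro i _
    have := (hi i).const_inner (𝕜 := ℝ) (stdVec i)
    simpa only [inner_smul_right, inner_gradient_eq'] using this

lemma TV_le_of_hasGradMeasure {Ω : Set (Eu n)} {u φ : Eu n → ℝ}
    {ν : Measure (Eu n)} {θ : Eu n → Eu n}
    (hu : ∀ K ⊆ Ω, IsCompact K → IntegrableOn u K) (hν : LocFinOn Ω ν)
    (h : HasGradMeasure Ω u ν θ) (hφ : IsTest Ω φ) (hφ0 : ∀ x, 0 ≤ φ x) :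
    TV u φ ≤ ENNReal.ofReal (∫ x, φ x ∂ν) := by
  refine TV_le fun X hX => ENNReal.ofReal_le_ofReal ?_
  rw [integral_mul_dv_eq_sum hu hX hφ.2.2]
  have ht := fun i => hX.coord_isTest hφ.2.2 i
  by_cases hm : ∀ ψ, IsTest Ω ψ → AEStronglyMeasurable (fun x => ψ x • θ x) ν
  · have hi := fun i => integrable_smul_polar h.1 (hν.integrable_test (ht i)) (hm _ (ht i))
    have hi2 : ∀ i, Integrable (fun x => X x i * ⟪θ x, stdVec i⟫) ν := fun i => by
      simpa only [inner_smul_left, RCLike.conj_to_real] using (hi i).inner_const (𝕜 := ℝ) (stdVec i)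
    have e : ∀ i, ⟪∫ x in Ω, u x • gradient (fun y => X y i) x, stdVec i⟫
        = - ∫ x, X x i * ⟪θ x, stdVec i⟫ ∂ν := by
      intro i
      rw [h.2.2 _ (ht i), inner_neg_left, real_inner_comm, ← integral_inner (hi i)]
      congr 1
      refine integral_congr_ae (Eventually.of_forall fun x => ?_)
      simp only [inner_smul_right, real_inner_comm]
    simp_rw [e]
    rw [Finset.sum_neg_distrib, ← integral_finsetSum _ fun i _ => hi2 i, ← integral_neg]
    refine integral_mono_ae (integrable_finsetSum _ fun i _ => hi2 i).neg
      (hν.integrable_test hφ) ?_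
    filter_upwards [h.1] with x hx
    have e2 : ∑ i, X x i * ⟪θ x, stdVec i⟫ = ⟪X x, θ x⟫ := by
      rw [PiLp.inner_apply]
      refine Finset.sum_congr rfl fun i _ => ?_
      rw [EuclideanSpace.inner_single_right]
      simp [mul_comm]
    simp only [e2]
    calc -⟪X x, θ x⟫ ≤ ‖X x‖ * ‖θ x‖ := (neg_le_abs _).trans (abs_real_inner_le_norm _ _)
      _ ≤ φ x := by rw [hx, mul_one]; exact hX.2.2 x
  · push Not at hm
    obtain ⟨ψ, hψ, hmψ⟩ := hm
    simp only [h.eq_zero_of_not_measurable hu hψ hmψ (ht _), inner_zero_left,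
      Finset.sum_const_zero]
    exact integral_nonneg hφ0

/-- The volume of the unit ball. -/
def unitVol (n : ℕ) : ℝ := (volume : Measure (Eu n)).real (ball 0 1)

lemma unitVol_pos (n : ℕ) : 0 < unitVol n :=
  ENNReal.toReal_pos (measure_ball_pos _ _ one_pos).ne' measure_ball_lt_top.ne

lemma volume_ball_eq (x : Eu n) {r : ℝ} (hr : 0 < r) :
    volume (ball x r) = ENNReal.ofReal (r ^ n * unitVol n) := by
  rw [Measure.addHaar_ball_of_pos _ _ hr, ENNReal.ofReal_mul (by positivity), unitVol,
    Measure.real, ENNReal.ofReal_toReal measure_ball_lt_top.ne]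
  simp

lemma volume_real_ball (x : Eu n) {r : ℝ} (hr : 0 < r) :
    volume.real (ball x r) = r ^ n * unitVol n := by
  rw [Measure.real, volume_ball_eq x hr, ENNReal.toReal_ofReal]
  have := unitVol_pos n
  positivity

lemma volume_real_closedBall (x : Eu n) {r : ℝ} (hr : 0 < r) :
    volume.real (closedBall x r) = r ^ n * unitVol n := by
  rw [Measure.real, Measure.addHaar_closedBall _ _ hr.le, ← volume_real_ball x hr, Measure.real,
    Measure.addHaar_ball_of_pos _ _ hr]

/-- A smooth bump with inner radius `ε / 2` and outer radius `ε`. -/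
def bmp (n : ℕ) (ε : ℝ) : ContDiffBump (0 : Eu n) :=
  if h : 0 < ε then ⟨ε / 2, ε, half_pos h, half_lt_self h⟩
  else ⟨1 / 2, 1, by norm_num, by norm_num⟩

lemma bmp_rOut {ε : ℝ} (h : 0 < ε) : (bmp n ε).rOut = ε := by simp [bmp, h]

lemma bmp_rIn {ε : ℝ} (h : 0 < ε) : (bmp n ε).rIn = ε / 2 := by simp [bmp, h]

/-- The standard mollifier at scale `ε`. -/
def rho (ε : ℝ) (x : Eu n) : ℝ := (bmp n ε).normed volume x

lemma rho_nonneg (ε : ℝ) (x : Eu n) : 0 ≤ rho ε x := (bmp n ε).nonneg_normed x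

lemma contDiff_rho (ε : ℝ) : ContDiff ℝ (⊤ : ℕ∞) (rho (n := n) ε) := (bmp n ε).contDiff_normed

lemma continuous_rho (ε : ℝ) : Continuous (rho (n := n) ε) := (contDiff_rho ε).continuous

lemma rho_neg (ε : ℝ) (x : Eu n) : rho ε (-x) = rho ε x := (bmp n ε).normed_neg x

lemma rho_sub_comm (ε : ℝ) (x y : Eu n) : rho ε (x - y) = rho ε (y - x) := by
  rw [← neg_sub, rho_neg]

lemma hasCompactSupport_rho (ε : ℝ) : HasCompactSupport (rho (n := n) ε) :=
  (bmp n ε).hasCompactSupport_normed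

lemma integral_rho (ε : ℝ) : ∫ x : Eu n, rho ε x = 1 := (bmp n ε).integral_normed

lemma rho_eq_zero {ε : ℝ} (hε : 0 < ε) {x : Eu n} (hx : ε ≤ ‖x‖) : rho ε x = 0 := by
  have h := (bmp n ε).support_normed_eq (μ := volume)
  rw [bmp_rOut hε] at h
  by_contra h0
  have : x ∈ Function.support ((bmp n ε).normed volume) := h0
  rw [h, mem_ball_zero_iff] at this
  linarith

lemma rho_le {ε : ℝ} (hε : 0 < ε) (x : Eu n) : rho ε x ≤ 1 / ((ε / 2) ^ n * unitVol n) := by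
  have := (bmp n ε).normed_le_div_measure_closedBall_rIn (μ := volume) x
  rwa [bmp_rIn hε, volume_real_closedBall _ (half_pos hε)] at this

lemma le_rho {ε : ℝ} (hε : 0 < ε) {x : Eu n} (hx : ‖x‖ ≤ ε / 2) :
    1 / (ε ^ n * unitVol n) ≤ rho ε x := by
  have h1 := (bmp n ε).integral_le_measure_closedBall (μ := volume)
  rw [bmp_rOut hε, volume_real_closedBall _ hε] at h1
  rw [rho, ContDiffBump.normed_def, (bmp n ε).one_of_mem_closedBall]
  · exact one_div_le_one_div_of_le ((bmp n ε).integral_pos (μ := volume)) h1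
  · rw [mem_closedBall_zero_iff, bmp_rIn hε]; exact hx

/-- Mollification of `w` at scale `ε`. -/
def moll (ε : ℝ) (w : Eu n → ℝ) (x : Eu n) : ℝ := ∫ y, rho ε (x - y) * w y

open scoped Convolution in
lemma moll_eq_convolution (ε : ℝ) (w : Eu n → ℝ) :
    moll ε w = ((bmp n ε).normed volume ⋆[ContinuousLinearMap.lsmul ℝ ℝ, volume] w) := by
  ext x
  rw [convolution_lsmul_swap]
  rfl

lemma contDiff_moll (ε : ℝ) {w : Eu n → ℝ} (hw : LocallyIntegrable w) :
    ContDiff ℝ (⊤ : ℕ∞) (moll ε w) := by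
  rw [moll_eq_convolution]
  exact (bmp n ε).hasCompactSupport_normed.contDiff_convolution_left _
    (bmp n ε).contDiff_normed hw

lemma hasCompactSupport_rho_sub (ε : ℝ) (x : Eu n) :
    HasCompactSupport (fun y => rho ε (x - y)) :=
  (hasCompactSupport_rho ε).comp_homeomorph (Homeomorph.subLeft x)

lemma continuous_rho_sub (ε : ℝ) (x : Eu n) : Continuous (fun y => rho ε (x - y)) :=
  (continuous_rho ε).comp (continuous_const.sub continuous_id)

lemma contDiff_rho_sub (ε : ℝ) (x : Eu n) : ContDiff ℝ (⊤ : ℕ∞) (fun y => rho ε (x - y)) :=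
  (contDiff_rho ε).comp (contDiff_const.sub contDiff_id)

lemma tsupport_rho_sub_subset {ε : ℝ} (hε : 0 < ε) (x : Eu n) :
    tsupport (fun y => rho ε (x - y)) ⊆ closedBall x ε := by
  refine closure_minimal (fun y hy => ?_) isClosed_closedBall
  by_contra h
  rw [mem_closedBall, dist_comm, dist_eq_norm, not_le] at h
  exact hy (rho_eq_zero hε h.le)

lemma integrable_rho_sub (ε : ℝ) (x : Eu n) : Integrable (fun y => rho ε (x - y)) :=
  (continuous_rho_sub ε x).integrable_of_hasCompactSupport (hasCompactSupport_rho_sub ε x)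

lemma integral_rho_sub (ε : ℝ) (x : Eu n) : ∫ y, rho ε (x - y) = 1 := by
  rw [integral_sub_left_eq_self (rho ε) volume x, integral_rho]

lemma integrable_rho_mul {w : Eu n → ℝ} (hw : LocallyIntegrable w) (ε : ℝ)
    (x : Eu n) : Integrable (fun y => rho ε (x - y) * w y) := by
  have := Integrable.mul_of_tsupport_subset (hasCompactSupport_rho_sub ε x).isCompact
    (hw.integrableOn_isCompact (hasCompactSupport_rho_sub ε x).isCompact) (continuous_rho_sub ε x)
    (subset_tsupport _)
  simpa only [mul_comm] using this

lemma moll_const (ε c : ℝ) (x : Eu n) : moll ε (fun _ => c) x = c := by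
  rw [moll, integral_mul_const, integral_rho_sub, one_mul]

lemma moll_mono {v w : Eu n → ℝ} (hv : LocallyIntegrable v) (hw : LocallyIntegrable w)
    (h : ∀ x, v x ≤ w x) (ε : ℝ) (x : Eu n) : moll ε v x ≤ moll ε w x :=
  integral_mono (integrable_rho_mul hv ε x) (integrable_rho_mul hw ε x)
    fun y => mul_le_mul_of_nonneg_left (h y) (rho_nonneg _ _)

lemma locallyIntegrable_const' (c : ℝ) : LocallyIntegrable (fun _ : Eu n => c) :=
  locallyIntegrable_const c

lemma moll_le {w : Eu n → ℝ} (hw : LocallyIntegrable w) {b : ℝ} (h : ∀ x, w x ≤ b) (ε : ℝ)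
    (x : Eu n) : moll ε w x ≤ b :=
  (moll_mono hw (locallyIntegrable_const' b) h ε x).trans (moll_const ε b x).le

lemma le_moll {w : Eu n → ℝ} (hw : LocallyIntegrable w) {b : ℝ} (h : ∀ x, b ≤ w x) (ε : ℝ)
    (x : Eu n) : b ≤ moll ε w x :=
  (moll_const ε b x).ge.trans (moll_mono (locallyIntegrable_const' b) hw h ε x)

lemma moll_add {v w : Eu n → ℝ} (hv : LocallyIntegrable v) (hw : LocallyIntegrable w) (ε : ℝ)
    (x : Eu n) : moll ε (fun y => v y + w y) x = moll ε v x + moll ε w x := by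
  simp only [moll, mul_add]
  exact integral_add (integrable_rho_mul hv ε x) (integrable_rho_mul hw ε x)

lemma moll_const_mul (w : Eu n → ℝ) (ε c : ℝ) (x : Eu n) :
    moll ε (fun y => c * w y) x = c * moll ε w x := by
  simp only [moll, ← integral_const_mul]
  congr 1; ext y; ring

lemma tendsto_bmp_rOut : Tendsto (fun ε => (bmp n ε).rOut) (𝓝[>] 0) (𝓝 0) := by
  refine Tendsto.congr' (f₁ := fun ε : ℝ => ε) ?_ (tendsto_id.mono_left nhdsWithin_le_nhds)
  filter_upwards [self_mem_nhdsWithin] with ε hε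
  rw [bmp_rOut hε]

lemma ae_tendsto_moll {w : Eu n → ℝ} (hw : LocallyIntegrable w) :
    ∀ᵐ x, Tendsto (fun ε => moll ε w x) (𝓝[>] 0) (𝓝 (w x)) := by
  simp_rw [moll_eq_convolution]
  refine ContDiffBump.ae_convolution_tendsto_right_of_locallyIntegrable (K := 2)
    tendsto_bmp_rOut ?_ hw
  filter_upwards [self_mem_nhdsWithin] with ε hε
  rw [bmp_rOut hε, bmp_rIn hε]; linarith

lemma locallyIntegrable_of_bdd {w : Eu n → ℝ} (hw : Measurable w) {M : ℝ} (hM : ∀ x, |w x| ≤ M) :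
    LocallyIntegrable w :=
  (locallyIntegrable_const' M).mono hw.aestronglyMeasurable
    (Eventually.of_forall fun x => by
      rw [Real.norm_eq_abs, Real.norm_eq_abs, abs_of_nonneg ((abs_nonneg _).trans (hM x))]
      exact hM x)

lemma abs_moll_le {w : Eu n → ℝ} (hw : LocallyIntegrable w) {M : ℝ} (hM : ∀ x, |w x| ≤ M)
    (ε : ℝ) (x : Eu n) : |moll ε w x| ≤ M :=
  abs_le.2 ⟨le_moll hw (fun x => (abs_le.1 (hM x)).1) ε x,
    moll_le hw (fun x => (abs_le.1 (hM x)).2) ε x⟩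

/-- `L¹` convergence on finite-measure sets of `f (w_ε)` for bounded `w` and continuous `f`. -/
lemma tendsto_integral_comp_moll {w : Eu n → ℝ} (hw : Measurable w) {M : ℝ} (hM : ∀ x, |w x| ≤ M)
    {f : ℝ → ℝ} (hf : Continuous f) {K : Set (Eu n)} (hK : IsCompact K) :
    Tendsto (fun ε => ∫ x in K, |f (moll ε w x) - f (w x)|) (𝓝[>] 0) (𝓝 0) := by
  have hl := locallyIntegrable_of_bdd hw hM
  obtain ⟨C, hC⟩ := (isCompact_Icc (a := -M) (b := M)).exists_bound_of_continuousOn hf.continuousOn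
  have : Tendsto (fun ε => ∫ x in K, |f (moll ε w x) - f (w x)|) (𝓝[>] 0)
      (𝓝 (∫ x in K, (0 : ℝ))) := by
    refine tendsto_integral_filter_of_dominated_convergence (fun _ => C + C) ?_ ?_ ?_ ?_
    · refine Eventually.of_forall fun ε => ?_
      have h1 := (contDiff_moll ε hl).continuous.measurable
      exact ((((hf.measurable.comp h1).sub (hf.measurable.comp hw)).abs).aestronglyMeasurable)
    · refine Eventually.of_forall fun ε => Eventually.of_forall fun x => ?_
      rw [Real.norm_eq_abs, abs_abs]
      refine (abs_sub _ _).trans (add_le_add (hC _ ?_) (hC _ ?_))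
      · exact abs_le.1 (abs_moll_le hl hM ε x)
      · exact abs_le.1 (hM x)
    · exact integrableOn_const (hs := hK.measure_lt_top.ne)
    · filter_upwards [ae_restrict_of_ae (ae_tendsto_moll hl)] with x hx
      have := (((hf.tendsto _).comp hx).sub_const (f (w x))).abs
      simpa using this
  simpa using this

/-- Uniform convergence of mollifications of compactly supported continuous functions. -/
lemma moll_uniform {f : Eu n → ℝ} (hf : Continuous f) (hc : HasCompactSupport f) {η : ℝ}
    (hη : 0 < η) : ∀ᶠ ε in 𝓝[>] (0 : ℝ), ∀ x, |moll ε f x - f x| ≤ η := by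
  have hu := hc.uniformContinuous_of_continuous hf
  obtain ⟨δ, hδ, h⟩ := Metric.uniformContinuous_iff.1 hu η hη
  have : ∀ᶠ ε in 𝓝[>] (0 : ℝ), ε < δ := (gt_mem_nhds hδ).filter_mono nhdsWithin_le_nhds
  filter_upwards [self_mem_nhdsWithin, this] with ε hε hεδ x
  rw [moll_eq_convolution, ← Real.dist_eq]
  refine ContDiffBump.dist_normed_convolution_le hf.aestronglyMeasurable fun y hy => ?_
  rw [bmp_rOut hε, mem_ball] at hy
  exact (h (hy.trans hεδ)).le

lemma moll_eq_zero {ε : ℝ} (hε : 0 < ε) {w : Eu n → ℝ} {x : Eu n}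
    (h : ∀ y ∈ ball x ε, w y = 0) : moll ε w x = 0 := by
  rw [moll]
  refine integral_eq_zero_of_ae (Eventually.of_forall fun y => ?_)
  by_cases hy : y ∈ ball x ε
  · simp [h y hy]
  · rw [mem_ball, dist_comm, dist_eq_norm, not_lt] at hy
    simp [rho_eq_zero hε hy]

lemma tsupport_moll_subset {ε : ℝ} (hε : 0 < ε) (w : Eu n → ℝ) :
    tsupport (moll ε w) ⊆ cthickening ε (tsupport w) := by
  refine closure_minimal (fun x hx => ?_) isClosed_cthickening
  by_contra h
  refine hx (moll_eq_zero hε fun y hy => ?_)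
  by_contra h0
  apply h
  refine mem_cthickening_of_dist_le x y ε _ (subset_tsupport w h0) ?_
  rw [dist_comm]; exact (mem_ball.1 hy).le

/-- The gradient of a mollification as an integral against `w`. -/
lemma inner_gradient_moll (ε : ℝ) {w : Eu n → ℝ} (hw : LocallyIntegrable w) (x e : Eu n) :
    ⟪gradient (moll ε w) x, e⟫ = ∫ y, w y * dv (fun y => rho ε (x - y) • (-e)) y := by
  have h1 := ((bmp n ε).hasCompactSupport_normed (μ := volume)).hasFDerivAt_convolution_left
    (ContinuousLinearMap.lsmul ℝ ℝ) (μ := volume) ((bmp n ε).contDiff_normed (n := 1)) hw x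
  rw [← moll_eq_convolution] at h1
  rw [inner_gradient_eq, h1.fderiv, convolution_eq_swap]
  have hexists : Integrable (fun t => ((ContinuousLinearMap.lsmul ℝ ℝ).precompL (Eu n))
      (fderiv ℝ ((bmp n ε).normed volume) (x - t)) (w t)) := by
    have := ((bmp n ε).hasCompactSupport_normed (μ := volume)).fderiv (𝕜 := ℝ)
      |>.convolutionExists_left ((ContinuousLinearMap.lsmul ℝ ℝ).precompL (Eu n)) (μ := volume)
      (((bmp n ε).contDiff_normed (n := 1)).continuous_fderiv (by simp)) hw x
    exact this.integrable_swap
  rw [ContinuousLinearMap.integral_apply hexists]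
  refine integral_congr_ae (Eventually.of_forall fun y => ?_)
  simp only []
  rw [dv_smul_const (contDiff_rho_sub ε x), inner_gradient_eq]
  have h2 : HasFDerivAt (fun y => rho ε (x - y))
      ((fderiv ℝ (rho ε) (x - y)).comp (-ContinuousLinearMap.id ℝ (Eu n))) y :=
    (((contDiff_rho ε).differentiable (by simp) (x - y)).hasFDerivAt).comp y
      ((hasFDerivAt_id y).const_sub x)
  rw [h2.fderiv]
  simp [ContinuousLinearMap.precompL_apply, mul_comm]
  left; rfl

lemma norm_gradient_moll_le (ε : ℝ) {w : Eu n → ℝ} (hw : LocallyIntegrable w) (x : Eu n) :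
    ENNReal.ofReal ‖gradient (moll ε w) x‖ ≤ TV w (fun y => rho ε (x - y)) := by
  set g := gradient (moll ε w) x with hg
  rcases eq_or_ne g 0 with h0 | h0
  · simp [h0]
  set e : Eu n := (‖g‖⁻¹ : ℝ) • g with he
  have hne : ‖e‖ = 1 := by
    rw [he, norm_smul, norm_inv, norm_norm, inv_mul_cancel₀ (norm_ne_zero_iff.2 h0)]
  have h1 : ‖g‖ = ⟪g, e⟫ := by
    rw [he, inner_smul_right, real_inner_self_eq_norm_sq]
    field_simp [norm_ne_zero_iff.2 h0]
  rw [h1, hg, inner_gradient_moll ε hw]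
  refine le_TV ⟨(contDiff_rho_sub ε x).smul contDiff_const,
    (hasCompactSupport_rho_sub ε x).smul_right, fun y => ?_⟩
  rw [norm_smul, norm_neg, hne, mul_one, Real.norm_of_nonneg (rho_nonneg _ _)]

/-- Limit of a real sequence along a fixed non-principal ultrafilter. -/
def ulim (x : ℕ → ℝ) : ℝ := limUnder (hyperfilter ℕ : Filter ℕ) x

lemma tendsto_ulim {x : ℕ → ℝ} {C : ℝ} (h : ∀ᶠ j in (hyperfilter ℕ : Filter ℕ), |x j| ≤ C) :
    Tendsto x (hyperfilter ℕ) (𝓝 (ulim x)) := by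
  have h1 : ∀ᶠ j in (hyperfilter ℕ : Filter ℕ), x j ∈ Icc (-C) C := by
    filter_upwards [h] with j hj using abs_le.1 hj
  obtain ⟨a, -, ha⟩ := (isCompact_Icc (a := -C) (b := C)).ultrafilter_le_nhds
    ((hyperfilter ℕ).map x) (by rw [le_principal_iff]; exact h1)
  exact tendsto_nhds_limUnder ⟨a, ha⟩

lemma ulim_eq {x : ℕ → ℝ} {a : ℝ} (h : Tendsto x (hyperfilter ℕ) (𝓝 a)) : ulim x = a :=
  h.limUnder_eq

lemma tendsto_epsSeq : Tendsto (fun j : ℕ => 1 / ((j : ℝ) + 1)) atTop (𝓝[>] 0) :=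
  tendsto_nhdsWithin_iff.2 ⟨tendsto_one_div_add_atTop_nhds_zero_nat,
    Eventually.of_forall fun j => by simp only [mem_Ioi]; positivity⟩

/-- A positive, additive and positively homogeneous functional on nonnegative test functions. -/
structure PosFun (Ω : Set (Eu n)) (V : (Eu n → ℝ) → ℝ) : Prop where
  nonneg : ∀ φ, IsTest Ω φ → (∀ x, 0 ≤ φ x) → 0 ≤ V φ
  add : ∀ φ ψ, IsTest Ω φ → IsTest Ω ψ → (∀ x, 0 ≤ φ x) → (∀ x, 0 ≤ ψ x) →
    V (fun x => φ x + ψ x) = V φ + V ψ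
  smul : ∀ (c : ℝ) φ, 0 ≤ c → IsTest Ω φ → (∀ x, 0 ≤ φ x) → V (fun x => c * φ x) = c * V φ

lemma PosFun.mono {Ω : Set (Eu n)} {V : (Eu n → ℝ) → ℝ} (hV : PosFun Ω V) {φ ψ : Eu n → ℝ}
    (hφ : IsTest Ω φ) (hψ : IsTest Ω ψ) (hφ0 : ∀ x, 0 ≤ φ x) (h : ∀ x, φ x ≤ ψ x) : V φ ≤ V ψ := by
  have hd : ∀ x, 0 ≤ ψ x - φ x := fun x => sub_nonneg.2 (h x)
  have h1 := hV.add φ _ hφ (hψ.sub hφ) hφ0 hd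
  have h2 := hV.nonneg _ (hψ.sub hφ) hd
  have e : (fun x => φ x + (ψ x - φ x)) = ψ := by ext x; ring
  rw [e] at h1
  linarith

lemma exists_cutoff_moll {Ω : Set (Eu n)} (hΩ : IsOpen Ω) {K : Set (Eu n)} (hK : IsCompact K)
    (hKΩ : K ⊆ Ω) : ∃ χ, IsTest Ω χ ∧ (∀ x, 0 ≤ χ x) ∧ (∀ x, χ x ≤ 1) ∧ (∀ x ∈ K, χ x = 1) ∧
      ∀ᶠ ε in 𝓝[>] (0 : ℝ), ∀ g : Eu n → ℝ, Continuous g → tsupport g ⊆ K →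
        IsTest Ω (moll ε g) ∧ ∀ x ∈ tsupport (moll ε g), χ x = 1 := by
  obtain ⟨δ, hδ, hδΩ⟩ := hK.exists_cthickening_subset_open hΩ hKΩ
  have hKδ : IsCompact (cthickening δ K) := hK.cthickening
  obtain ⟨χ, hχ, h0, h1, U, hU, hKU, -, hχU⟩ := exists_cutoff hΩ hKδ hδΩ
  refine ⟨χ, hχ, h0, h1, fun x hx => hχU x (hKU (self_subset_cthickening K hx)), ?_⟩
  have : ∀ᶠ ε in 𝓝[>] (0 : ℝ), ε < δ := (gt_mem_nhds hδ).filter_mono nhdsWithin_le_nhds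
  filter_upwards [self_mem_nhdsWithin, this] with ε hε hεδ g hg hgK
  have hsub : tsupport (moll ε g) ⊆ cthickening δ K :=
    (tsupport_moll_subset hε g).trans ((cthickening_mono hεδ.le _).trans
      (cthickening_subset_of_subset δ hgK))
  exact ⟨⟨contDiff_moll ε hg.locallyIntegrable, hKδ.of_isClosed_subset (isClosed_tsupport _) hsub,
    hsub.trans hδΩ⟩, fun x hx => hχU x (hKU (hsub hx))⟩

/-- Extension by zero of a compactly supported function on `Ω`. -/
def zext {Ω : Set (Eu n)} (f : CompactlySupportedContinuousMap Ω NNReal) : Eu n → ℝ :=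
  Subtype.val.extend (fun x => (f x : ℝ)) 0

section zext
variable {Ω : Set (Eu n)}

lemma zext_apply (f : CompactlySupportedContinuousMap Ω NNReal) (x : Ω) : zext f x = f x :=
  Subtype.val_injective.extend_apply _ _ _

lemma zext_of_notMem (f : CompactlySupportedContinuousMap Ω NNReal) {x : Eu n} (hx : x ∉ Ω) :
    zext f x = 0 :=
  Function.extend_apply' _ _ _ (by rintro ⟨y, rfl⟩; exact hx y.2)

lemma zext_nonneg (f : CompactlySupportedContinuousMap Ω NNReal) (x : Eu n) : 0 ≤ zext f x := by
  by_cases hx : x ∈ Ω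
  · rw [show x = ((⟨x, hx⟩ : Ω) : Eu n) from rfl, zext_apply]; positivity
  · rw [zext_of_notMem f hx]

lemma hasCompactSupport_coe (f : CompactlySupportedContinuousMap Ω NNReal) :
    HasCompactSupport (fun x => (f x : ℝ)) :=
  f.hasCompactSupport'.mono fun x hx h => hx (by
    have : f x = 0 := h
    simp [this])

lemma continuous_zext (hΩ : IsOpen Ω) (f : CompactlySupportedContinuousMap Ω NNReal) :
    Continuous (zext f) :=
  (hasCompactSupport_coe f).continuous_extend_zero hΩ
    (NNReal.continuous_coe.comp f.continuous)

lemma tsupport_zext (f : CompactlySupportedContinuousMap Ω NNReal) :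
    tsupport (zext f) ⊆ Subtype.val '' tsupport (fun x => (f x : ℝ)) :=
  (hasCompactSupport_coe f).tsupport_extend_zero_subset continuous_subtype_val

lemma zext_isCompact (f : CompactlySupportedContinuousMap Ω NNReal) :
    IsCompact (Subtype.val '' tsupport (fun x => (f x : ℝ))) :=
  (hasCompactSupport_coe f).isCompact.image continuous_subtype_val

lemma zext_image_subset (f : CompactlySupportedContinuousMap Ω NNReal) :
    Subtype.val '' tsupport (fun x => (f x : ℝ)) ⊆ Ω := by
  rintro _ ⟨y, -, rfl⟩; exact y.2

lemma hasCompactSupport_zext (f : CompactlySupportedContinuousMap Ω NNReal) :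
    HasCompactSupport (zext f) :=
  (zext_isCompact f).of_isClosed_subset (isClosed_tsupport _) (tsupport_zext f)

end zext

lemma PosFun.eventually_bdd {Ω : Set (Eu n)} (hΩ : IsOpen Ω) {V : (Eu n → ℝ) → ℝ}
    (hV : PosFun Ω V) {g : Eu n → ℝ} (hg : Continuous g) (hc : HasCompactSupport g)
    (hs : tsupport g ⊆ Ω) (h0 : ∀ x, 0 ≤ g x) :
    ∃ C, ∀ᶠ ε in 𝓝[>] (0 : ℝ), |V (moll ε g)| ≤ C := by
  obtain ⟨χ, hχ, hχ0, hχ1, hχK, hev⟩ := exists_cutoff_moll hΩ hc.isCompact hs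
  obtain ⟨M, hM⟩ := hc.exists_bound_of_continuous hg
  have hM0 : 0 ≤ M := (norm_nonneg _).trans (hM 0)
  refine ⟨M * V χ, ?_⟩
  filter_upwards [hev] with ε hε
  obtain ⟨ht, hχt⟩ := hε g hg subset_rfl
  have hn : ∀ x, 0 ≤ moll ε g x := le_moll hg.locallyIntegrable h0 ε
  rw [abs_of_nonneg (hV.nonneg _ ht hn), ← hV.smul M χ hM0 hχ hχ0]
  refine hV.mono ht (hχ.const_mul M) hn fun x => ?_
  by_cases hx : x ∈ tsupport (moll ε g)
  · rw [hχt x hx, mul_one]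
    exact moll_le hg.locallyIntegrable (fun y => (le_abs_self _).trans (hM y)) ε x
  · rw [image_eq_zero_of_notMem_tsupport hx]; exact mul_nonneg hM0 (hχ0 x)

lemma eventually_hyper {p : ℝ → Prop} (h : ∀ᶠ ε in 𝓝[>] (0 : ℝ), p ε) :
    ∀ᶠ j : ℕ in (hyperfilter ℕ : Filter ℕ), p (1 / ((j : ℝ) + 1)) :=
  (tendsto_epsSeq.mono_left Nat.hyperfilter_le_atTop).eventually h

lemma PosFun.tendsto_moll {Ω : Set (Eu n)} (hΩ : IsOpen Ω) {V : (Eu n → ℝ) → ℝ}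
    (hV : PosFun Ω V) {φ : Eu n → ℝ} (hφ : IsTest Ω φ) (hφ0 : ∀ x, 0 ≤ φ x) :
    Tendsto (fun ε => V (moll ε φ)) (𝓝[>] 0) (𝓝 (V φ)) := by
  obtain ⟨χ, hχ, hχ0, hχ1, hχK, hev⟩ := exists_cutoff_moll hΩ hφ.2.1.isCompact hφ.2.2
  rw [Metric.tendsto_nhds]
  intro η hη
  have hVχ := hV.nonneg χ hχ hχ0
  set τ := η / (V χ + 1) / 2 with hτ
  have hτ0 : 0 < τ := by positivity
  have hτη : τ * V χ < η := by
    rw [hτ, div_div, div_mul_eq_mul_div, div_lt_iff₀ (by positivity)]; nlinarith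
  filter_upwards [hev, moll_uniform hφ.continuous hφ.2.1 hτ0] with ε hε hu
  obtain ⟨ht, hχt⟩ := hε φ hφ.continuous subset_rfl
  have hn : ∀ x, 0 ≤ moll ε φ x := le_moll hφ.continuous.locallyIntegrable hφ0 ε
  have hτχ := hχ.const_mul τ
  have hτχ0 : ∀ x, 0 ≤ τ * χ x := fun x => mul_nonneg hτ0.le (hχ0 x)
  have key : ∀ x, |moll ε φ x - φ x| ≤ τ * χ x := by
    intro x
    by_cases h1 : x ∈ tsupport φ
    · rw [hχK x h1, mul_one]; exact hu x
    by_cases h2 : x ∈ tsupport (moll ε φ)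
    · rw [hχt x h2, mul_one]; exact hu x
    · rw [image_eq_zero_of_notMem_tsupport h1, image_eq_zero_of_notMem_tsupport h2]
      simpa using hτχ0 x
  have a1 : V (moll ε φ) ≤ V φ + τ * V χ := by
    rw [← hV.smul τ χ hτ0.le hχ hχ0, ← hV.add _ _ hφ hτχ hφ0 hτχ0]
    exact hV.mono ht (hφ.add hτχ) hn fun x => by linarith [(abs_le.1 (key x)).2]
  have a2 : V φ ≤ V (moll ε φ) + τ * V χ := by
    rw [← hV.smul τ χ hτ0.le hχ hχ0, ← hV.add _ _ ht hτχ hn hτχ0]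
    exact hV.mono hφ (ht.add hτχ) hφ0 fun x => by linarith [(abs_le.1 (key x)).1]
  rw [Real.dist_eq, abs_lt]
  constructor <;> linarith

/-- Representation of positive functionals on nonnegative test functions by Radon measures. -/
lemma PosFun.exists_measure {Ω : Set (Eu n)} (hΩ : IsOpen Ω) {V : (Eu n → ℝ) → ℝ}
    (hV : PosFun Ω V) : ∃ ν : Measure (Eu n), LocFinOn Ω ν ∧
      ∀ φ, IsTest Ω φ → (∀ x, 0 ≤ φ x) → V φ = ∫ x, φ x ∂ν := by
  have : LocallyCompactSpace Ω := hΩ.locallyCompactSpace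
  set x : CompactlySupportedContinuousMap Ω NNReal → ℕ → ℝ :=
    fun f j => V (moll (1 / ((j : ℝ) + 1)) (zext f)) with hx
  have hlim : ∀ f, Tendsto (x f) (hyperfilter ℕ) (𝓝 (ulim (x f))) := by
    intro f
    obtain ⟨C, hC⟩ := hV.eventually_bdd hΩ (continuous_zext hΩ f) (hasCompactSupport_zext f)
      ((tsupport_zext f).trans (zext_image_subset f)) (zext_nonneg f)
    exact tendsto_ulim (eventually_hyper hC)
  have htest : ∀ f : CompactlySupportedContinuousMap Ω NNReal,
      ∀ᶠ ε in 𝓝[>] (0 : ℝ), IsTest Ω (moll ε (zext f)) := by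
    intro f
    obtain ⟨χ, -, -, -, -, h⟩ := exists_cutoff_moll hΩ (zext_isCompact f) (zext_image_subset f)
    filter_upwards [h] with ε hε
    exact (hε _ (continuous_zext hΩ f) (tsupport_zext f)).1
  have hli := fun f => (continuous_zext hΩ f).locallyIntegrable (μ := volume)
  have hnn : ∀ f ε x, 0 ≤ moll ε (zext f) x := fun f ε x => le_moll (hli f) (zext_nonneg f) ε x
  have hnonneg : ∀ f, 0 ≤ ulim (x f) := by
    intro f
    refine ge_of_tendsto (hlim f) ?_
    filter_upwards [eventually_hyper (htest f)] with j hj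
    exact hV.nonneg _ hj (hnn f _)
  let Λ : CompactlySupportedContinuousMap Ω NNReal →ₗ[NNReal] NNReal :=
    { toFun := fun f => ⟨ulim (x f), hnonneg f⟩
      map_add' := by
        intro f g
        apply NNReal.eq
        change ulim (x (f + g)) = ulim (x f) + ulim (x g)
        refine ulim_eq (((hlim f).add (hlim g)).congr' ?_)
        filter_upwards [eventually_hyper (htest f), eventually_hyper (htest g)] with j hf hg
        rw [hx]
        simp only []
        rw [← hV.add _ _ hf hg (hnn f _) (hnn g _)]
        congr 1
        ext1 y
        rw [← moll_add (hli f) (hli g)]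
        congr 1
        ext1 z
        by_cases hz : z ∈ Ω
        · have e := fun f => zext_apply f ⟨z, hz⟩
          simp only at e
          rw [e, e, e]; simp
        · simp [zext_of_notMem _ hz]
      map_smul' := by
        intro c f
        apply NNReal.eq
        change ulim (x (c • f)) = (c : ℝ) * ulim (x f)
        refine ulim_eq (((hlim f).const_mul (c : ℝ)).congr' ?_)
        filter_upwards [eventually_hyper (htest f)] with j hf
        rw [hx]
        simp only []
        rw [← hV.smul _ _ c.coe_nonneg hf (hnn f _)]
        congr 1
        ext1 y
        rw [← moll_const_mul]
        congr 1
        ext1 z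
        by_cases hz : z ∈ Ω
        · have e := fun f => zext_apply f ⟨z, hz⟩
          simp only at e
          rw [e, e]; simp
        · simp [zext_of_notMem _ hz] }
  refine ⟨(NNRealRMK.rieszMeasure Λ).map Subtype.val, ⟨fun K hK hKc => ?_, ?_⟩, ?_⟩
  · rw [Measure.map_apply measurable_subtype_coe hKc.measurableSet]
    refine IsCompact.measure_lt_top ?_
    rw [Subtype.isCompact_iff, Subtype.image_preimage_coe, inter_eq_self_of_subset_right hK]
    exact hKc
  · rw [Measure.map_apply measurable_subtype_coe hΩ.measurableSet.compl]
    have : (Subtype.val ⁻¹' Ωᶜ : Set Ω) = ∅ := by ext y; simp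
    rw [this, measure_empty]
  · intro φ hφ hφ0
    rw [integral_map measurable_subtype_coe.aemeasurable hφ.continuous.aestronglyMeasurable]
    have hcs : HasCompactSupport (fun y : Ω => (⟨φ y, hφ0 y⟩ : NNReal)) := by
      have hK : IsCompact (Subtype.val ⁻¹' tsupport φ : Set Ω) := by
        rw [Subtype.isCompact_iff, Subtype.image_preimage_coe,
          inter_eq_self_of_subset_right hφ.2.2]
        exact hφ.2.1
      refine HasCompactSupport.intro hK fun y hy => ?_
      apply NNReal.eq
      exact image_eq_zero_of_notMem_tsupport (f := φ) hy
    let f : CompactlySupportedContinuousMap Ω NNReal :=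
      { toFun := fun y => ⟨φ y, hφ0 y⟩
        continuous_toFun := (hφ.continuous.comp continuous_subtype_val).subtype_mk _
        hasCompactSupport' := hcs }
    have hf := NNRealRMK.integral_rieszMeasure Λ f
    have hz : zext f = φ := by
      ext1 z
      by_cases hz : z ∈ Ω
      · exact zext_apply f ⟨z, hz⟩
      · rw [zext_of_notMem _ hz, image_eq_zero_of_notMem_tsupport fun h => hz (hφ.2.2 h)]
    have e1 : (Λ f : ℝ) = V φ := by
      change ulim (x f) = V φ
      refine ulim_eq ?_
      rw [hx]
      simp only [hz]
      exact (hV.tendsto_moll hΩ hφ hφ0).comp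
        (tendsto_epsSeq.mono_left Nat.hyperfilter_le_atTop)
    rw [← e1, ← hf]
    rfl

lemma exists_compact_exhaustion {Ω : Set (Eu n)} (hΩ : IsOpen Ω) :
    ∃ K : ℕ → Set (Eu n), (∀ m, IsCompact (K m)) ∧ (∀ m, K m ⊆ Ω) ∧ Monotone K ∧ ⋃ m, K m = Ω := by
  obtain ⟨F, hF, hFΩ, hU, hm⟩ := hΩ.exists_iUnion_isClosed
  refine ⟨fun m => F m ∩ closedBall 0 m, fun m => (isCompact_closedBall _ _).inter_left (hF m),
    fun m => inter_subset_left.trans (hFΩ m), fun a b hab => inter_subset_inter (hm hab)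
      (closedBall_subset_closedBall (by exact_mod_cast hab)), ?_⟩
  refine Subset.antisymm (iUnion_subset fun m => inter_subset_left.trans (hFΩ m)) fun x hx => ?_
  rw [← hU] at hx
  obtain ⟨i, hi⟩ := mem_iUnion.1 hx
  obtain ⟨j, hj⟩ := exists_nat_ge (‖x‖)
  refine mem_iUnion.2 ⟨max i j, hm (le_max_left _ _) hi, ?_⟩
  rw [mem_closedBall_zero_iff]
  exact hj.trans (by exact_mod_cast le_max_right i j)

namespace LocFinOn
variable {Ω : Set (Eu n)} {ν κ : Measure (Eu n)}

lemma sigmaFinite (hΩ : IsOpen Ω) (hν : LocFinOn Ω ν) : SigmaFinite ν := by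
  obtain ⟨K, hK, hKΩ, -, hU⟩ := exists_compact_exhaustion hΩ
  refine ⟨⟨⟨fun m => K m ∪ Ωᶜ, fun _ => trivial, fun m => ?_, ?_⟩⟩⟩
  · exact (measure_union_le _ _).trans_lt (by rw [hν.2, add_zero]; exact hν.1 _ (hKΩ m) (hK m))
  · rw [← iUnion_union, hU, union_compl_self]

lemma mono_measure (hν : LocFinOn Ω ν) (h : κ ≤ ν) : LocFinOn Ω κ :=
  ⟨fun K hK hKc => (h K).trans_lt (hν.1 K hK hKc), le_antisymm ((h _).trans hν.2.le) zero_le⟩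

lemma tendsto_cthickening (hΩ : IsOpen Ω) (hν : LocFinOn Ω ν) {K : Set (Eu n)} (hK : IsCompact K)
    (hKΩ : K ⊆ Ω) : Tendsto (fun δ => ν (cthickening δ K)) (𝓝 0) (𝓝 (ν K)) := by
  obtain ⟨δ, hδ, hδΩ⟩ := hK.exists_cthickening_subset_open hΩ hKΩ
  have := tendsto_measure_cthickening (μ := ν) (s := K) ⟨δ, hδ, (hν.1 _ hδΩ hK.cthickening).ne⟩
  rwa [hK.isClosed.closure_eq] at this

/-- Inner regularity with respect to compact subsets. -/
lemma exists_compact_lt (hΩ : IsOpen Ω) (hν : LocFinOn Ω ν) {A : Set (Eu n)} (hA : MeasurableSet A)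
    {c : ℝ≥0∞} (hc : c < ν A) : ∃ K ⊆ A ∩ Ω, IsCompact K ∧ c < ν K := by
  obtain ⟨K, hK, hKΩ, hKm, hU⟩ := exists_compact_exhaustion hΩ
  have h1 : ν A = ν (A ∩ Ω) := by
    refine le_antisymm ?_ (measure_mono inter_subset_left)
    calc ν A ≤ ν (A ∩ Ω) + ν Ωᶜ := by
          refine (measure_mono fun x hx => ?_).trans (measure_union_le _ _)
          by_cases h : x ∈ Ω
          · exact Or.inl ⟨hx, h⟩
          · exact Or.inr h
      _ = _ := by rw [hν.2, add_zero]
  have h2 : Tendsto (fun m => ν (A ∩ K m)) atTop (𝓝 (ν (A ∩ Ω))) := by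
    rw [← hU, inter_iUnion]
    exact tendsto_measure_iUnion_atTop fun a b hab => inter_subset_inter_right _ (hKm hab)
  rw [h1] at hc
  obtain ⟨m, hm⟩ := (h2.eventually (lt_mem_nhds hc)).exists
  have : IsFiniteMeasure (ν.restrict (K m)) :=
    ⟨by rw [Measure.restrict_apply_univ]; exact hν.1 _ (hKΩ m) (hK m)⟩
  have h3 : c < ν.restrict (K m) (A ∩ K m) := by
    rwa [Measure.restrict_apply (hA.inter (hK m).measurableSet), inter_assoc, inter_self]
  obtain ⟨L, hL, hLc, hcL⟩ := (hA.inter (hK m).measurableSet).exists_lt_isCompact h3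
  exact ⟨L, hL.trans (inter_subset_inter_right _ (hKΩ m)), hLc,
    hcL.trans_le (Measure.restrict_apply_le _ _)⟩

lemma le_of_integral_le (hΩ : IsOpen Ω) (hκ : LocFinOn Ω κ) (hν : LocFinOn Ω ν)
    (h : ∀ φ, IsTest Ω φ → (∀ x, 0 ≤ φ x) → ∫ x, φ x ∂κ ≤ ∫ x, φ x ∂ν) : κ ≤ ν := by
  have key : ∀ K ⊆ Ω, IsCompact K → κ K ≤ ν K := by
    intro K hKΩ hK
    obtain ⟨δ₀, hδ₀, hδΩ⟩ := hK.exists_cthickening_subset_open hΩ hKΩ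
    have hl := (hν.tendsto_cthickening hΩ hK hKΩ).mono_left (nhdsWithin_le_nhds (s := Ioi 0))
    refine ge_of_tendsto hl ?_
    have h2 : ∀ᶠ δ in 𝓝[>] (0 : ℝ), δ < δ₀ := (gt_mem_nhds hδ₀).filter_mono nhdsWithin_le_nhds
    filter_upwards [self_mem_nhdsWithin, h2] with δ hδ hδ'
    have ho : IsOpen (thickening δ K) := isOpen_thickening
    obtain ⟨χ, hχ, h0, h1, U, hU, hKU, -, hχU⟩ := exists_cutoff ho hK (self_subset_thickening hδ K)
    have hs : thickening δ K ⊆ cthickening δ K := thickening_subset_cthickening δ K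
    have hsΩ : cthickening δ K ⊆ Ω := (cthickening_mono hδ'.le K).trans hδΩ
    have hχΩ : IsTest Ω χ := hχ.mono (hs.trans hsΩ)
    have i1 := hκ.integrable_test hχΩ
    have i2 := hν.integrable_test hχΩ
    have e1 : κ K ≤ ENNReal.ofReal (∫ x, χ x ∂κ) := by
      rw [ofReal_integral_eq_lintegral_ofReal i1 (Eventually.of_forall h0),
        ← lintegral_indicator_one hK.measurableSet]
      refine lintegral_mono fun x => ?_
      by_cases hx : x ∈ K
      · simp [hx, hχU x (hKU hx)]
      · simp [hx]
    have e2 : ENNReal.ofReal (∫ x, χ x ∂ν) ≤ ν (cthickening δ K) := by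
      rw [ofReal_integral_eq_lintegral_ofReal i2 (Eventually.of_forall h0),
        ← lintegral_indicator_one isClosed_cthickening.measurableSet]
      refine lintegral_mono fun x => ?_
      by_cases hx : x ∈ cthickening δ K
      · simp [hx, h1 x]
      · rw [image_eq_zero_of_notMem_tsupport fun h => hx (hs (hχ.2.2 h))]; simp
    exact e1.trans ((ENNReal.ofReal_le_ofReal (h χ hχΩ h0)).trans e2)
  refine Measure.le_iff.2 fun A hA => le_of_forall_lt fun c hc => ?_
  obtain ⟨K, hK, hKc, hcK⟩ := hκ.exists_compact_lt hΩ hA hc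
  exact hcK.trans_le ((key K (hK.trans inter_subset_right) hKc).trans
    (measure_mono (hK.trans inter_subset_left)))

lemma withDensity_of_bdd (hν : LocFinOn Ω ν) {f : Eu n → ℝ} {C : ℝ}
    (hfC : ∀ x, f x ≤ C) : LocFinOn Ω (ν.withDensity fun x => ENNReal.ofReal (f x)) := by
  refine ⟨fun K hK hKc => ?_, ?_⟩
  · rw [withDensity_apply _ hKc.measurableSet]
    calc _ ≤ ∫⁻ _ in K, ENNReal.ofReal C ∂ν :=
          lintegral_mono fun x => ENNReal.ofReal_le_ofReal (hfC x)
      _ < ⊤ := by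
          rw [setLIntegral_const]
          exact ENNReal.mul_lt_top ENNReal.ofReal_lt_top (hν.1 K hK hKc)
  · exact withDensity_absolutelyContinuous _ _ hν.2

lemma integrable_mul_bdd (hν : LocFinOn Ω ν) {f φ : Eu n → ℝ} (hφ : IsTest Ω φ) {C : ℝ}
    (hf : AEStronglyMeasurable f ν) (hfC : ∀ᵐ x ∂ν, |f x| ≤ C) :
    Integrable (fun x => φ x * f x) ν :=
  (hν.integrable_test hφ).mul_bdd hf hfC

lemma ae_nonneg_of_integral (hΩ : IsOpen Ω) (hν : LocFinOn Ω ν) {f : Eu n → ℝ} {C : ℝ}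
    (hf : Measurable f) (hfC : ∀ x, |f x| ≤ C)
    (h : ∀ φ, IsTest Ω φ → (∀ x, 0 ≤ φ x) → 0 ≤ ∫ x, φ x * f x ∂ν) : ∀ᵐ x ∂ν, 0 ≤ f x := by
  have hfm : Measurable fun x => max (-f x) 0 := hf.neg.max measurable_const
  have hm := hν.withDensity_of_bdd (f := fun x => max (-f x) 0) (C := C) fun x =>
    max_le ((neg_le_abs _).trans (hfC x)) ((abs_nonneg _).trans (hfC x))
  have hp := hν.withDensity_of_bdd (f := fun x => max (f x) 0) (C := C) fun x =>
    max_le ((le_abs_self _).trans (hfC x)) ((abs_nonneg _).trans (hfC x))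
  have hle : ν.withDensity (fun x => ENNReal.ofReal (max (-f x) 0)) ≤
      ν.withDensity (fun x => ENNReal.ofReal (max (f x) 0)) := by
    refine le_of_integral_le hΩ hm hp fun φ hφ hφ0 => ?_
    have e : ∀ g : Eu n → ℝ, Measurable g → (∀ x, 0 ≤ g x) →
        ∫ x, φ x ∂(ν.withDensity fun x => ENNReal.ofReal (g x)) = ∫ x, φ x * g x ∂ν := by
      intro g hg hg0
      rw [integral_withDensity_eq_integral_toReal_smul hg.ennreal_ofReal
        (Eventually.of_forall fun x => ENNReal.ofReal_lt_top)]
      refine integral_congr_ae (Eventually.of_forall fun x => ?_)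
      simp [ENNReal.toReal_ofReal (hg0 x), mul_comm]
    rw [e _ hfm fun x => le_max_right _ _,
      e _ (hf.max measurable_const) fun x => le_max_right _ _]
    have i1 : Integrable (fun x => φ x * max (f x) 0) ν := hν.integrable_mul_bdd hφ (C := C)
      (hf.max measurable_const).aestronglyMeasurable (Eventually.of_forall fun x => by
        rw [abs_of_nonneg (le_max_right _ _)]
        exact max_le ((le_abs_self _).trans (hfC x)) ((abs_nonneg _).trans (hfC x)))
    have i2 : Integrable (fun x => φ x * max (-f x) 0) ν := hν.integrable_mul_bdd hφ (C := C)
      hfm.aestronglyMeasurable (Eventually.of_forall fun x => by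
        rw [abs_of_nonneg (le_max_right _ _)]
        exact max_le ((neg_le_abs _).trans (hfC x)) ((abs_nonneg _).trans (hfC x)))
    have := h φ hφ hφ0
    rw [← sub_nonneg, ← integral_sub i1 i2]
    convert this using 2
    ext x
    rcases le_total 0 (f x) with h | h
    · rw [max_eq_left h, max_eq_right (by linarith)]; ring
    · rw [max_eq_right h, max_eq_left (by linarith)]; ring
  have hA : MeasurableSet {x | f x < 0} := measurableSet_lt hf measurable_const
  have h0 : ν.withDensity (fun x => ENNReal.ofReal (max (-f x) 0)) {x | f x < 0} = 0 := by
    refine le_antisymm ((hle _).trans (le_of_eq ?_)) zero_le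
    rw [withDensity_apply _ hA, setLIntegral_congr_fun hA
      (g := fun _ => 0) (fun x hx => by simp [le_of_lt (show f x < 0 from hx)])]
    simp
  rw [withDensity_apply_eq_zero hfm.ennreal_ofReal] at h0
  rw [ae_iff]
  convert h0 using 2
  ext x
  simp

end LocFinOn

/-- Functions of locally bounded variation in `Ω`, expressed through the variation `TV`. -/
structure FinTV (Ω : Set (Eu n)) (w : Eu n → ℝ) : Prop where
  integrable : ∀ K ⊆ Ω, IsCompact K → IntegrableOn w K
  finite : ∀ φ, IsTest Ω φ → (∀ x, 0 ≤ φ x) → TV w φ ≠ ⊤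

lemma Fld.smul_const {Ω : Set (Eu n)} {φ : Eu n → ℝ} (hφ : IsTest Ω φ) (hφ0 : ∀ x, 0 ≤ φ x)
    {v : Eu n} (hv : ‖v‖ ≤ 1) : Fld φ (fun x => φ x • v) := by
  refine ⟨hφ.1.smul contDiff_const, hφ.2.1.smul_right, fun x => ?_⟩
  rw [norm_smul, Real.norm_eq_abs, abs_of_nonneg (hφ0 x)]
  exact mul_le_of_le_one_right (hφ0 x) hv

lemma FinTV.toReal_add {Ω : Set (Eu n)} (hΩ : IsOpen Ω) {w : Eu n → ℝ} (hw : FinTV Ω w)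
    {φ ψ : Eu n → ℝ} (hφ : IsTest Ω φ) (hψ : IsTest Ω ψ)
    (hφ0 : ∀ x, 0 ≤ φ x) (hψ0 : ∀ x, 0 ≤ ψ x) :
    (TV w fun x => φ x + ψ x).toReal = (TV w φ).toReal + (TV w ψ).toReal := by
  rw [← ENNReal.toReal_add (hw.finite φ hφ hφ0) (hw.finite ψ hψ hψ0)]
  congr 1
  exact le_antisymm (TV_le_add hΩ hφ hψ hφ0 hψ0 hw.integrable hw.finite)
    (TV_add_le hφ.2.1 hψ.2.1 hφ0 hψ0 (hw.integrable _ hφ.2.2 hφ.2.1) (hw.integrable _ hψ.2.2 hψ.2.1))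

lemma FinTV.posFun {Ω : Set (Eu n)} (hΩ : IsOpen Ω) {w : Eu n → ℝ} (hw : FinTV Ω w) :
    PosFun Ω fun φ => (TV w φ).toReal where
  nonneg _ _ _ := ENNReal.toReal_nonneg
  add _ _ hφ hψ hφ0 hψ0 := hw.toReal_add hΩ hφ hψ hφ0 hψ0
  smul c φ hc _ _ := by
    rw [TV_weight_const_mul hc, ENNReal.toReal_mul, ENNReal.toReal_ofReal hc]

/-- The variation of a function of locally bounded variation is a Radon measure. -/
lemma FinTV.exists_measure {Ω : Set (Eu n)} (hΩ : IsOpen Ω) {w : Eu n → ℝ} (hw : FinTV Ω w) :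
    ∃ ν : Measure (Eu n), LocFinOn Ω ν ∧
      ∀ φ, IsTest Ω φ → (∀ x, 0 ≤ φ x) → TV w φ = ENNReal.ofReal (∫ x, φ x ∂ν) := by
  obtain ⟨ν, hν, h⟩ := (hw.posFun hΩ).exists_measure hΩ
  exact ⟨ν, hν, fun φ hφ hφ0 => by
    rw [← h φ hφ hφ0, ENNReal.ofReal_toReal (hw.finite φ hφ hφ0)]⟩

/-- An additive functional on nonnegative test functions dominated by a Radon measure has a
bounded density with respect to it. -/
lemma LocFinOn.exists_density {Ω : Set (Eu n)} (hΩ : IsOpen Ω) {ν : Measure (Eu n)}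
    (hν : LocFinOn Ω ν) {L : (Eu n → ℝ) → ℝ}
    (hle : ∀ φ, IsTest Ω φ → (∀ x, 0 ≤ φ x) → |L φ| ≤ ∫ x, φ x ∂ν)
    (hadd : ∀ φ ψ, IsTest Ω φ → IsTest Ω ψ → L (fun x => φ x + ψ x) = L φ + L ψ)
    (hmul : ∀ (c : ℝ) φ, IsTest Ω φ → L (fun x => c * φ x) = c * L φ) :
    ∃ g : Eu n → ℝ, Measurable g ∧ (∀ x, |g x| ≤ 1) ∧
      ∀ φ, IsTest Ω φ → (∀ x, 0 ≤ φ x) → L φ = ∫ x, φ x * g x ∂ν := by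
  have hP : PosFun Ω fun φ => ((∫ x, φ x ∂ν) + L φ) / 2 := by
    refine ⟨fun φ hφ hφ0 => ?_, fun φ ψ hφ hψ hφ0 hψ0 => ?_, fun c φ hc hφ hφ0 => ?_⟩
    · have := (abs_le.1 (hle φ hφ hφ0)).1
      linarith
    · rw [hadd φ ψ hφ hψ, integral_add (hν.integrable_test hφ) (hν.integrable_test hψ)]
      ring
    · rw [hmul c φ hφ, integral_const_mul]
      ring
  obtain ⟨κ, hκ, hκP⟩ := hP.exists_measure hΩ
  have hκν : κ ≤ ν := hκ.le_of_integral_le hΩ hν fun φ hφ hφ0 => by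
    rw [← hκP φ hφ hφ0]
    have := (abs_le.1 (hle φ hφ hφ0)).2
    linarith
  have := hν.sigmaFinite hΩ
  have := hκ.sigmaFinite hΩ
  have hac : κ ≪ ν := Measure.absolutelyContinuous_of_le hκν
  have hr1 := Measure.rnDeriv_le_one_of_le hκν
  set r : Eu n → ℝ := fun x => min (κ.rnDeriv ν x).toReal 1 with hr
  have hr0 : ∀ x, 0 ≤ r x := fun x => le_min ENNReal.toReal_nonneg zero_le_one
  have hrm : Measurable r := (κ.measurable_rnDeriv ν).ennreal_toReal.min measurable_const
  refine ⟨fun x => 2 * r x - 1, (hrm.const_mul 2).sub_const 1, fun x => ?_, fun φ hφ hφ0 => ?_⟩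
  · have := hr0 x
    have h2 : r x ≤ 1 := min_le_right _ _
    exact abs_le.2 ⟨by linarith, by linarith⟩
  have e1 : ∫ x, φ x ∂κ = ∫ x, φ x * r x ∂ν := by
    rw [← integral_rnDeriv_smul hac]
    refine integral_congr_ae ?_
    filter_upwards [hr1] with x hx
    have : (κ.rnDeriv ν x).toReal ≤ 1 := by
      have := ENNReal.toReal_mono ENNReal.one_ne_top hx
      simpa using this
    simp [hr, min_eq_left this, mul_comm]
  have e2 : ∫ x, φ x * (2 * r x - 1) ∂ν = 2 * (∫ x, φ x * r x ∂ν) - ∫ x, φ x ∂ν := by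
    rw [← integral_const_mul, ← integral_sub _ (hν.integrable_test hφ)]
    · congr 1; ext x; ring
    · refine (hν.integrable_mul_bdd hφ (C := 1) hrm.aestronglyMeasurable
        (Eventually.of_forall fun x => ?_)).const_mul 2
      rw [abs_of_nonneg (hr0 x)]; exact min_le_right _ _
  rw [e2, ← e1, ← hκP φ hφ hφ0]
  ring

lemma FinTV.exists_directional {Ω : Set (Eu n)} (hΩ : IsOpen Ω) {w : Eu n → ℝ} (hw : FinTV Ω w)
    {ν : Measure (Eu n)} (hν : LocFinOn Ω ν)
    (h : ∀ φ, IsTest Ω φ → (∀ x, 0 ≤ φ x) → TV w φ = ENNReal.ofReal (∫ x, φ x ∂ν))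
    {v : Eu n} (hv : ‖v‖ ≤ 1) : ∃ g : Eu n → ℝ, Measurable g ∧ (∀ x, |g x| ≤ 1) ∧
      ∀ φ, IsTest Ω φ → (∀ x, 0 ≤ φ x) → ∫ x, w x * ⟪gradient φ x, v⟫ = ∫ x, φ x * g x ∂ν := by
  have hfin : ∀ φ, IsTest Ω φ → (∀ x, 0 ≤ φ x) →
      |∫ x, w x * ⟪gradient φ x, v⟫| ≤ ∫ x, φ x ∂ν := by
    intro φ hφ hφ0
    have e1 := integral_le_TV_toReal (w := w) (Fld.smul_const hφ hφ0 hv) (hw.finite φ hφ hφ0)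
    have e2 := integral_le_TV_toReal (w := w) (Fld.smul_const hφ hφ0 (v := -v) (by simpa using hv))
      (hw.finite φ hφ hφ0)
    simp only [dv_smul_const hφ.1, inner_neg_right, mul_neg, integral_neg] at e1 e2
    rw [h φ hφ hφ0, ENNReal.toReal_ofReal (integral_nonneg hφ0)] at e1 e2
    exact abs_le.2 ⟨by linarith, e1⟩
  have hi : ∀ φ, IsTest Ω φ → Integrable fun x => w x * ⟪gradient φ x, v⟫ := by
    intro φ hφ
    have := (integrable_smul_gradient hw.integrable hφ).inner_const (𝕜 := ℝ) v
    simpa only [inner_smul_left, RCLike.conj_to_real] using this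
  refine hν.exists_density hΩ (L := fun φ => ∫ x, w x * ⟪gradient φ x, v⟫) hfin
    (fun φ ψ hφ hψ => ?_) fun c φ hφ => ?_
  · simp only [gradient_add hφ.1 hψ.1, inner_add_left, mul_add]
    rw [integral_add (hi φ hφ) (hi ψ hψ)]
  · simp only [gradient_const_mul hφ.1, inner_smul_left, RCLike.conj_to_real]
    simp_rw [mul_left_comm]
    rw [integral_const_mul]

lemma IsTest.exists_sub_nonneg {Ω : Set (Eu n)} (hΩ : IsOpen Ω) {φ : Eu n → ℝ} (hφ : IsTest Ω φ) :
    ∃ χ, IsTest Ω χ ∧ (∀ x, 0 ≤ χ x) ∧ ∀ x, 0 ≤ φ x + χ x := by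
  obtain ⟨χ, hχ, h0, -, U, -, hKU, -, hχU⟩ := exists_cutoff hΩ hφ.2.1.isCompact hφ.2.2
  obtain ⟨C, hC0, hC⟩ := hφ.exists_bound
  refine ⟨fun x => C * χ x, hχ.const_mul C, fun x => mul_nonneg hC0 (h0 x), fun x => ?_⟩
  by_cases hx : x ∈ tsupport φ
  · simp only [hχU x (hKU hx)]; linarith [(abs_le.1 (hC x)).1]
  · rw [image_eq_zero_of_notMem_tsupport hx]; simpa using mul_nonneg hC0 (h0 x)

lemma ae_norm_le_one_of_inner {ν : Measure (Eu n)} {θ : Eu n → Eu n}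
    (h1 : ∀ v : Eu n, ‖v‖ ≤ 1 → ∀ᵐ x ∂ν, 0 ≤ 1 - ⟪θ x, v⟫) : ∀ᵐ x ∂ν, ‖θ x‖ ≤ 1 := by
  obtain ⟨D, hDc, hDd⟩ := TopologicalSpace.exists_countable_dense (Eu n)
  have h2 : ∀ᵐ x ∂ν, ∀ d ∈ D, ‖d‖ ≤ 1 → 0 ≤ 1 - ⟪θ x, d⟫ := by
    rw [ae_ball_iff hDc]
    intro d _
    by_cases hd : ‖d‖ ≤ 1
    · filter_upwards [h1 d hd] with x hx _ using hx
    · exact Eventually.of_forall fun x h => absurd h hd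
  filter_upwards [h2] with x hx
  by_contra hcon
  push Not at hcon
  have hU : IsOpen {d : Eu n | ‖d‖ < 1 ∧ 1 < ⟪θ x, d⟫} :=
    (isOpen_lt continuous_norm continuous_const).inter
      (isOpen_lt continuous_const (f := fun _ => (1 : ℝ)) (g := fun d : Eu n => ⟪θ x, d⟫)
        (continuous_const.inner continuous_id))
  have hpos : 0 < ‖θ x‖ := by linarith
  have hne : {d : Eu n | ‖d‖ < 1 ∧ 1 < ⟪θ x, d⟫}.Nonempty := by
    obtain ⟨s, hs1, hs2⟩ := exists_between (show 1 / ‖θ x‖ ^ 2 < 1 / ‖θ x‖ by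
      rw [div_lt_div_iff₀ (by positivity) hpos]; nlinarith)
    have hs0 : 0 < s := lt_trans (by positivity) hs1
    refine ⟨s • θ x, ?_, ?_⟩
    · rw [norm_smul, Real.norm_of_nonneg hs0.le]
      rwa [lt_div_iff₀ hpos] at hs2
    · rw [inner_smul_right, real_inner_self_eq_norm_sq]
      rwa [div_lt_iff₀ (by positivity)] at hs1
  obtain ⟨d, hd1, hd2⟩ := hDd.exists_mem_open hU hne
  have := hx d hd1 hd2.1.le
  linarith [hd2.2]

/-- Structure theorem for functions of locally bounded variation. -/
lemma FinTV.exists_hasGradMeasure {Ω : Set (Eu n)} (hΩ : IsOpen Ω) {w : Eu n → ℝ}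
    (hw : FinTV Ω w) {ν : Measure (Eu n)} (hν : LocFinOn Ω ν)
    (h : ∀ φ, IsTest Ω φ → (∀ x, 0 ≤ φ x) → TV w φ = ENNReal.ofReal (∫ x, φ x ∂ν)) :
    ∃ θ, Measurable θ ∧ HasGradMeasure Ω w ν θ := by
  choose g hgm hg1 hg using fun i : Fin n =>
    hw.exists_directional hΩ hν h (v := stdVec i) (by simp)
  have hgi : ∀ i φ, IsTest Ω φ → Integrable (fun x => φ x * g i x) ν := fun i φ hφ =>
    hν.integrable_mul_bdd hφ (hgm i).aestronglyMeasurable (Eventually.of_forall (hg1 i))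
  have hwi : ∀ i φ, IsTest Ω φ → Integrable fun x => w x * ⟪gradient φ x, stdVec i⟫ := by
    intro i φ hφ
    have := (integrable_smul_gradient hw.integrable hφ).inner_const (𝕜 := ℝ) (stdVec i)
    simpa only [inner_smul_left, RCLike.conj_to_real] using this
  have hg' : ∀ i φ, IsTest Ω φ →
      ∫ x, w x * ⟪gradient φ x, stdVec i⟫ = ∫ x, φ x * g i x ∂ν := by
    intro i φ hφ
    obtain ⟨χ, hχ, hχ0, hs⟩ := hφ.exists_sub_nonneg hΩ
    have a := hg i _ (hφ.add hχ) hs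
    simp only [gradient_add hφ.1 hχ.1, inner_add_left, mul_add, add_mul] at a
    rw [integral_add (hwi i φ hφ) (hwi i χ hχ), integral_add (hgi i φ hφ) (hgi i χ hχ),
      hg i χ hχ hχ0] at a
    linarith
  set θ : Eu n → Eu n := fun x => WithLp.toLp 2 fun i => - g i x with hθ
  have hθm : Measurable θ :=
    (WithLp.measurable_toLp 2 _).comp (measurable_pi_lambda _ fun i => (hgm i).neg)
  have hθi : ∀ x i, ⟪θ x, stdVec i⟫ = - g i x := fun x i => by
    rw [EuclideanSpace.inner_single_right]; simp [hθ]
  obtain ⟨C, hC⟩ : ∃ C : ℝ, ∀ x, ‖θ x‖ ≤ C := by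
    refine ⟨Real.sqrt n, fun x => ?_⟩
    rw [EuclideanSpace.norm_eq]
    refine Real.sqrt_le_sqrt ?_
    calc ∑ i, ‖θ x i‖ ^ 2 ≤ ∑ _i : Fin n, (1 : ℝ) := by
          refine Finset.sum_le_sum fun i _ => ?_
          have : ‖θ x i‖ ≤ 1 := by simpa [hθ] using hg1 i x
          nlinarith [norm_nonneg (θ x i)]
      _ = n := by simp
  have hC0 : 0 ≤ C := (norm_nonneg _).trans (hC 0)
  have hφθ : ∀ φ, IsTest Ω φ → Integrable (fun x => φ x • θ x) ν := fun φ hφ =>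
    (hν.integrable_test hφ).smul_bdd C hθm.aestronglyMeasurable (Eventually.of_forall hC)
  have hvec : ∀ φ, IsTest Ω φ → ∫ x in Ω, w x • gradient φ x = - ∫ x, φ x • θ x ∂ν := by
    intro φ hφ
    rw [setIntegral_eq_of_tsupport hφ.2.2 fun x hx => by simp [gradient_eq_zero_of_notMem hx]]
    refine ext_inner_right ℝ fun v => ?_
    have hb : ∀ i, ⟪∫ x, w x • gradient φ x, stdVec i⟫ = ⟪- ∫ x, φ x • θ x ∂ν, stdVec i⟫ := by
      intro i
      rw [inner_neg_left, real_inner_comm, ← integral_inner (integrable_smul_gradient hw.integrable hφ),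
        real_inner_comm, ← integral_inner (hφθ φ hφ), ← integral_neg]
      have e1 : ∀ x, ⟪stdVec i, θ x⟫ = - g i x := fun x => by rw [real_inner_comm, hθi]
      have e2 : ∀ x, ⟪stdVec i, gradient φ x⟫ = ⟪gradient φ x, stdVec i⟫ := fun x =>
        real_inner_comm _ _
      simp only [inner_smul_right, e1, e2, mul_neg, neg_neg]
      exact hg' i φ hφ
    have : v = ∑ i, v i • stdVec i := by
      ext j
      simp [Finset.sum_apply, Pi.single_apply]
    rw [this, inner_sum, inner_sum]
    simp only [inner_smul_right, hb]
  have hdir : ∀ φ, IsTest Ω φ → ∀ v : Eu n,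
      ∫ x, w x * ⟪gradient φ x, v⟫ = - ∫ x, φ x * ⟪θ x, v⟫ ∂ν := by
    intro φ hφ v
    have e := congrArg (fun z => ⟪v, z⟫) (hvec φ hφ)
    rw [setIntegral_eq_of_tsupport hφ.2.2 fun x hx => by simp [gradient_eq_zero_of_notMem hx]] at e
    simp only [inner_neg_right] at e
    rw [← integral_inner (integrable_smul_gradient hw.integrable hφ), ← integral_inner (hφθ φ hφ)] at e
    simpa only [inner_smul_right, real_inner_comm v] using e
  have hle : ∀ᵐ x ∂ν, ‖θ x‖ ≤ 1 := by
    have h1 : ∀ v : Eu n, ‖v‖ ≤ 1 → ∀ᵐ x ∂ν, 0 ≤ 1 - ⟪θ x, v⟫ := by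
      intro v hv
      have hm : Measurable fun x => ⟪θ x, v⟫ := hθm.inner measurable_const
      have hb : ∀ x, |⟪θ x, v⟫| ≤ C := fun x => (abs_real_inner_le_norm _ _).trans
        ((mul_le_of_le_one_right (norm_nonneg _) hv).trans (hC x))
      refine hν.ae_nonneg_of_integral hΩ (C := 1 + C) (measurable_const.sub hm) (fun x => ?_)
        fun φ hφ hφ0 => ?_
      · rw [abs_le]
        have := abs_le.1 (hb x)
        constructor <;> linarith [this.1, this.2]
      · have e1 := integral_le_TV_toReal (w := w) (Fld.smul_const hφ hφ0 (v := -v) (by simpa using hv))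
          (hw.finite φ hφ hφ0)
        simp only [dv_smul_const hφ.1] at e1
        rw [h φ hφ hφ0, ENNReal.toReal_ofReal (integral_nonneg hφ0), hdir φ hφ] at e1
        simp only [inner_neg_right, mul_neg, integral_neg, neg_neg] at e1
        simp only [mul_sub, mul_one]
        rw [integral_sub (hν.integrable_test hφ)
          (hν.integrable_mul_bdd hφ hm.aestronglyMeasurable (Eventually.of_forall hb))]
        linarith
    exact ae_norm_le_one_of_inner h1
  have hge : ∀ᵐ x ∂ν, 0 ≤ ‖θ x‖ - 1 := by
    refine hν.ae_nonneg_of_integral hΩ (C := C + 1) (hθm.norm.sub measurable_const) (fun x => ?_)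
        fun φ hφ hφ0 => ?_
    · have := norm_nonneg (θ x)
      rw [abs_le]
      constructor <;> linarith [hC x]
    · have hin : Integrable (fun x => φ x * ‖θ x‖) ν :=
        hν.integrable_mul_bdd hφ hθm.norm.aestronglyMeasurable (C := C)
          (Eventually.of_forall fun x => by simpa using hC x)
      have hT : TV w φ ≤ ENNReal.ofReal (∫ x, φ x * ‖θ x‖ ∂ν) := by
        refine TV_le fun X hX => ENNReal.ofReal_le_ofReal ?_
        rw [integral_mul_dv_eq_sum hw.integrable hX hφ.2.2]
        have ht := fun i => hX.coord_isTest hφ.2.2 i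
        have e : ∀ i, ⟪∫ x in Ω, w x • gradient (fun y => X y i) x, stdVec i⟫
            = ∫ x, X x i * g i x ∂ν := by
          intro i
          rw [setIntegral_eq_of_tsupport (ht i).2.2 fun x hx => by
            simp [gradient_eq_zero_of_notMem hx], ← hg' i _ (ht i), real_inner_comm,
            ← integral_inner (integrable_smul_gradient hw.integrable (ht i))]
          simp only [inner_smul_right, real_inner_comm (stdVec i)]
        simp_rw [e]
        rw [← integral_finsetSum _ fun i _ => hgi i _ (ht i)]
        refine integral_mono (integrable_finsetSum _ fun i _ => hgi i _ (ht i)) hin fun x => ?_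
        have e2 : ∑ i, X x i * g i x = - ⟪X x, θ x⟫ := by
          rw [PiLp.inner_apply, ← Finset.sum_neg_distrib]
          refine Finset.sum_congr rfl fun i _ => ?_
          simp [hθ, mul_comm]
        simp only [e2]
        calc -⟪X x, θ x⟫ ≤ ‖X x‖ * ‖θ x‖ := (neg_le_abs _).trans (abs_real_inner_le_norm _ _)
          _ ≤ φ x * ‖θ x‖ := mul_le_mul_of_nonneg_right (hX.2.2 x) (norm_nonneg _)
      rw [h φ hφ hφ0, ENNReal.ofReal_le_ofReal_iff
        (integral_nonneg fun x => mul_nonneg (hφ0 x) (norm_nonneg _))] at hT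
      simp only [mul_sub, mul_one]
      rw [integral_sub hin (hν.integrable_test hφ)]
      linarith
  refine ⟨θ, hθm, ?_, hν.2, hvec⟩
  filter_upwards [hle, hge] with x h1 h2
  linarith

/-- `w` is a bounded Borel function of locally bounded variation in `Ω` with variation `ν`. -/
structure BVm (Ω : Set (Eu n)) (w : Eu n → ℝ) (ν : Measure (Eu n)) : Prop where
  meas : Measurable w
  bdd : ∃ M, ∀ x, |w x| ≤ M
  locFin : LocFinOn Ω ν
  tv : ∀ φ, IsTest Ω φ → (∀ x, 0 ≤ φ x) → TV w φ = ENNReal.ofReal (∫ x, φ x ∂ν)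

/-- Mollification of a measure. -/
def mollM (ε : ℝ) (ν : Measure (Eu n)) (x : Eu n) : ℝ≥0∞ := ∫⁻ y, ENNReal.ofReal (rho ε (x - y)) ∂ν

lemma lintegral_mul_mollM {ν : Measure (Eu n)} [SFinite ν] (ε : ℝ) {g : Eu n → ℝ≥0∞}
    (hg : Measurable g) : ∫⁻ x, g x * mollM ε ν x =
      ∫⁻ y, (∫⁻ x, g x * ENNReal.ofReal (rho ε (x - y))) ∂ν := by
  have hm : Measurable fun p : Eu n × Eu n => ENNReal.ofReal (rho ε (p.1 - p.2)) :=
    ((continuous_rho ε).comp (continuous_fst.sub continuous_snd)).measurable.ennreal_ofReal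
  rw [lintegral_lintegral_swap ((hg.comp measurable_snd).mul
    (hm.comp measurable_swap)).aemeasurable]
  refine lintegral_congr fun x => ?_
  rw [mollM, lintegral_const_mul]
  exact ((continuous_rho_sub ε x).measurable).ennreal_ofReal

lemma lintegral_mul_rho (ε : ℝ) {φ : Eu n → ℝ} (hφ : Continuous φ) (hφ0 : ∀ x, 0 ≤ φ x) (y : Eu n) :
    ∫⁻ x, ENNReal.ofReal (φ x) * ENNReal.ofReal (rho ε (x - y)) =
      ENNReal.ofReal (moll ε φ y) := by
  rw [moll, ofReal_integral_eq_lintegral_ofReal (integrable_rho_mul hφ.locallyIntegrable ε y)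
    (Eventually.of_forall fun x => mul_nonneg (rho_nonneg _ _) (hφ0 x))]
  refine lintegral_congr fun x => ?_
  rw [← ENNReal.ofReal_mul (hφ0 x), rho_sub_comm, mul_comm]

lemma LocFinOn.posFun {Ω : Set (Eu n)} {ν : Measure (Eu n)} (hν : LocFinOn Ω ν) :
    PosFun Ω fun φ => ∫ x, φ x ∂ν where
  nonneg _ _ hφ0 := integral_nonneg hφ0
  add _ _ hφ hψ _ _ := integral_add (hν.integrable_test hφ) (hν.integrable_test hψ)
  smul c _ _ _ _ := integral_const_mul c _

lemma LocFinOn.eventually_lintegral_mollM_le {Ω : Set (Eu n)} (hΩ : IsOpen Ω) {ν : Measure (Eu n)}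
    (hν : LocFinOn Ω ν) {φ : Eu n → ℝ} (hφ : IsTest Ω φ) (hφ0 : ∀ x, 0 ≤ φ x) {η : ℝ} (hη : 0 < η) :
    ∀ᶠ ε in 𝓝[>] (0 : ℝ), ∫⁻ x, ENNReal.ofReal (φ x) * mollM ε ν x ≤
      ENNReal.ofReal ((∫ x, φ x ∂ν) + η) := by
  have := hν.sigmaFinite hΩ
  obtain ⟨χ, -, -, -, -, hev⟩ := exists_cutoff_moll hΩ hφ.2.1.isCompact hφ.2.2
  have ht := hν.posFun.tendsto_moll hΩ hφ hφ0
  filter_upwards [hev, ht.eventually (gt_mem_nhds (lt_add_of_pos_right _ hη))] with ε h1 h2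
  rw [lintegral_mul_mollM ε hφ.continuous.measurable.ennreal_ofReal]
  simp_rw [lintegral_mul_rho ε hφ.continuous hφ0]
  rw [← ofReal_integral_eq_lintegral_ofReal
    (hν.integrable_test (h1 φ hφ.continuous subset_rfl).1)
    (Eventually.of_forall fun x => le_moll hφ.continuous.locallyIntegrable hφ0 ε x)]
  exact ENNReal.ofReal_le_ofReal h2.le

lemma eventually_forall_closedBall_subset {Ω : Set (Eu n)} (hΩ : IsOpen Ω) {K : Set (Eu n)}
    (hK : IsCompact K) (hKΩ : K ⊆ Ω) : ∀ᶠ ε in 𝓝[>] (0 : ℝ), ∀ x ∈ K, closedBall x ε ⊆ Ω := by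
  obtain ⟨δ, hδ, h⟩ := hK.exists_cthickening_subset_open hΩ hKΩ
  have h2 : ∀ᶠ ε in 𝓝[>] (0 : ℝ), ε < δ := (gt_mem_nhds hδ).filter_mono nhdsWithin_le_nhds
  filter_upwards [h2] with ε hε x hx
  exact ((closedBall_subset_closedBall hε.le).trans (closedBall_subset_cthickening hx δ)).trans h

lemma lintegral_mul_norm_eq {φ : Eu n → ℝ} (hφ : Continuous φ) (hc : HasCompactSupport φ)
    (hφ0 : ∀ x, 0 ≤ φ x) {v : Eu n → ℝ} (hv : ContDiff ℝ (⊤ : ℕ∞) v) :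
    ENNReal.ofReal (∫ x, φ x * ‖gradient v x‖) =
      ∫⁻ x, ENNReal.ofReal (φ x) * ENNReal.ofReal ‖gradient v x‖ := by
  rw [ofReal_integral_eq_lintegral_ofReal]
  · exact lintegral_congr fun x => ENNReal.ofReal_mul (hφ0 x)
  · exact (hφ.mul (continuous_gradient hv).norm).integrable_of_hasCompactSupport hc.mul_right
  · exact Eventually.of_forall fun x => mul_nonneg (hφ0 x) (norm_nonneg _)

lemma integrable_mul_norm_gradient {φ : Eu n → ℝ} (hφ : Continuous φ) (hc : HasCompactSupport φ)
    {v : Eu n → ℝ} (hv : ContDiff ℝ (⊤ : ℕ∞) v) : Integrable fun x => φ x * ‖gradient v x‖ :=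
  (hφ.mul (continuous_gradient hv).norm).integrable_of_hasCompactSupport hc.mul_right

namespace BVm
variable {Ω : Set (Eu n)} {w : Eu n → ℝ} {ν : Measure (Eu n)}

lemma locallyIntegrable (h : BVm Ω w ν) : LocallyIntegrable w := by
  obtain ⟨M, hM⟩ := h.bdd
  exact locallyIntegrable_of_bdd h.meas hM

lemma finTV (h : BVm Ω w ν) : FinTV Ω w :=
  ⟨fun _ _ hK => h.locallyIntegrable.integrableOn_isCompact hK,
    fun φ hφ hφ0 => by rw [h.tv φ hφ hφ0]; exact ENNReal.ofReal_ne_top⟩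

lemma norm_gradient_le_mollM (h : BVm Ω w ν) {ε : ℝ} (hε : 0 < ε) {x : Eu n}
    (hx : closedBall x ε ⊆ Ω) : ENNReal.ofReal ‖gradient (moll ε w) x‖ ≤ mollM ε ν x := by
  have ht : IsTest Ω fun y => rho ε (x - y) :=
    ⟨contDiff_rho_sub ε x, hasCompactSupport_rho_sub ε x, (tsupport_rho_sub_subset hε x).trans hx⟩
  refine (norm_gradient_moll_le ε h.locallyIntegrable x).trans ?_
  rw [h.tv _ ht fun y => rho_nonneg _ _, mollM, ofReal_integral_eq_lintegral_ofReal
    (h.locFin.integrable_test ht) (Eventually.of_forall fun y => rho_nonneg _ _)]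

lemma eventually_integral_gradient_le (hΩ : IsOpen Ω) (h : BVm Ω w ν) {φ : Eu n → ℝ}
    (hφ : IsTest Ω φ) (hφ0 : ∀ x, 0 ≤ φ x) {η : ℝ} (hη : 0 < η) :
    ∀ᶠ ε in 𝓝[>] (0 : ℝ), ∫ x, φ x * ‖gradient (moll ε w) x‖ ≤ (∫ x, φ x ∂ν) + η := by
  filter_upwards [h.locFin.eventually_lintegral_mollM_le hΩ hφ hφ0 hη, self_mem_nhdsWithin,
    eventually_forall_closedBall_subset hΩ hφ.2.1.isCompact hφ.2.2] with ε h1 hε h2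
  have hp : 0 ≤ (∫ x, φ x ∂ν) + η := add_nonneg (integral_nonneg hφ0) hη.le
  rw [← ENNReal.ofReal_le_ofReal_iff hp, lintegral_mul_norm_eq hφ.continuous hφ.2.1 hφ0
    (contDiff_moll ε h.locallyIntegrable)]
  refine le_trans (lintegral_mono fun x => ?_) h1
  by_cases hx : x ∈ tsupport φ
  · exact mul_le_mul_right (h.norm_gradient_le_mollM hε (h2 x hx)) _
  · simp [image_eq_zero_of_notMem_tsupport hx]

lemma integrableOn_comp_moll {f : ℝ → ℝ} (h : BVm Ω w ν) (hf : Continuous f) {K : Set (Eu n)}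
    (hK : IsCompact K) (ε : ℝ) : IntegrableOn (fun x => f (moll ε w x)) K :=
  (hf.comp (contDiff_moll ε h.locallyIntegrable).continuous).continuousOn.integrableOn_compact hK

lemma integrableOn_comp {f : ℝ → ℝ} (h : BVm Ω w ν) (hf : Continuous f) {K : Set (Eu n)}
    (hK : IsCompact K) : IntegrableOn (fun x => f (w x)) K := by
  obtain ⟨M, hM⟩ := h.bdd
  obtain ⟨C, hC⟩ := (isCompact_Icc (a := -M) (b := M)).exists_bound_of_continuousOn hf.continuousOn
  exact Measure.integrableOn_of_bounded hK.measure_lt_top.ne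
    (hf.measurable.comp h.meas).aestronglyMeasurable (M := C)
    (Eventually.of_forall fun x => hC _ (abs_le.1 (hM x)))

lemma lt_of_lt_TV_comp {f : ℝ → ℝ} (h : BVm Ω w ν) (hf : Continuous f) {φ : Eu n → ℝ}
    (hφ : HasCompactSupport φ) {c : ℝ≥0∞} (hc : c < TV (fun x => f (w x)) φ) :
    ∀ᶠ ε in 𝓝[>] (0 : ℝ), c < TV (fun x => f (moll ε w x)) φ := by
  obtain ⟨M, hM⟩ := h.bdd
  exact TV_lsc hφ (h.integrableOn_comp hf hφ.isCompact)
    (Eventually.of_forall fun ε => h.integrableOn_comp_moll hf hφ.isCompact ε)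
    (tendsto_integral_comp_moll h.meas hM hf hφ.isCompact) hc

/-- Splitting of the variation along a smooth monotone decomposition of the identity. -/
lemma eventually_split (hΩ : IsOpen Ω) (h : BVm Ω w ν) {a b : ℝ} (hab : ∀ x, w x ∈ Icc a b)
    {f : ℝ → ℝ} (hf : ContDiff ℝ (⊤ : ℕ∞) f) (hf' : ∀ s ∈ Icc a b, deriv f s ∈ Icc (0 : ℝ) 1)
    {φ : Eu n → ℝ} (hφ : IsTest Ω φ) (hφ0 : ∀ x, 0 ≤ φ x) {c : ℝ≥0∞}
    (hc : c < TV (fun x => w x - f (w x)) φ ∨ c = 0) {η : ℝ} (hη : 0 < η) :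
    ∀ᶠ ε in 𝓝[>] (0 : ℝ),
      ENNReal.ofReal (∫ x, φ x * ‖gradient (fun y => f (moll ε w y)) x‖) + c ≤
        ENNReal.ofReal ((∫ x, φ x ∂ν) + η) := by
  set g : ℝ → ℝ := fun s => s - f s with hg
  have hgs : ContDiff ℝ (⊤ : ℕ∞) g := contDiff_id.sub hf
  have hdg : ∀ s, deriv g s = 1 - deriv f s := fun s => by
    have := ((hf.differentiable (by simp)) s).hasDerivAt
    exact ((hasDerivAt_id s).sub this).deriv
  have hc' : ∀ᶠ ε in 𝓝[>] (0 : ℝ), c ≤ TV (fun x => g (moll ε w x)) φ := by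
    rcases hc with hc | rfl
    · exact (h.lt_of_lt_TV_comp (f := g) hgs.continuous hφ.2.1 hc).mono fun _ => le_of_lt
    · simp
  filter_upwards [h.eventually_integral_gradient_le hΩ hφ hφ0 hη, hc'] with ε h1 h2
  have hs := contDiff_moll ε h.locallyIntegrable
  have hfs : ContDiff ℝ (⊤ : ℕ∞) fun y => f (moll ε w y) := hf.comp hs
  have hgs' : ContDiff ℝ (⊤ : ℕ∞) fun y => g (moll ε w y) := hgs.comp hs
  have h3 := h2.trans (TV_le_of_smooth hgs' hφ.continuous hφ.2.1)
  have hnn : ∀ v : Eu n → ℝ, 0 ≤ ∫ x, φ x * ‖gradient v x‖ := fun v =>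
    integral_nonneg fun x => mul_nonneg (hφ0 x) (norm_nonneg _)
  calc _ ≤ ENNReal.ofReal (∫ x, φ x * ‖gradient (fun y => f (moll ε w y)) x‖)
        + ENNReal.ofReal (∫ x, φ x * ‖gradient (fun y => g (moll ε w y)) x‖) := by gcongr
    _ = ENNReal.ofReal (∫ x, φ x * ‖gradient (moll ε w) x‖) := by
        rw [← ENNReal.ofReal_add (hnn _) (hnn _),
          ← integral_add (integrable_mul_norm_gradient hφ.continuous hφ.2.1 hfs)
            (integrable_mul_norm_gradient hφ.continuous hφ.2.1 hgs')]
        congr 2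
        ext x
        have hm : moll ε w x ∈ Icc a b :=
          ⟨le_moll h.locallyIntegrable (fun x => (hab x).1) ε x,
            moll_le h.locallyIntegrable (fun x => (hab x).2) ε x⟩
        obtain ⟨h4, h5⟩ := hf' _ hm
        rw [gradient_comp hf hs, gradient_comp hgs hs, hdg, norm_smul, norm_smul,
          Real.norm_of_nonneg h4, Real.norm_of_nonneg (by linarith)]
        ring
    _ ≤ _ := ENNReal.ofReal_le_ofReal h1

end BVm

/-- The real indicator function of a set. -/
def ind (E : Set (Eu n)) : Eu n → ℝ := E.indicator fun _ => 1

lemma ind_mem (E : Set (Eu n)) (x : Eu n) : ind E x ∈ Icc (0 : ℝ) 1 := by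
  by_cases h : x ∈ E <;> simp [ind, h]

lemma abs_ind_le (E : Set (Eu n)) (x : Eu n) : |ind E x| ≤ 1 := by
  rw [abs_of_nonneg (ind_mem E x).1]; exact (ind_mem E x).2

lemma measurable_ind {E : Set (Eu n)} (hE : MeasurableSet E) : Measurable (ind E) :=
  measurable_const.indicator hE

lemma locallyIntegrable_ind {E : Set (Eu n)} (hE : MeasurableSet E) : LocallyIntegrable (ind E) :=
  locallyIntegrable_of_bdd (measurable_ind hE) (abs_ind_le E)

lemma moll_ind_mem {E : Set (Eu n)} (hE : MeasurableSet E) (ε : ℝ) (x : Eu n) :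
    moll ε (ind E) x ∈ Icc (0 : ℝ) 1 :=
  ⟨le_moll (locallyIntegrable_ind hE) (fun x => (ind_mem E x).1) ε x,
    moll_le (locallyIntegrable_ind hE) (fun x => (ind_mem E x).2) ε x⟩

/-- A concave polynomial on `[0, 1]` fixing `0` and `1`, steep at `0`. -/
def cpol (m : ℕ) (s : ℝ) : ℝ := 1 - (1 - s) ^ m

lemma contDiff_cpol (m : ℕ) : ContDiff ℝ (⊤ : ℕ∞) (cpol m) :=
  contDiff_const.sub ((contDiff_const.sub contDiff_id).pow m)

lemma deriv_cpol (m : ℕ) (s : ℝ) : deriv (cpol m) s = m * (1 - s) ^ (m - 1) := by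
  have h := (((hasDerivAt_id s).const_sub 1).pow m).const_sub 1
  have h2 : deriv (cpol m) s = -(↑m * (1 - s) ^ (m - 1) * -1) := h.deriv
  rw [h2]; ring

lemma cpol_mem (m : ℕ) {s : ℝ} (hs : s ∈ Icc (0 : ℝ) 1) : cpol m s ∈ Icc (0 : ℝ) 1 := by
  have h1 := pow_le_one₀ (n := m) (sub_nonneg.2 hs.2) (by linarith [hs.1])
  have h2 := pow_nonneg (sub_nonneg.2 hs.2) m
  constructor <;> simp only [cpol] <;> linarith

lemma cpol_ind {m : ℕ} (hm : 1 ≤ m) (E : Set (Eu n)) (x : Eu n) : cpol m (ind E x) = ind E x := by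
  by_cases h : x ∈ E
  · simp [ind, h, cpol, zero_pow (by lia : m ≠ 0)]
  · simp [ind, h, cpol]

lemma half_le_deriv_cpol {m : ℕ} (hm : 1 ≤ m) {s : ℝ} (hs : 0 ≤ s) (hs' : s ≤ 1 / (2 * m)) :
    (m : ℝ) / 2 ≤ deriv (cpol m) s := by
  have hm' : (1 : ℝ) ≤ m := by exact_mod_cast hm
  have h1 : s ≤ 1 := hs'.trans (by rw [div_le_one (by linarith)]; linarith)
  have h2 := one_add_mul_le_pow (a := -s) (by linarith) (m - 1)
  have h3 : m * s ≤ 1 / 2 := by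
    calc m * s ≤ m * (1 / (2 * m)) := by gcongr
      _ = 1 / 2 := by field_simp
  rw [deriv_cpol]
  have h4 : ((m - 1 : ℕ) : ℝ) = m - 1 := by push_cast [hm]; ring
  rw [h4] at h2
  have h5 : (1 : ℝ) / 2 ≤ (1 - s) ^ (m - 1) := by
    rw [show 1 - s = 1 + -s by ring]; nlinarith
  nlinarith

/-- The points near which the mollification of `w` is small. -/
def badSet (w : Eu n → ℝ) (ε δ : ℝ) : Set (Eu n) :=
  {y | moll ε (ind {x | moll ε w x < δ}) y = 1}

lemma measurableSet_moll_lt {w : Eu n → ℝ} (hw : LocallyIntegrable w) (ε δ : ℝ) :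
    MeasurableSet {x | moll ε w x < δ} :=
  (contDiff_moll ε hw).continuous.measurable measurableSet_Iio

lemma measurableSet_badSet {w : Eu n → ℝ} (hw : LocallyIntegrable w) (ε δ : ℝ) :
    MeasurableSet (badSet w ε δ) :=
  (contDiff_moll ε (locallyIntegrable_ind (measurableSet_moll_lt hw ε δ))).continuous.measurable
    (measurableSet_singleton 1)

lemma ae_of_mem_badSet {w : Eu n → ℝ} (hw : LocallyIntegrable w) {ε δ : ℝ} {y : Eu n}
    (hy : y ∈ badSet w ε δ) : ∀ᵐ x, rho ε (x - y) = 0 ∨ moll ε w x < δ := by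
  have hE := measurableSet_moll_lt hw ε δ
  set E := {x | moll ε w x < δ} with hEdef
  have h1 := integrable_rho_mul (locallyIntegrable_ind hE) ε y
  have h0 : ∫ x, (rho ε (y - x) - rho ε (y - x) * ind E x) = 0 := by
    rw [integral_sub (integrable_rho_sub ε y) h1, integral_rho_sub]
    have : moll ε (ind E) y = 1 := hy
    rw [moll] at this
    rw [this, sub_self]
  rw [integral_eq_zero_iff_of_nonneg] at h0
  · filter_upwards [h0] with x hx
    by_cases hxE : x ∈ E
    · exact Or.inr hxE
    · left
      rw [rho_sub_comm]
      simpa [ind, hxE] using hx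
  · intro x
    have := mul_le_mul_of_nonneg_left (ind_mem E x).2 (rho_nonneg ε (y - x))
    simp only [Pi.zero_apply]
    linarith
  · exact (integrable_rho_sub ε y).sub h1

lemma ENNReal.le_ofReal_sub {X : ℝ≥0∞} {a b : ℝ} (h : X + ENNReal.ofReal a ≤ ENNReal.ofReal b) :
    X ≤ ENNReal.ofReal (b - a) := by
  rcases le_total 0 a with ha | ha
  · rw [ENNReal.ofReal_sub _ ha]
    exact ENNReal.le_sub_of_add_le_right ENNReal.ofReal_ne_top h
  · exact (le_self_add.trans h).trans (ENNReal.ofReal_le_ofReal (by linarith))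

lemma BVm.eventually_le_integral_gradient {Ω : Set (Eu n)} {w : Eu n → ℝ} {ν : Measure (Eu n)}
    (h : BVm Ω w ν) {φ : Eu n → ℝ}
    (hφ : IsTest Ω φ) (hφ0 : ∀ x, 0 ≤ φ x) {η : ℝ} (hη : 0 < η) :
    ∀ᶠ ε in 𝓝[>] (0 : ℝ), (∫ x, φ x ∂ν) - η ≤ ∫ x, φ x * ‖gradient (moll ε w) x‖ := by
  rcases le_or_gt (∫ x, φ x ∂ν) 0 with h0 | h0
  · filter_upwards with ε
    have : 0 ≤ ∫ x, φ x * ‖gradient (moll ε w) x‖ :=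
      integral_nonneg fun x => mul_nonneg (hφ0 x) (norm_nonneg _)
    linarith
  · have hc : ENNReal.ofReal ((∫ x, φ x ∂ν) - η) < TV (fun x => id (w x)) φ := by
      simp only [id]
      rw [h.tv φ hφ hφ0, ENNReal.ofReal_lt_ofReal_iff h0]
      linarith
    filter_upwards [h.lt_of_lt_TV_comp continuous_id hφ.2.1 hc] with ε h1
    have h2 := h1.le.trans (TV_le_of_smooth (contDiff_moll ε h.locallyIntegrable) hφ.continuous hφ.2.1)
    rwa [ENNReal.ofReal_le_ofReal_iff] at h2
    exact integral_nonneg fun x => mul_nonneg (hφ0 x) (norm_nonneg _)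

section
variable {Ω : Set (Eu n)} {E : Set (Eu n)} {ν : Measure (Eu n)}

lemma BVm.eventually_integral_cpol_le (hΩ : IsOpen Ω) (h : BVm Ω (ind E) ν) {m : ℕ} (hm : 1 ≤ m)
    {φ : Eu n → ℝ} (hφ : IsTest Ω φ) (hφ0 : ∀ x, 0 ≤ φ x) {η : ℝ} (hη : 0 < η) :
    ∀ᶠ ε in 𝓝[>] (0 : ℝ),
      ∫ x, φ x * ‖gradient (fun y => cpol m (moll ε (ind E) y)) x‖ ≤ (∫ x, φ x ∂ν) + η := by
  set T := ∫ x, φ x ∂ν with hT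
  have hT0 : 0 ≤ T := integral_nonneg hφ0
  have hm' : (1 : ℝ) ≤ m := by exact_mod_cast hm
  set κ : ℝ := 1 / m with hκ
  have hκ0 : 0 < κ := by positivity
  have hκ1 : κ ≤ 1 := by rw [hκ, div_le_one (by linarith)]; exact hm'
  have hκm : κ * m = 1 := by rw [hκ]; field_simp
  set f : ℝ → ℝ := fun s => κ * cpol m s with hf
  have hfs : ContDiff ℝ (⊤ : ℕ∞) f := contDiff_const.mul (contDiff_cpol m)
  have hdf : ∀ s, deriv f s = (1 - s) ^ (m - 1) := fun s => by
    rw [hf, deriv_const_mul_field, deriv_cpol, ← mul_assoc, hκm, one_mul]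
  have hTV : TV (fun x => ind E x - f (ind E x)) φ = ENNReal.ofReal ((1 - κ) * T) := by
    have : (fun x => ind E x - f (ind E x)) = fun x => (1 - κ) * ind E x := by
      ext x; simp only [hf, cpol_ind hm]; ring
    rw [this, TV_const_mul (by linarith), h.tv φ hφ hφ0, ← ENNReal.ofReal_mul (by linarith)]
  have hc : ENNReal.ofReal ((1 - κ) * T - κ * η / 2) < TV (fun x => ind E x - f (ind E x)) φ ∨
      ENNReal.ofReal ((1 - κ) * T - κ * η / 2) = 0 := by
    have hκη : 0 < κ * η / 2 := by positivity
    rcases le_or_gt ((1 - κ) * T - κ * η / 2) 0 with h0 | h0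
    · exact Or.inr (ENNReal.ofReal_eq_zero.2 h0)
    · left
      rw [hTV, ENNReal.ofReal_lt_ofReal_iff (by linarith)]
      linarith
  filter_upwards [h.eventually_split hΩ (ind_mem E) hfs (fun s hs => by
    rw [hdf]
    exact ⟨pow_nonneg (by linarith [hs.2]) _, pow_le_one₀ (by linarith [hs.2]) (by linarith [hs.1])⟩)
    hφ hφ0 hc (η := κ * η / 2) (by positivity)] with ε hε
  have h1 := ENNReal.le_ofReal_sub hε
  have hs := contDiff_moll ε h.locallyIntegrable
  have h2 : ∀ x, gradient (fun y => f (moll ε (ind E) y)) x =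
      κ • gradient (fun y => cpol m (moll ε (ind E) y)) x := fun x =>
    gradient_const_mul ((contDiff_cpol m).comp hs) κ x
  have h3 : ∫ x, φ x * ‖gradient (fun y => f (moll ε (ind E) y)) x‖ =
      κ * ∫ x, φ x * ‖gradient (fun y => cpol m (moll ε (ind E) y)) x‖ := by
    rw [← integral_const_mul]
    congr 1; ext x
    rw [h2, norm_smul, Real.norm_of_nonneg hκ0.le]; ring
  rw [h3, ENNReal.ofReal_le_ofReal_iff (by nlinarith)] at h1
  refine le_of_mul_le_mul_left (h1.trans (le_of_eq ?_)) hκ0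
  ring

lemma BVm.eventually_lintegral_gradient_lt (hΩ : IsOpen Ω) (h : BVm Ω (ind E) ν) {m : ℕ}
    (hm : 1 ≤ m) {φ : Eu n → ℝ} (hφ : IsTest Ω φ) (hφ0 : ∀ x, 0 ≤ φ x) {η : ℝ} (hη : 0 < η) :
    ∀ᶠ ε in 𝓝[>] (0 : ℝ), ∫⁻ x in {x | moll ε (ind E) x < 1 / (2 * m)},
      ENNReal.ofReal (φ x) * ENNReal.ofReal ‖gradient (moll ε (ind E)) x‖ ≤
        ENNReal.ofReal (2 / m * ((∫ x, φ x ∂ν) + η)) := by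
  have hm' : (1 : ℝ) ≤ m := by exact_mod_cast hm
  filter_upwards [h.eventually_integral_cpol_le hΩ hm hφ hφ0 hη] with ε hε
  have hs := contDiff_moll ε h.locallyIntegrable
  have h2m : (0 : ℝ) ≤ 2 / m := by positivity
  rw [ENNReal.ofReal_mul h2m]
  refine le_trans ?_ (mul_le_mul_right (ENNReal.ofReal_le_ofReal hε) _)
  rw [lintegral_mul_norm_eq hφ.continuous hφ.2.1 hφ0
      (v := fun y => cpol m (moll ε (ind E) y)) ((contDiff_cpol m).comp hs),
    ← lintegral_const_mul' _ _ ENNReal.ofReal_ne_top]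
  refine le_trans (setLIntegral_mono' (measurableSet_moll_lt h.locallyIntegrable _ _) fun x hx => ?_)
    (setLIntegral_le_lintegral _ _)
  rw [← ENNReal.ofReal_mul (hφ0 x), ← ENNReal.ofReal_mul (hφ0 x), ← ENNReal.ofReal_mul h2m]
  apply ENNReal.ofReal_le_ofReal
  have hE : Measurable (ind E) := h.meas
  have hmem : 0 ≤ moll ε (ind E) x := le_moll h.locallyIntegrable (fun x => (ind_mem E x).1) ε x
  have h4 := half_le_deriv_cpol hm hmem (le_of_lt hx)
  rw [gradient_comp (contDiff_cpol m) hs, norm_smul, Real.norm_of_nonneg (by linarith)]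
  have h5 : 1 ≤ 2 / m * deriv (cpol m) (moll ε (ind E) x) := by
    rw [div_mul_eq_mul_div, le_div_iff₀ (by linarith)]; linarith
  have h6 : 0 ≤ φ x * ‖gradient (moll ε (ind E)) x‖ := mul_nonneg (hφ0 x) (norm_nonneg _)
  nlinarith

lemma BVm.eventually_lintegral_mollM_lt (hΩ : IsOpen Ω) (h : BVm Ω (ind E) ν) {m : ℕ}
    (hm : 1 ≤ m) {φ : Eu n → ℝ} (hφ : IsTest Ω φ) (hφ0 : ∀ x, 0 ≤ φ x) {η : ℝ} (hη : 0 < η) :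
    ∀ᶠ ε in 𝓝[>] (0 : ℝ), ∫⁻ x in {x | moll ε (ind E) x < 1 / (2 * m)},
      ENNReal.ofReal (φ x) * mollM ε ν x ≤ ENNReal.ofReal (2 / m * (∫ x, φ x ∂ν) + η) := by
  have hm' : (1 : ℝ) ≤ m := by exact_mod_cast hm
  set T := ∫ x, φ x ∂ν with hT
  have hT0 : 0 ≤ T := integral_nonneg hφ0
  set η' := η / 4 with hη'
  have hη'0 : 0 < η' := by positivity
  filter_upwards [h.eventually_lintegral_gradient_lt hΩ hm hφ hφ0 hη'0,
    h.locFin.eventually_lintegral_mollM_le hΩ hφ hφ0 hη'0,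
    h.eventually_le_integral_gradient hφ hφ0 hη'0, self_mem_nhdsWithin,
    eventually_forall_closedBall_subset hΩ hφ.2.1.isCompact hφ.2.2] with ε h1 h2 h3 hε h4
  have hA := measurableSet_moll_lt h.locallyIntegrable ε (1 / (2 * m))
  set A := {x | moll ε (ind E) x < 1 / (2 * m)}
  have hs := contDiff_moll ε h.locallyIntegrable
  have hpt : ∀ x, ENNReal.ofReal (φ x) * ENNReal.ofReal ‖gradient (moll ε (ind E)) x‖ ≤
      ENNReal.ofReal (φ x) * mollM ε ν x := fun x => by
    by_cases hx : x ∈ tsupport φ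
    · exact mul_le_mul_right (h.norm_gradient_le_mollM hε (h4 x hx)) _
    · simp [image_eq_zero_of_notMem_tsupport hx]
  have h5 := ENNReal.ofReal_le_ofReal h3
  rw [lintegral_mul_norm_eq hφ.continuous hφ.2.1 hφ0 hs, ← lintegral_add_compl _ hA] at h5
  rw [← lintegral_add_compl _ hA] at h2
  have h6 : (∫⁻ x in A, ENNReal.ofReal (φ x) * mollM ε ν x) + ENNReal.ofReal (T - η') ≤
      ENNReal.ofReal (T + η' + 2 / m * (T + η')) := by
    rw [ENNReal.ofReal_add (by positivity) (by positivity)]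
    refine le_trans ?_ (add_le_add h2 h1)
    rw [add_assoc]
    gcongr
    rw [add_comm]
    exact h5.trans (add_le_add le_rfl (lintegral_mono hpt))
  refine (ENNReal.le_ofReal_sub h6).trans (ENNReal.ofReal_le_ofReal ?_)
  have h7 : (2 : ℝ) / m ≤ 2 := by rw [div_le_iff₀ (by linarith)]; linarith
  nlinarith

/-- The perimeter measure of `E` charges little the points near which `E` has small density. -/
lemma BVm.eventually_lintegral_badSet_le (hΩ : IsOpen Ω) (h : BVm Ω (ind E) ν) {m : ℕ}
    (hm : 1 ≤ m) {φ : Eu n → ℝ} (hφ : IsTest Ω φ) (hφ0 : ∀ x, 0 ≤ φ x) {η : ℝ} (hη : 0 < η) :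
    ∀ᶠ ε in 𝓝[>] (0 : ℝ), ∫⁻ y in badSet (ind E) ε (1 / (2 * m)), ENNReal.ofReal (φ y) ∂ν ≤
      ENNReal.ofReal (2 / m * (∫ x, φ x ∂ν) + η) := by
  have := h.locFin.sigmaFinite hΩ
  have hm' : (1 : ℝ) ≤ m := by exact_mod_cast hm
  set T := ∫ x, φ x ∂ν with hT
  have hT0 : 0 ≤ T := integral_nonneg hφ0
  have hKfin := h.locFin.1 _ hφ.2.2 hφ.2.1.isCompact
  set N := (ν (tsupport φ)).toReal with hN
  have hN0 : 0 ≤ N := ENNReal.toReal_nonneg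
  set τ := η / (2 * (N + 1)) with hτ
  have hτ0 : 0 < τ := by positivity
  have hτN : τ * N ≤ η / 2 := by
    rw [hτ, div_mul_eq_mul_div, div_le_div_iff₀ (by positivity) (by positivity)]; nlinarith
  filter_upwards [h.eventually_lintegral_mollM_lt hΩ hm hφ hφ0 (half_pos hη),
    moll_uniform hφ.continuous hφ.2.1 hτ0] with ε h1 h2
  set A := {x | moll ε (ind E) x < 1 / (2 * m)} with hAdef
  have hA : MeasurableSet A := measurableSet_moll_lt h.locallyIntegrable ε (1 / (2 * m))
  have hB := measurableSet_badSet h.locallyIntegrable ε (1 / (2 * m))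
  set B := badSet (ind E) ε (1 / (2 * m)) with hBdef
  have h3 : ∫⁻ y in B, ENNReal.ofReal (moll ε φ y) ∂ν ≤ ENNReal.ofReal (2 / m * T + η / 2) := by
    refine le_trans ?_ h1
    rw [← lintegral_indicator hA]
    have hg : Measurable (A.indicator fun x => ENNReal.ofReal (φ x)) :=
      hφ.continuous.measurable.ennreal_ofReal.indicator hA
    have heq : (A.indicator fun x => ENNReal.ofReal (φ x) * mollM ε ν x) =
        fun x => A.indicator (fun x => ENNReal.ofReal (φ x)) x * mollM ε ν x := by
      ext x; by_cases hx : x ∈ A <;> simp [hx]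
    rw [heq, lintegral_mul_mollM ε hg]
    refine le_trans (setLIntegral_mono' hB fun y hy => ?_) (setLIntegral_le_lintegral _ _)
    rw [← lintegral_mul_rho ε hφ.continuous hφ0]
    refine lintegral_mono_ae ?_
    filter_upwards [ae_of_mem_badSet h.locallyIntegrable hy] with x hx
    rcases hx with hx | hx
    · simp [hx]
    · rw [indicator_of_mem (show x ∈ A from hx)]
  have h4 : ∀ y, ENNReal.ofReal (φ y) ≤ ENNReal.ofReal (moll ε φ y) +
      (tsupport φ).indicator (fun _ => ENNReal.ofReal τ) y := fun y => by
    by_cases hy : y ∈ tsupport φ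
    · rw [indicator_of_mem hy, ← ENNReal.ofReal_add
        (le_moll hφ.continuous.locallyIntegrable hφ0 ε y) hτ0.le]
      exact ENNReal.ofReal_le_ofReal (by have := abs_le.1 (h2 y); linarith)
    · simp [image_eq_zero_of_notMem_tsupport hy]
  calc _ ≤ ∫⁻ y in B, (ENNReal.ofReal (moll ε φ y) +
      (tsupport φ).indicator (fun _ => ENNReal.ofReal τ) y) ∂ν := lintegral_mono h4
    _ = (∫⁻ y in B, ENNReal.ofReal (moll ε φ y) ∂ν) +
        ∫⁻ y in B, (tsupport φ).indicator (fun _ => ENNReal.ofReal τ) y ∂ν :=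
      lintegral_add_left
        (contDiff_moll ε hφ.continuous.locallyIntegrable).continuous.measurable.ennreal_ofReal _
    _ ≤ ENNReal.ofReal (2 / m * T + η / 2) + ENNReal.ofReal (η / 2) := by
      gcongr
      refine (setLIntegral_le_lintegral _ _).trans ?_
      rw [lintegral_indicator (isClosed_tsupport φ).measurableSet, setLIntegral_const,
        ← ENNReal.ofReal_toReal hKfin.ne, ← ENNReal.ofReal_mul hτ0.le]
      exact ENNReal.ofReal_le_ofReal hτN
    _ = _ := by
      rw [← ENNReal.ofReal_add (by positivity) (by positivity)]
      congr 1; ring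
end

/-- Fraction of the ball `B_r(x)` occupied by `E`. -/
def dens (E : Set (Eu n)) (x : Eu n) (r : ℝ) : ℝ :=
  volume.real (E ∩ ball x r) / (r ^ n * unitVol n)

lemma volume_inter_ball_ne_top (E : Set (Eu n)) (x : Eu n) (r : ℝ) : volume (E ∩ ball x r) ≠ ⊤ :=
  ((measure_mono inter_subset_right).trans_lt measure_ball_lt_top).ne

lemma pow_mul_unitVol_pos {r : ℝ} (hr : 0 < r) : 0 < r ^ n * unitVol n :=
  mul_pos (pow_pos hr n) (unitVol_pos n)

lemma dens_nonneg (E : Set (Eu n)) (x : Eu n) {r : ℝ} (hr : 0 < r) : 0 ≤ dens E x r :=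
  div_nonneg measureReal_nonneg (pow_mul_unitVol_pos hr).le

lemma volume_real_eq_dens (E : Set (Eu n)) (x : Eu n) {r : ℝ} (hr : 0 < r) :
    volume.real (E ∩ ball x r) = dens E x r * (r ^ n * unitVol n) :=
  (div_mul_cancel₀ _ (pow_mul_unitVol_pos hr).ne').symm

lemma dens_le_dens (E : Set (Eu n)) {x z : Eu n} {r s : ℝ} (hs : 0 < s)
    (h : s + dist z x ≤ r) : dens E z s ≤ (r / s) ^ n * dens E x r := by
  have hr : 0 < r := by linarith [dist_nonneg (x := z) (y := x)]
  have h1 : volume.real (E ∩ ball z s) ≤ volume.real (E ∩ ball x r) :=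
    measureReal_mono (inter_subset_inter_right _ (ball_subset_ball' h))
      (volume_inter_ball_ne_top _ _ _)
  rw [volume_real_eq_dens _ _ hs, volume_real_eq_dens _ _ hr] at h1
  have h2 : dens E z s * s ^ n ≤ dens E x r * r ^ n := by
    have := unitVol_pos n
    nlinarith
  rw [div_pow, div_mul_eq_mul_div, le_div_iff₀ (pow_pos hs n)]
  linarith

lemma integral_ind_inter {E : Set (Eu n)} (hE : MeasurableSet E) (x : Eu n) (r : ℝ) :
    ∫ y, ind (E ∩ ball x r) y = volume.real (E ∩ ball x r) := by
  rw [ind, integral_indicator (hE.inter measurableSet_ball)]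
  simp

lemma integrable_ind_inter {E : Set (Eu n)} (hE : MeasurableSet E) (x : Eu n) (r : ℝ) :
    Integrable (ind (E ∩ ball x r)) := by
  rw [ind, integrable_indicator_iff (hE.inter measurableSet_ball)]
  exact integrableOn_const (volume_inter_ball_ne_top _ _ _)

lemma moll_ind_le {E : Set (Eu n)} (hE : MeasurableSet E) {ε : ℝ} (hε : 0 < ε) (x : Eu n) :
    moll ε (ind E) x ≤ 2 ^ n * dens E x ε := by
  have h1 : moll ε (ind E) x ≤ ∫ y, 1 / ((ε / 2) ^ n * unitVol n) * ind (E ∩ ball x ε) y := by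
    refine integral_mono (integrable_rho_mul (locallyIntegrable_ind hE) ε x)
      ((integrable_ind_inter hE x ε).const_mul _) fun y => ?_
    by_cases hy : y ∈ ball x ε
    · by_cases hyE : y ∈ E
      · have h3 : y ∈ E ∩ ball x ε := ⟨hyE, hy⟩
        simp only [ind, indicator_of_mem hyE, indicator_of_mem h3, mul_one]
        exact rho_le hε _
      · simp [ind, hyE]
    · have h3 : rho ε (x - y) = 0 := rho_eq_zero hε (by
        rw [mem_ball, not_lt, dist_comm, dist_eq_norm] at hy; exact hy)
      simp [h3, ind, hy]
  rw [integral_const_mul, integral_ind_inter hE, volume_real_eq_dens _ _ hε] at h1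
  refine h1.trans (le_of_eq ?_)
  have := unitVol_pos n
  rw [div_pow]
  field_simp

lemma dens_le_moll_ind {E : Set (Eu n)} (hE : MeasurableSet E) {ε : ℝ} (hε : 0 < ε) (x : Eu n) :
    dens E x (ε / 2) ≤ 2 ^ n * moll ε (ind E) x := by
  have h1 : ∫ y, 1 / (ε ^ n * unitVol n) * ind (E ∩ ball x (ε / 2)) y ≤ moll ε (ind E) x := by
    refine integral_mono ((integrable_ind_inter hE x _).const_mul _)
      (integrable_rho_mul (locallyIntegrable_ind hE) ε x) fun y => ?_
    by_cases hy : y ∈ E ∩ ball x (ε / 2)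
    · simp only [ind, indicator_of_mem hy, indicator_of_mem hy.1, mul_one]
      refine le_rho hε ?_
      have := hy.2
      rw [mem_ball, dist_comm, dist_eq_norm] at this
      exact this.le
    · simp only [ind, indicator_of_notMem hy, mul_zero]
      exact mul_nonneg (rho_nonneg _ _) (ind_mem E y).1
  rw [integral_const_mul, integral_ind_inter hE, volume_real_eq_dens _ _ (half_pos hε)] at h1
  have h2 : 1 / (ε ^ n * unitVol n) * (dens E x (ε / 2) * ((ε / 2) ^ n * unitVol n)) =
      dens E x (ε / 2) / 2 ^ n := by
    have := unitVol_pos n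
    rw [div_pow]
    field_simp
  rw [h2, div_le_iff₀ (by positivity)] at h1
  linarith

lemma mem_badSet {E : Set (Eu n)} (hE : MeasurableSet E) {ε δ R : ℝ} (hε : 0 < ε) {x y : Eu n}
    (hy : dist y x + 2 * ε ≤ R) (h : (2 * (R / ε)) ^ n * dens E x R < δ) :
    y ∈ badSet (ind E) ε δ := by
  have hA : ∀ z ∈ ball y ε, moll ε (ind E) z < δ := fun z hz => by
    refine (moll_ind_le hE hε z).trans_lt (lt_of_le_of_lt ?_ h)
    rw [mul_pow, mul_assoc]
    gcongr
    refine dens_le_dens E hε ?_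
    have := dist_triangle z y x
    rw [mem_ball] at hz
    linarith
  rw [badSet, mem_ofPred_eq, moll, ← integral_rho_sub ε y]
  congr 1; ext z
  by_cases hz : z ∈ ball y ε
  · rw [show ind {x | moll ε (ind E) x < δ} z = 1 from
      indicator_of_mem (show z ∈ {x | moll ε (ind E) x < δ} from hA z hz) _, mul_one]
  · rw [mem_ball, not_lt, dist_comm, dist_eq_norm] at hz
    simp [rho_eq_zero hε hz]

/-- Almost every point with respect to the perimeter measure has density bounded below. -/
lemma BVm.measure_eventually_dens_lt {Ω : Set (Eu n)} (hΩ : IsOpen Ω) {E : Set (Eu n)}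
    (hE : MeasurableSet E) {ν : Measure (Eu n)} (h : BVm Ω (ind E) ν) :
    ν {x | ∀ᶠ r in 𝓝[>] (0 : ℝ), dens E x r < 1 / (8 * 4 ^ n)} = 0 := by
  set B : ℕ → Set (Eu n) := fun j => badSet (ind E) (1 / ((j : ℝ) + 1)) (1 / (2 * (4 : ℕ))) with hB
  have hBm : ∀ j, MeasurableSet (B j) := fun j => measurableSet_badSet h.locallyIntegrable _ _
  set Z : ℕ → Set (Eu n) := fun k => ⋂ j ≥ k, B j with hZ
  have hZm : ∀ k, MeasurableSet (Z k) := fun k =>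
    MeasurableSet.iInter fun j => MeasurableSet.iInter fun _ => hBm j
  have hsub : {x | ∀ᶠ r in 𝓝[>] (0 : ℝ), dens E x r < 1 / (8 * 4 ^ n)} ⊆ ⋃ k, Z k := by
    intro x hx
    have ht : Tendsto (fun j : ℕ => 2 * (1 / ((j : ℝ) + 1))) atTop (𝓝[>] 0) := by
      refine tendsto_nhdsWithin_iff.2 ⟨?_, Eventually.of_forall fun j => by
        simp only [mem_Ioi]; positivity⟩
      simpa using tendsto_one_div_add_atTop_nhds_zero_nat.const_mul (2 : ℝ)
    obtain ⟨k, hk⟩ := eventually_atTop.1 (ht.eventually hx)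
    refine mem_iUnion.2 ⟨k, mem_iInter₂.2 fun j hj => ?_⟩
    have hpos : (0 : ℝ) < 1 / ((j : ℝ) + 1) := by positivity
    refine mem_badSet hE hpos (R := 2 * (1 / ((j : ℝ) + 1))) (x := x) (by simp) ?_
    have h2 : 2 * (2 * (1 / ((j : ℝ) + 1)) / (1 / ((j : ℝ) + 1))) = 4 := by
      field_simp; norm_num
    have h3 := hk j hj
    rw [lt_div_iff₀ (by positivity)] at h3
    rw [h2]
    push_cast
    linarith
  refine measure_mono_null hsub (measure_iUnion_null fun k => ?_)
  have hle : ν.restrict (Z k) ≤ (1 / 2 : ℝ≥0∞) • ν := by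
    have hfin : LocFinOn Ω ((1 / 2 : ℝ≥0∞) • ν) :=
      ⟨fun K hK hKc => by
        rw [Measure.smul_apply, smul_eq_mul]
        exact ENNReal.mul_lt_top (by simp) (h.locFin.1 K hK hKc), by
        rw [Measure.smul_apply, h.locFin.2, smul_zero]⟩
    refine (h.locFin.mono_measure Measure.restrict_le_self).le_of_integral_le hΩ hfin
      fun φ hφ hφ0 => ?_
    rw [integral_smul_measure]
    have hi : 0 ≤ ∫ x, φ x ∂ν := integral_nonneg hφ0
    refine le_of_forall_pos_le_add fun η hη => ?_
    obtain ⟨j, hj1, hj2⟩ := ((tendsto_epsSeq.eventually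
      (h.eventually_lintegral_badSet_le hΩ (m := 4) (by norm_num) hφ hφ0 hη)).and
        (eventually_ge_atTop k)).exists
    have h4 : ENNReal.ofReal (∫ x in Z k, φ x ∂ν) ≤
        ENNReal.ofReal (2 / (4 : ℕ) * (∫ x, φ x ∂ν) + η) := by
      rw [ofReal_integral_eq_lintegral_ofReal (h.locFin.integrable_test hφ).integrableOn
        (Eventually.of_forall hφ0)]
      exact (lintegral_mono_set (iInter₂_subset j hj2)).trans hj1
    rw [ENNReal.ofReal_le_ofReal_iff (by positivity)] at h4
    refine h4.trans (le_of_eq ?_)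
    norm_num
  obtain ⟨K, hK, hKΩ, -, hU⟩ := exists_compact_exhaustion hΩ
  have hnull : ν (Z k ∩ Ω) = 0 := by
    rw [← hU, inter_iUnion]
    refine measure_iUnion_null fun m => ?_
    have h5 := hle (Z k ∩ K m)
    rw [Measure.restrict_apply ((hZm k).inter (hK m).measurableSet), Measure.smul_apply,
      smul_eq_mul, inter_right_comm, inter_self] at h5
    have h6 : ν (Z k ∩ K m) ≠ ⊤ :=
      ((measure_mono inter_subset_right).trans_lt (h.locFin.1 _ (hKΩ m) (hK m))).ne
    by_contra h0
    have h7 := ENNReal.mul_lt_mul_left h0 h6 (show (1 / 2 : ℝ≥0∞) < 1 by simp)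
    rw [one_mul] at h7
    exact absurd h5 (not_le.2 h7)
  refine measure_mono_null (fun x hx => ?_) (measure_union_null hnull h.locFin.2)
  by_cases hxΩ : x ∈ Ω
  · exact Or.inl ⟨hx, hxΩ⟩
  · exact Or.inr hxΩ

lemma ofReal_abs_sub_le_lintegral {v : Eu n → ℝ} (hv : ContDiff ℝ (⊤ : ℕ∞) v) (y z : Eu n) :
    ENNReal.ofReal |v (y + z) - v y| ≤
      ∫⁻ t in Icc (0 : ℝ) 1, ENNReal.ofReal (‖z‖ * ‖gradient v (y + t • z)‖) := by
  have hpath : ∀ t : ℝ, HasDerivAt (fun t : ℝ => y + t • z) z t := fun t => by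
    simpa using ((hasDerivAt_id t).smul_const z).const_add y
  have hd : ∀ t : ℝ, HasDerivAt (fun t : ℝ => v (y + t • z)) ⟪gradient v (y + t • z), z⟫ t := by
    intro t
    have h1 := (hv.differentiable (by simp) (y + t • z)).hasFDerivAt
    have h2 := h1.comp_hasDerivAt t (hpath t)
    rw [inner_gradient_eq]
    exact h2
  have hcp : Continuous fun t : ℝ => y + t • z := by fun_prop
  have hc : Continuous fun t : ℝ => ⟪gradient v (y + t • z), z⟫ :=
    ((continuous_gradient hv).comp hcp).inner continuous_const
  have hc2 : Continuous fun t : ℝ => ‖z‖ * ‖gradient v (y + t • z)‖ :=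
    continuous_const.mul ((continuous_gradient hv).comp hcp).norm
  have hF := intervalIntegral.integral_eq_sub_of_hasDerivAt (a := 0) (b := 1)
    (fun t _ => hd t) (hc.intervalIntegrable 0 1)
  simp only [one_smul, zero_smul, add_zero] at hF
  have hle : |v (y + z) - v y| ≤ ∫ t in (0 : ℝ)..1, ‖z‖ * ‖gradient v (y + t • z)‖ := by
    rw [← hF, ← Real.norm_eq_abs]
    refine intervalIntegral.norm_integral_le_of_norm_le zero_le_one
      (Eventually.of_forall fun t _ => ?_) (hc2.intervalIntegrable 0 1)
    rw [mul_comm]; exact norm_inner_le_norm _ _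
  rw [intervalIntegral.integral_of_le zero_le_one, ← integral_Icc_eq_integral_Ioc] at hle
  refine (ENNReal.ofReal_le_ofReal hle).trans (le_of_eq ?_)
  exact ofReal_integral_eq_lintegral_ofReal hc2.continuousOn.integrableOn_Icc
    (Eventually.of_forall fun t => by positivity)

lemma lintegral_ball_translate_le {g : Eu n → ℝ≥0∞} (x z : Eu n) (r : ℝ) {R : ℝ}
    (h : r + ‖z‖ ≤ R) : ∫⁻ y in ball x r, g (y + z) ≤ ∫⁻ y in ball x R, g y := by
  rw [← lintegral_indicator measurableSet_ball, ← lintegral_indicator measurableSet_ball,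
    ← lintegral_add_right_eq_self ((ball x R).indicator g) z]
  refine lintegral_mono fun y => ?_
  by_cases hy : y ∈ ball x r
  · have : y + z ∈ ball x R := by
      rw [mem_ball, dist_eq_norm] at hy ⊢
      have := norm_add_le (y - x) z
      rw [show y + z - x = y - x + z by abel]
      linarith
    simp [hy, this]
  · simp [hy]

lemma lintegral_translate_sub_le {v : Eu n → ℝ} (hv : ContDiff ℝ (⊤ : ℕ∞) v) (x z : Eu n) {r : ℝ}
    (hz : ‖z‖ ≤ 2 * r) : ∫⁻ y in ball x r, ENNReal.ofReal |v (y + z) - v y| ≤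
      ENNReal.ofReal (2 * r) * ∫⁻ y in ball x (3 * r), ENNReal.ofReal ‖gradient v y‖ := by
  have hm : Measurable fun p : Eu n × ℝ =>
      ENNReal.ofReal (‖z‖ * ‖gradient v (p.1 + p.2 • z)‖) := by
    refine Measurable.ennreal_ofReal (Continuous.measurable ?_)
    exact continuous_const.mul ((continuous_gradient hv).comp (by fun_prop)).norm
  calc _ ≤ ∫⁻ y in ball x r, ∫⁻ t in Icc (0 : ℝ) 1,
        ENNReal.ofReal (‖z‖ * ‖gradient v (y + t • z)‖) :=
        lintegral_mono fun y => ofReal_abs_sub_le_lintegral hv y z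
    _ = ∫⁻ t in Icc (0 : ℝ) 1, ∫⁻ y in ball x r,
        ENNReal.ofReal (‖z‖ * ‖gradient v (y + t • z)‖) :=
        lintegral_lintegral_swap hm.aemeasurable
    _ ≤ ∫⁻ t in Icc (0 : ℝ) 1, ENNReal.ofReal (2 * r) *
        ∫⁻ y in ball x (3 * r), ENNReal.ofReal ‖gradient v y‖ := by
      refine setLIntegral_mono' measurableSet_Icc fun t ht => ?_
      simp_rw [ENNReal.ofReal_mul (norm_nonneg z)]
      rw [lintegral_const_mul' _ _ ENNReal.ofReal_ne_top]
      refine mul_le_mul' (ENNReal.ofReal_le_ofReal hz) ?_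
      refine lintegral_ball_translate_le (g := fun y => ENNReal.ofReal ‖gradient v y‖) x (t • z) r ?_
      rw [norm_smul, Real.norm_of_nonneg ht.1]
      nlinarith [ht.2, norm_nonneg z]
    _ = _ := by rw [setLIntegral_const]; simp

lemma lintegral_lintegral_sub_le {v : Eu n → ℝ} (hv : ContDiff ℝ (⊤ : ℕ∞) v) (x : Eu n) {r : ℝ} :
    ∫⁻ y in ball x r, ∫⁻ z in ball x r, ENNReal.ofReal |v z - v y| ≤
      volume (ball (0 : Eu n) (2 * r)) * (ENNReal.ofReal (2 * r) *
        ∫⁻ y in ball x (3 * r), ENNReal.ofReal ‖gradient v y‖) := by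
  have hvc := hv.continuous
  have hm : Measurable fun p : Eu n × Eu n => ENNReal.ofReal |v (p.1 + p.2) - v p.1| := by
    refine Measurable.ennreal_ofReal (Continuous.measurable ?_)
    fun_prop
  calc _ ≤ ∫⁻ y in ball x r, ∫⁻ z in ball (0 : Eu n) (2 * r), ENNReal.ofReal |v (y + z) - v y| := by
        refine setLIntegral_mono' measurableSet_ball fun y hy => ?_
        rw [← lintegral_indicator measurableSet_ball, ← lintegral_indicator measurableSet_ball,
          ← lintegral_add_left_eq_self _ y]
        refine lintegral_mono fun z => ?_
        by_cases hz : y + z ∈ ball x r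
        · have : z ∈ ball (0 : Eu n) (2 * r) := by
            rw [mem_ball, dist_eq_norm] at hy hz
            rw [mem_ball_zero_iff]
            have := norm_sub_le (y + z - x) (y - x)
            rw [show y + z - x - (y - x) = z by abel] at this
            linarith
          simp [hz, this]
        · simp [hz]
    _ = ∫⁻ z in ball (0 : Eu n) (2 * r), ∫⁻ y in ball x r, ENNReal.ofReal |v (y + z) - v y| :=
        lintegral_lintegral_swap hm.aemeasurable
    _ ≤ ∫⁻ z in ball (0 : Eu n) (2 * r), ENNReal.ofReal (2 * r) *
        ∫⁻ y in ball x (3 * r), ENNReal.ofReal ‖gradient v y‖ := by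
        refine setLIntegral_mono' measurableSet_ball fun z hz => ?_
        exact lintegral_translate_sub_le hv x z (mem_ball_zero_iff.1 hz).le
    _ = _ := by rw [setLIntegral_const, mul_comm]

lemma measure_mul_measure_le {E : Set (Eu n)} (hE : MeasurableSet E) {v : Eu n → ℝ}
    (hv : Measurable v) (x : Eu n) (r : ℝ) :
    volume (E ∩ ball x r) * volume (ball x r \ E) ≤
      (∫⁻ y in ball x r, ∫⁻ z in ball x r, ENNReal.ofReal |v z - v y|) +
        ENNReal.ofReal 2 * volume (ball x r) * ∫⁻ y in ball x r, ENNReal.ofReal |v y - ind E y| := by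
  set B := ball x r
  set a : Eu n → ℝ≥0∞ := fun y => ENNReal.ofReal |v y - ind E y| with ha
  have ham : Measurable a := ((hv.sub (measurable_ind hE)).norm).ennreal_ofReal
  have hB : MeasurableSet B := measurableSet_ball
  have key : ∀ y z, E.indicator (fun _ => (1 : ℝ≥0∞)) y * Eᶜ.indicator (fun _ => 1) z ≤
      ENNReal.ofReal |v z - v y| + (a y + a z) := fun y z => by
    by_cases hy : y ∈ E
    · by_cases hz : z ∈ E
      · simp [hz]
      · simp only [ha]
        rw [← ENNReal.ofReal_add (abs_nonneg _) (abs_nonneg _),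
          ← ENNReal.ofReal_add (abs_nonneg _) (by positivity)]
        simp only [ind, indicator_of_mem hy, indicator_of_notMem hz,
          indicator_of_mem (show z ∈ Eᶜ from hz), mul_one]
        rw [← ENNReal.ofReal_one]
        refine ENNReal.ofReal_le_ofReal ?_
        have h1 := neg_abs_le (v z - v y)
        have h2 := neg_abs_le (v y - 1)
        have h3 := le_abs_self (v z - 0)
        linarith
    · simp [hy]
  have h1 : volume (E ∩ B) * volume (B \ E) =
      ∫⁻ y in B, ∫⁻ z in B, E.indicator (fun _ => (1 : ℝ≥0∞)) y * Eᶜ.indicator (fun _ => 1) z := by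
    have h2 : ∀ y, ∫⁻ z in B, E.indicator (fun _ => (1 : ℝ≥0∞)) y * Eᶜ.indicator (fun _ => 1) z =
        E.indicator (fun _ => (1 : ℝ≥0∞)) y * volume (B \ E) := fun y => by
      rw [lintegral_const_mul _ (measurable_const.indicator hE.compl),
        lintegral_indicator_const hE.compl, Measure.restrict_apply hE.compl, one_mul,
        sdiff_eq, inter_comm B]
    simp_rw [h2]
    rw [lintegral_mul_const _ (measurable_const.indicator hE), lintegral_indicator_const hE,
      Measure.restrict_apply hE, one_mul]
  rw [h1]
  calc _ ≤ ∫⁻ y in B, ∫⁻ z in B, (ENNReal.ofReal |v z - v y| + (a y + a z)) :=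
        lintegral_mono fun y => lintegral_mono fun z => key y z
    _ = ∫⁻ y in B, ((∫⁻ z in B, ENNReal.ofReal |v z - v y|) +
          (a y * volume B + ∫⁻ z in B, a z)) := by
        refine lintegral_congr fun y => ?_
        have h3 : Measurable fun z => a y + a z := measurable_const.add ham
        rw [lintegral_add_right _ h3, lintegral_add_left measurable_const,
          setLIntegral_const]
    _ = _ := by
        have h3 : Measurable fun y => a y * volume B + ∫⁻ z in B, a z :=
          (ham.mul_const _).add_const _
        rw [lintegral_add_right _ h3, lintegral_add_left (ham.mul_const _), setLIntegral_const,
          lintegral_mul_const _ ham, ENNReal.ofReal_ofNat]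
        ring

/-- Relative isoperimetric inequality. -/
lemma BVm.dens_mul_le {Ω : Set (Eu n)} (hΩ : IsOpen Ω) {E : Set (Eu n)} (hE : MeasurableSet E)
    {ν : Measure (Eu n)} (h : BVm Ω (ind E) ν) {x : Eu n} {r : ℝ} (hr : 0 < r)
    (hx : closedBall x (4 * r) ⊆ Ω) :
    dens E x r * (1 - dens E x r) * (r ^ n * unitVol n) ≤
      2 ^ (n + 1) * r * (ν (closedBall x (4 * r))).toReal := by
  have hνfin := h.locFin.1 _ hx (isCompact_closedBall _ _)
  obtain ⟨χ, hχ, hχ0, hχ1, U, -, hKU, -, hχU⟩ := exists_cutoff (isOpen_ball (x := x) (ε := 4 * r))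
    (isCompact_closedBall x (3 * r)) (closedBall_subset_ball (by linarith))
  have hχΩ : IsTest Ω χ := hχ.mono (ball_subset_closedBall.trans hx)
  have hχν : ∫ y, χ y ∂ν ≤ (ν (closedBall x (4 * r))).toReal := by
    have h1 : ∫ y, χ y ∂ν ≤ ∫ y, (closedBall x (4 * r)).indicator (fun _ => (1 : ℝ)) y ∂ν := by
      refine integral_mono (h.locFin.integrable_test hχΩ) ?_ fun y => ?_
      · rw [integrable_indicator_iff isClosed_closedBall.measurableSet]
        exact integrableOn_const hνfin.ne
      · by_cases hy : y ∈ closedBall x (4 * r)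
        · rw [indicator_of_mem hy]; exact hχ1 y
        · rw [image_eq_zero_of_notMem_tsupport fun h' => hy (ball_subset_closedBall (hχ.2.2 h'))]
          exact indicator_nonneg (fun _ _ => zero_le_one) _
    refine h1.trans (le_of_eq ?_)
    rw [integral_indicator isClosed_closedBall.measurableSet]
    simp [Measure.real]
  set N := (ν (closedBall x (4 * r))).toReal
  have hN : 0 ≤ N := ENNReal.toReal_nonneg
  have hω := unitVol_pos n
  have hBr : volume.real (ball x r) = r ^ n * unitVol n := volume_real_ball x hr
  have hB2r : volume.real (ball (0 : Eu n) (2 * r)) = (2 * r) ^ n * unitVol n :=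
    volume_real_ball 0 (by linarith)
  have hlim := tendsto_integral_comp_moll h.meas (abs_ind_le E) continuous_id
    (isCompact_closedBall x r)
  have hmain : ∀ η > 0, volume.real (E ∩ ball x r) * volume.real (ball x r \ E) ≤
      (2 * r) ^ n * unitVol n * (2 * r * (N + η)) + 2 * (r ^ n * unitVol n) * η := by
    intro η hη
    obtain ⟨ε, h1, h2⟩ := ((h.eventually_integral_gradient_le hΩ hχΩ hχ0 hη).and
      (hlim.eventually (gt_mem_nhds hη))).exists
    have hs := contDiff_moll ε h.locallyIntegrable
    have hgr : ∫⁻ y in ball x (3 * r), ENNReal.ofReal ‖gradient (moll ε (ind E)) y‖ ≤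
        ENNReal.ofReal (N + η) := by
      refine le_trans ?_ (ENNReal.ofReal_le_ofReal (h1.trans (add_le_add_left hχν η)))
      rw [lintegral_mul_norm_eq hχΩ.continuous hχ.2.1 hχ0 hs]
      refine le_trans (setLIntegral_mono' measurableSet_ball fun y hy => ?_)
        (setLIntegral_le_lintegral _ _)
      rw [hχU y (hKU (ball_subset_closedBall hy))]; simp
    have hL1 : ∫⁻ y in ball x r, ENNReal.ofReal |moll ε (ind E) y - ind E y| ≤
        ENNReal.ofReal η := by
      have hi : IntegrableOn (fun y => |moll ε (ind E) y - ind E y|) (closedBall x r) :=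
        ((hs.continuous.locallyIntegrable.integrableOn_isCompact (isCompact_closedBall x r)).sub
          (h.locallyIntegrable.integrableOn_isCompact (isCompact_closedBall x r))).abs
      refine (lintegral_mono_set ball_subset_closedBall).trans ?_
      rw [← ofReal_integral_eq_lintegral_ofReal hi (Eventually.of_forall fun y => abs_nonneg _)]
      exact ENNReal.ofReal_le_ofReal h2.le
    have hk := measure_mul_measure_le hE hs.continuous.measurable x r
    have hk2 := hk.trans (add_le_add ((lintegral_lintegral_sub_le hs x).trans
      (mul_le_mul_right (mul_le_mul_right hgr _) _)) (mul_le_mul_right hL1 _))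
    have e1 : volume (ball (0 : Eu n) (2 * r)) = ENNReal.ofReal ((2 * r) ^ n * unitVol n) := by
      rw [← hB2r, ofReal_measureReal measure_ball_lt_top.ne]
    have e2 : volume (ball x r) = ENNReal.ofReal (r ^ n * unitVol n) := by
      rw [← hBr, ofReal_measureReal measure_ball_lt_top.ne]
    rw [e1, e2, ← ENNReal.ofReal_mul (by positivity), ← ENNReal.ofReal_mul (by positivity),
      ← ENNReal.ofReal_mul (by positivity),
      ← ENNReal.ofReal_mul (by positivity), ← ENNReal.ofReal_add (by positivity) (by positivity)]
      at hk2
    have h3 := ENNReal.toReal_mono ENNReal.ofReal_ne_top hk2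
    rwa [ENNReal.toReal_mul, ENNReal.toReal_ofReal (by positivity)] at h3
  have hfin : volume.real (E ∩ ball x r) * volume.real (ball x r \ E) ≤
      (2 * r) ^ n * unitVol n * (2 * r * N) := by
    have ht : Tendsto (fun η : ℝ => (2 * r) ^ n * unitVol n * (2 * r * (N + η)) +
        2 * (r ^ n * unitVol n) * η) (𝓝[>] 0) (𝓝 ((2 * r) ^ n * unitVol n * (2 * r * (N + 0)) +
        2 * (r ^ n * unitVol n) * 0)) := by
      refine Tendsto.mono_left (Continuous.tendsto ?_ 0) nhdsWithin_le_nhds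
      fun_prop
    have := ge_of_tendsto ht (by filter_upwards [self_mem_nhdsWithin] with η hη; exact hmain η hη)
    simpa using this
  have hdiff : volume.real (ball x r \ E) = (1 - dens E x r) * (r ^ n * unitVol n) := by
    have := measureReal_inter_add_sdiff (μ := volume) (s := ball x r) hE measure_ball_lt_top.ne
    rw [inter_comm, volume_real_eq_dens _ _ hr, hBr] at this
    linarith
  rw [volume_real_eq_dens _ _ hr, hdiff, mul_pow] at hfin
  have hp : 0 < r ^ n * unitVol n := pow_mul_unitVol_pos hr
  refine le_of_mul_le_mul_right (hfin.trans' (le_of_eq (by ring)) |>.trans (le_of_eq (by ring))) hp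

/-- A field `σ` with `|σ| ≤ 1` whose negative divergence is the Radon measure `μ`. -/
structure SigM (Ω : Set (Eu n)) (σ : Eu n → Eu n) (μ : Measure (Eu n)) : Prop where
  bdd : Bdd Ω σ 1
  rep : RepNegDiv Ω σ μ 0
  locFin : LocFinOn Ω μ

namespace SigM
variable {Ω : Set (Eu n)} {σ : Eu n → Eu n} {μ : Measure (Eu n)}

lemma integral_eq (h : SigM Ω σ μ) {φ : Eu n → ℝ} (hφ : IsTest Ω φ) :
    ∫ x, φ x ∂μ = ∫ x in Ω, ⟪σ x, gradient φ x⟫ := by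
  simpa using (h.rep φ hφ).symm

lemma integrableOn_inner (h : SigM Ω σ μ) {G : Eu n → Eu n} (hG : Integrable G) :
    IntegrableOn (fun x => ⟪σ x, G x⟫) Ω := by
  refine hG.integrableOn.norm.mono' (h.bdd.1.inner hG.integrableOn.aestronglyMeasurable) ?_
  filter_upwards [h.bdd.2] with x hx
  calc ‖⟪σ x, G x⟫‖ ≤ ‖σ x‖ * ‖G x‖ := norm_inner_le_norm _ _
    _ ≤ 1 * ‖G x‖ := by gcongr
    _ = _ := one_mul _

lemma setIntegral_inner_le (h : SigM Ω σ μ) {G : Eu n → Eu n} (hG : Integrable G) :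
    ∫ x in Ω, ⟪σ x, G x⟫ ≤ ∫ x in Ω, ‖G x‖ := by
  refine integral_mono_ae (h.integrableOn_inner hG) hG.integrableOn.norm ?_
  filter_upwards [h.bdd.2] with x hx
  calc ⟪σ x, G x⟫ ≤ ‖σ x‖ * ‖G x‖ := real_inner_le_norm _ _
    _ ≤ 1 * ‖G x‖ := by gcongr
    _ = _ := one_mul _
end SigM

lemma IsTest.integrable_gradient {Ω : Set (Eu n)} {φ : Eu n → ℝ} (hφ : IsTest Ω φ) :
    Integrable (gradient φ) :=
  (continuous_gradient hφ.1).integrable_of_hasCompactSupport hφ.hasCompactSupport_gradient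

lemma exists_scaled_bump (n : ℕ) : ∃ M : ℝ, 0 < M ∧ ∀ (x : Eu n) (r : ℝ), 0 < r →
    ∃ φ : Eu n → ℝ, ContDiff ℝ (⊤ : ℕ∞) φ ∧ tsupport φ ⊆ closedBall x (2 * r) ∧ (∀ y, 0 ≤ φ y) ∧
      (∀ y ∈ closedBall x r, φ y = 1) ∧ ∀ y, ‖gradient φ y‖ ≤ M / r := by
  set b := bmp n 2
  have hb : ContDiff ℝ (⊤ : ℕ∞) b := b.contDiff
  have hcg : HasCompactSupport (fderiv ℝ b) := b.hasCompactSupport.fderiv ℝ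
  obtain ⟨M, hM⟩ := hcg.exists_bound_of_continuous (hb.continuous_fderiv (by simp))
  refine ⟨max M 1, by positivity, fun x r hr => ?_⟩
  have hout : b.rOut = 2 := bmp_rOut two_pos
  have hin : b.rIn = 1 := by rw [show b.rIn = 2 / 2 from bmp_rIn two_pos]; norm_num
  have hnorm : ∀ y : Eu n, dist (r⁻¹ • (y - x)) 0 = dist y x / r := fun y => by
    rw [dist_zero_right, norm_smul, norm_inv, Real.norm_of_nonneg hr.le, dist_eq_norm]; field_simp
  refine ⟨fun y => b (r⁻¹ • (y - x)), hb.comp (by fun_prop), ?_, fun y => b.nonneg, ?_, ?_⟩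
  · refine closure_minimal (fun y hy => ?_) isClosed_closedBall
    have : r⁻¹ • (y - x) ∈ Function.support b := hy
    rw [b.support_eq, mem_ball, hnorm, hout, div_lt_iff₀ hr] at this
    exact mem_closedBall.2 this.le
  · intro y hy
    refine b.one_of_mem_closedBall ?_
    rw [mem_closedBall, hnorm, hin, div_le_one hr]
    exact mem_closedBall.1 hy
  · intro y
    have hd : HasFDerivAt (fun y : Eu n => r⁻¹ • (y - x)) (r⁻¹ • ContinuousLinearMap.id ℝ (Eu n)) y :=
      ((hasFDerivAt_id y).sub_const x).const_smul r⁻¹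
    have := ((hb.differentiable (by simp)) (r⁻¹ • (y - x))).hasFDerivAt.comp y hd
    rw [norm_gradient_eq]
    change ‖fderiv ℝ (b ∘ fun y => r⁻¹ • (y - x)) y‖ ≤ _
    rw [this.fderiv]
    rw [ContinuousLinearMap.comp_smul, ContinuousLinearMap.comp_id, norm_smul, norm_inv,
      Real.norm_of_nonneg hr.le, div_eq_inv_mul]
    gcongr
    exact (hM _).trans (le_max_left _ _)

/-- Balls of radius `r` have `-Div σ`-measure of order `r ^ (n - 1)`. -/
lemma exists_sigM_ball_bound (n : ℕ) : ∃ C : ℝ, 0 < C ∧ ∀ (Ω : Set (Eu n)) (σ : Eu n → Eu n)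
    (μ : Measure (Eu n)), SigM Ω σ μ → ∀ (x : Eu n) (r : ℝ), 0 < r → closedBall x (2 * r) ⊆ Ω →
      ENNReal.ofReal r * μ (closedBall x r) ≤ ENNReal.ofReal (C * r ^ n) := by
  obtain ⟨M, hM, H⟩ := exists_scaled_bump n
  refine ⟨M * (2 ^ n * unitVol n), by have := unitVol_pos n; positivity, fun Ω σ μ h x r hr hx => ?_⟩
  obtain ⟨φ, hφ, hs, h0, h1, hg⟩ := H x r hr
  have hcs : HasCompactSupport φ := HasCompactSupport.of_support_subset_isCompact
    (isCompact_closedBall x (2 * r)) ((subset_tsupport _).trans hs)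
  have hT : IsTest Ω φ := ⟨hφ, hcs, hs.trans hx⟩
  have hwint : Integrable φ μ := h.locFin.integrable_test hT
  have hKfin : μ (closedBall x r) < ⊤ :=
    h.locFin.1 _ ((closedBall_subset_closedBall (by linarith)).trans hx) (isCompact_closedBall _ _)
  have e1 : (μ (closedBall x r)).toReal ≤ ∫ y, φ y ∂μ := by
    rw [show (μ (closedBall x r)).toReal = ∫ y in closedBall x r, (1 : ℝ) ∂μ by simp [Measure.real]]
    rw [← integral_indicator measurableSet_closedBall]
    refine integral_mono ((integrable_indicator_iff measurableSet_closedBall).2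
      (integrableOn_const hKfin.ne)) hwint fun y => ?_
    by_cases hy : y ∈ closedBall x r
    · simp [hy, h1 y hy]
    · simp [hy, h0 y]
  have e2 : ∫ y, φ y ∂μ ≤ M / r * ((2 * r) ^ n * unitVol n) := by
    rw [h.integral_eq hT]
    refine (h.setIntegral_inner_le hT.integrable_gradient).trans ?_
    calc ∫ y in Ω, ‖gradient φ y‖ ≤ ∫ y, ‖gradient φ y‖ :=
          setIntegral_le_integral hT.integrable_gradient.norm (Eventually.of_forall fun _ => norm_nonneg _)
      _ = ∫ y in closedBall x (2 * r), ‖gradient φ y‖ := by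
          refine (setIntegral_eq_integral_of_forall_compl_eq_zero fun y hy => ?_).symm
          rw [gradient_eq_zero_of_notMem (fun hy' => hy (hs hy')), norm_zero]
      _ ≤ ∫ y in closedBall x (2 * r), M / r := by
          refine integral_mono hT.integrable_gradient.norm.integrableOn
            (integrableOn_const (isCompact_closedBall _ _).measure_lt_top.ne) hg
      _ = _ := by
          rw [setIntegral_const, volume_real_closedBall _ (by positivity), smul_eq_mul, mul_comm]
  rw [← ENNReal.ofReal_toReal hKfin.ne, ← ENNReal.ofReal_mul hr.le]
  refine ENNReal.ofReal_le_ofReal ?_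
  calc _ ≤ r * (M / r * ((2 * r) ^ n * unitVol n)) := by gcongr; exact e1.trans e2
    _ = _ := by rw [mul_pow]; field_simp

/-- Comparison of a divergence measure with a measure of large lower density, by Vitali covering. -/
lemma exists_sigM_covering (n : ℕ) : ∃ C : ℝ, 0 < C ∧ ∀ (Ω : Set (Eu n)) (σ : Eu n → Eu n)
    (μ : Measure (Eu n)), SigM Ω σ μ → ∀ (ν : Measure (Eu n)) (A B : Set (Eu n)) (c R : ℝ), 0 < c →
      (∀ x ∈ A, ∃ r, 0 < r ∧ r ≤ R ∧ closedBall x r ⊆ B ∧ closedBall x (8 * r) ⊆ Ω ∧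
        ENNReal.ofReal (c * r ^ n) ≤ ENNReal.ofReal r * ν (closedBall x r)) →
      μ A ≤ ENNReal.ofReal (C / c) * ν B := by
  obtain ⟨C, hC, H⟩ := exists_sigM_ball_bound n
  refine ⟨C * 4 ^ n / 4, by positivity, fun Ω σ μ h ν A B c R hc hA => ?_⟩
  choose! r hr0 hrR hrB hrΩ hrν using hA
  obtain ⟨u, huA, hud, huc⟩ := Vitali.exists_disjoint_subfamily_covering_enlargement_closedBall
    A (fun x => x) r R hrR 4 (by norm_num)
  have hcount : u.Countable := by
    refine Set.PairwiseDisjoint.countable_of_nonempty_interior hud fun x hx => ?_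
    exact ⟨x, ball_subset_interior_closedBall (mem_ball_self (hr0 x (huA hx)))⟩
  have hball : ∀ x ∈ u, μ (closedBall x (4 * r x)) ≤
      ENNReal.ofReal (C * 4 ^ n / 4 / c) * ν (closedBall x (r x)) := by
    intro x hx
    have hr := hr0 x (huA hx)
    have h1 := H Ω σ μ h x (4 * r x) (by positivity) (by convert hrΩ x (huA hx) using 2; ring)
    have h2 : ENNReal.ofReal (C * (4 * r x) ^ n) =
        ENNReal.ofReal (C * 4 ^ n / c) * ENNReal.ofReal (c * r x ^ n) := by
      rw [← ENNReal.ofReal_mul (by positivity)]; congr 1; rw [mul_pow]; field_simp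
    have h3 : ENNReal.ofReal (4 * r x) * μ (closedBall x (4 * r x)) ≤
        ENNReal.ofReal (4 * r x) * (ENNReal.ofReal (C * 4 ^ n / 4 / c) * ν (closedBall x (r x))) := by
      refine h1.trans (h2.le.trans ((mul_le_mul_right (hrν x (huA hx)) _).trans_eq ?_))
      rw [← mul_assoc, ← mul_assoc, ← ENNReal.ofReal_mul (by positivity),
        ← ENNReal.ofReal_mul (by positivity)]
      congr 2; field_simp
    exact (ENNReal.mul_le_mul_iff_right (by simpa using hr) ENNReal.ofReal_ne_top).1 h3
  have : Countable u := hcount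
  calc μ A ≤ μ (⋃ x ∈ u, closedBall x (4 * r x)) := by
        refine measure_mono fun x hx => ?_
        obtain ⟨b, hb, hsub⟩ := huc x hx
        exact mem_biUnion hb (hsub (mem_closedBall_self (hr0 x hx).le))
    _ ≤ ∑' x : u, μ (closedBall x.1 (4 * r x)) := measure_biUnion_le _ hcount _
    _ ≤ ∑' x : u, ENNReal.ofReal (C * 4 ^ n / 4 / c) * ν (closedBall x.1 (r x)) :=
        ENNReal.tsum_le_tsum fun x => hball x.1 x.2
    _ = ENNReal.ofReal (C * 4 ^ n / 4 / c) * ∑' x : u, ν (closedBall x.1 (r x)) := ENNReal.tsum_mul_left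
    _ = ENNReal.ofReal (C * 4 ^ n / 4 / c) * ν (⋃ x ∈ u, closedBall x (r x)) := by
        rw [measure_biUnion hcount hud fun _ _ => measurableSet_closedBall]
    _ ≤ _ := mul_le_mul_right (measure_mono (iUnion₂_subset fun x hx => hrB x (huA hx))) _

/-- A divergence measure does not charge `ν`-null sets on which `ν` has positive upper
`(n-1)`-density. -/
lemma SigM.measure_null_of_frequently {Ω : Set (Eu n)} (hΩ : IsOpen Ω) {σ : Eu n → Eu n}
    {μ ν : Measure (Eu n)} (h : SigM Ω σ μ) (hν : LocFinOn Ω ν) {Z : Set (Eu n)} (hZΩ : Z ⊆ Ω)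
    (hZ : ν Z = 0)
    (hc : ∀ x ∈ Z, ∃ c : ℝ, 0 < c ∧ ∃ᶠ r in 𝓝[>] (0 : ℝ),
      ENNReal.ofReal (c * r ^ n) ≤ ENNReal.ofReal r * ν (closedBall x r)) : μ Z = 0 := by
  obtain ⟨C, hC, H⟩ := exists_sigM_covering n
  obtain ⟨K, hKc, hKΩ, -, hKu⟩ := exists_compact_exhaustion hΩ
  have key : ∀ j i : ℕ, μ {x ∈ Z | x ∈ K i ∧ ∃ᶠ r in 𝓝[>] (0 : ℝ),
      ENNReal.ofReal (1 / (j + 1) * r ^ n) ≤ ENNReal.ofReal r * ν (closedBall x r)} = 0 := by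
    intro j i
    obtain ⟨L, hLc, hKL, hLΩ⟩ := exists_compact_between (hKc i) hΩ (hKΩ i)
    have : IsFiniteMeasure (ν.restrict L) := ⟨by simpa using hν.1 L hLΩ hLc⟩
    have hZL : ν.restrict L Z = 0 := Measure.restrict_le_self.absolutelyContinuous hZ
    have hle : ∀ η : ℝ≥0∞, η ≠ 0 → η ≠ ⊤ → μ {x ∈ Z | x ∈ K i ∧ ∃ᶠ r in 𝓝[>] (0 : ℝ),
        ENNReal.ofReal (1 / (j + 1) * r ^ n) ≤ ENNReal.ofReal r * ν (closedBall x r)} ≤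
        ENNReal.ofReal (C / (1 / (j + 1))) * η := by
      intro η hη hη'
      obtain ⟨V, hZV, hV, hVη⟩ := Z.exists_isOpen_lt_of_lt (μ := ν.restrict L) η
        (by rw [hZL]; exact hη.bot_lt)
      have hB : ν (V ∩ interior L) ≤ η := by
        refine le_trans ?_ hVη.le
        rw [Measure.restrict_apply hV.measurableSet]
        exact measure_mono (inter_subset_inter_right _ interior_subset)
      refine (H Ω σ μ h ν _ (V ∩ interior L) (1 / (j + 1)) 1 (by positivity) ?_).trans
        (mul_le_mul_right hB _)
      rintro x ⟨hxZ, hxK, hfr⟩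
      have hVi : V ∩ interior L ∈ 𝓝 x := (hV.inter isOpen_interior).mem_nhds ⟨hZV hxZ, hKL hxK⟩
      obtain ⟨s, hs, hsV⟩ := nhds_basis_closedBall.mem_iff.1 hVi
      have hev : ∀ᶠ r in 𝓝[>] (0 : ℝ), 0 < r ∧ r < min 1 (s / 8) := by
        filter_upwards [Ioo_mem_nhdsGT (show (0 : ℝ) < min 1 (s / 8) by positivity)] with r hr using hr
      obtain ⟨r, hr1, hr0, hr2⟩ := (hfr.and_eventually hev).exists
      have hr3 := hr2.le.trans (min_le_left _ _)
      have hr4 := hr2.le.trans (min_le_right _ _)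
      refine ⟨r, hr0, hr3, (closedBall_subset_closedBall (by linarith)).trans hsV,
        (closedBall_subset_closedBall (by linarith)).trans
          (hsV.trans (inter_subset_right.trans (interior_subset.trans hLΩ))), hr1⟩
    have hlim : Tendsto (fun η : ℝ≥0∞ => ENNReal.ofReal (C / (1 / (j + 1))) * η) (𝓝[>] 0)
        (𝓝 (ENNReal.ofReal (C / (1 / (j + 1))) * 0)) :=
      (ENNReal.Tendsto.const_mul tendsto_id (Or.inr ENNReal.ofReal_ne_top)).mono_left
        nhdsWithin_le_nhds
    rw [mul_zero] at hlim
    refine le_antisymm (ge_of_tendsto hlim ?_) zero_le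
    filter_upwards [Ioo_mem_nhdsGT (zero_lt_one (α := ℝ≥0∞))] with η hη
    exact hle η hη.1.ne' (hη.2.trans ENNReal.one_lt_top).ne
  refine measure_mono_null (fun x hx => ?_)
    (measure_iUnion_null fun j => measure_iUnion_null fun i => key j i)
  obtain ⟨c, hc0, hfr⟩ := hc x hx
  obtain ⟨j, hj⟩ := exists_nat_one_div_lt hc0
  obtain ⟨i, hi⟩ := mem_iUnion.1 (hKu ▸ hZΩ hx : x ∈ ⋃ m, K m)
  refine mem_iUnion.2 ⟨j, mem_iUnion.2 ⟨i, hx, hi, ?_⟩⟩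
  refine (hfr.and_eventually self_mem_nhdsWithin).mono fun r hr => le_trans ?_ hr.1
  have hr0 : 0 < r := hr.2
  refine ENNReal.ofReal_le_ofReal ?_
  gcongr

lemma tendsto_const_mul_nhdsGT {c : ℝ} (hc : 0 < c) :
    Tendsto (fun r : ℝ => c * r) (𝓝[>] 0) (𝓝[>] 0) := by
  refine tendsto_nhdsWithin_iff.2 ⟨?_, ?_⟩
  · have : Tendsto (fun r : ℝ => c * r) (𝓝 0) (𝓝 (c * 0)) :=
      (continuous_const.mul continuous_id).tendsto 0
    rw [mul_zero] at this
    exact this.mono_left nhdsWithin_le_nhds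
  · filter_upwards [self_mem_nhdsWithin] with r hr using mul_pos hc hr

lemma densityZeroAt_iff (E : Set (Eu n)) (x : Eu n) :
    DensityZeroAt E x ↔ Tendsto (dens E x) (𝓝[>] 0) (𝓝 0) := by
  have heq : ∀ r : ℝ, 0 < r → volume (E ∩ ball x r) / volume (ball x r) =
      ENNReal.ofReal (dens E x r) := fun r hr => by
    rw [dens, ENNReal.ofReal_div_of_pos (pow_mul_unitVol_pos hr), ← volume_real_ball x hr,
      Measure.real, Measure.real, ENNReal.ofReal_toReal (volume_inter_ball_ne_top E x r),
      ENNReal.ofReal_toReal measure_ball_lt_top.ne]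
  have h1 : DensityZeroAt E x ↔
      Tendsto (fun r => ENNReal.ofReal (dens E x r)) (𝓝[>] 0) (𝓝 0) :=
    tendsto_congr' (by filter_upwards [self_mem_nhdsWithin] with r hr using heq r hr)
  rw [h1]
  constructor
  · intro h
    have h2 := (ENNReal.tendsto_toReal ENNReal.zero_ne_top).comp h
    refine (tendsto_congr' ?_).1 h2
    filter_upwards [self_mem_nhdsWithin] with r hr
    exact ENNReal.toReal_ofReal (dens_nonneg E x hr)
  · intro h
    simpa using ENNReal.tendsto_ofReal h

lemma frequently_le_dens {E : Set (Eu n)} {x : Eu n} (h : ¬ DensityZeroAt E x) :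
    ∃ e : ℝ, 0 < e ∧ ∃ᶠ r in 𝓝[>] (0 : ℝ), e ≤ dens E x r := by
  by_contra! H
  refine h ((densityZeroAt_iff E x).2 (Metric.tendsto_nhds.2 fun e he => ?_))
  filter_upwards [H e he, self_mem_nhdsWithin] with r hr hr0
  rw [Real.dist_eq, sub_zero, abs_of_nonneg (dens_nonneg E x hr0)]
  exact hr

/-- Points of `E` with intermediate density carry a definite amount of perimeter. -/
lemma BVm.le_measure_closedBall {Ω : Set (Eu n)} (hΩ : IsOpen Ω) {E : Set (Eu n)}
    (hE : MeasurableSet E) {ν : Measure (Eu n)} (h : BVm Ω (ind E) ν) {x : Eu n} {r a : ℝ}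
    (hr : 0 < r) (hx : closedBall x (4 * r) ⊆ Ω) (ha : 0 ≤ a) (har : a ≤ dens E x r)
    (hr2 : dens E x r ≤ 1 / 2) :
    ENNReal.ofReal (a * (unitVol n / 8 ^ n) * (4 * r) ^ n) ≤
      ENNReal.ofReal (4 * r) * ν (closedBall x (4 * r)) := by
  have hνfin := h.locFin.1 _ hx (isCompact_closedBall _ _)
  have h1 := h.dens_mul_le hΩ hE hr hx
  have h2 : a * (1 / 2) ≤ dens E x r * (1 - dens E x r) := by
    refine mul_le_mul har (by linarith) (by norm_num) (ha.trans har)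
  have h3 : a * (1 / 2) * (r ^ n * unitVol n) ≤ 2 ^ (n + 1) * r * (ν (closedBall x (4 * r))).toReal :=
    (mul_le_mul_of_nonneg_right h2 (pow_mul_unitVol_pos hr).le).trans h1
  rw [← ENNReal.ofReal_toReal hνfin.ne, ← ENNReal.ofReal_mul (by positivity)]
  refine ENNReal.ofReal_le_ofReal ?_
  have h4 : a * (unitVol n / 8 ^ n) * (4 * r) ^ n = a * (r ^ n * unitVol n) / 2 ^ n := by
    rw [mul_pow, show (8 : ℝ) ^ n = 4 ^ n * 2 ^ n by rw [← mul_pow]; norm_num]; field_simp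
  rw [h4, div_le_iff₀ (by positivity)]
  rw [pow_succ] at h3
  linarith

lemma SigM.measure_eventually_dens_lt {Ω : Set (Eu n)} (hΩ : IsOpen Ω) {σ : Eu n → Eu n}
    {μ ν : Measure (Eu n)} (hσ : SigM Ω σ μ) {E : Set (Eu n)}
    (hE : MeasurableSet E) (h : BVm Ω (ind E) ν) :
    μ {x ∈ Ω | ¬ DensityZeroAt E x ∧ ∀ᶠ r in 𝓝[>] (0 : ℝ), dens E x r < 1 / (8 * 4 ^ n)} = 0 := by
  refine hσ.measure_null_of_frequently hΩ h.locFin (fun x hx => hx.1)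
    (measure_mono_null (fun x hx => hx.2.2) (h.measure_eventually_dens_lt hΩ hE)) ?_
  rintro x ⟨hxΩ, hx, hxd⟩
  obtain ⟨e, he, hfr⟩ := frequently_le_dens hx
  refine ⟨e * (unitVol n / 8 ^ n), by have := unitVol_pos n; positivity, (tendsto_const_mul_nhdsGT four_pos).frequently ?_⟩
  obtain ⟨s, hs, hsΩ⟩ := nhds_basis_closedBall.mem_iff.1 (hΩ.mem_nhds hxΩ)
  have hev : ∀ᶠ r in 𝓝[>] (0 : ℝ), 4 * r ≤ s ∧ 0 < r := by
    filter_upwards [Ioo_mem_nhdsGT (show (0 : ℝ) < s / 4 by positivity)] with r hr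
    exact ⟨by linarith [hr.2], hr.1⟩
  refine (hfr.and_eventually (hxd.and hev)).mono fun r ⟨hr1, hr2, hr3, hr0⟩ => ?_
  refine h.le_measure_closedBall hΩ hE hr0 ((closedBall_subset_closedBall hr3).trans hsΩ) he.le hr1
    (hr2.le.trans ?_)
  have : (1 : ℝ) ≤ 4 ^ n := one_le_pow₀ (by norm_num)
  rw [div_le_div_iff₀ (by positivity) (by norm_num)]; linarith

/-- If the density is small at scale `ε` but not small at smaller scales, then it takes an
intermediate value at some scale `ε / 2 ^ i`. -/
lemma exists_dyadic_dens {E : Set (Eu n)} {x : Eu n} {ε c : ℝ} (hε : 0 < ε)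
    (h0 : dens E x ε < c / 2 ^ n) (hfr : ∃ᶠ r in 𝓝[>] (0 : ℝ), c ≤ dens E x r) :
    ∃ s, 0 < s ∧ 2 * s ≤ ε ∧ c / 2 ^ n ≤ dens E x s ∧ dens E x s < c := by
  have hpos : ∀ i : ℕ, 0 < ε / 2 ^ i := fun i => by positivity
  have hex : ∃ i : ℕ, c / 2 ^ n ≤ dens E x (ε / 2 ^ i) := by
    obtain ⟨r, hrc, hr0, hrε⟩ := (hfr.and_eventually (Ioo_mem_nhdsGT hε)).exists
    obtain ⟨i, hi1, hi2⟩ := exists_nat_pow_near (x := ε / r) (y := 2) ((one_le_div hr0).2 hrε.le)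
      one_lt_two
    refine ⟨i, ?_⟩
    have h1 : r ≤ ε / 2 ^ i := by
      rw [le_div_iff₀ (by positivity)]; rw [le_div_iff₀ hr0] at hi1; linarith
    have h2 := dens_le_dens E (x := x) (z := x) hr0 (r := ε / 2 ^ i) (by simpa using h1)
    have h3 : ε / 2 ^ i / r ≤ 2 := by
      rw [div_lt_iff₀ hr0, pow_succ] at hi2
      rw [div_le_iff₀ hr0, div_le_iff₀ (by positivity)]; linarith
    have h4 : (ε / 2 ^ i / r) ^ n * dens E x (ε / 2 ^ i) ≤ 2 ^ n * dens E x (ε / 2 ^ i) := by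
      have := dens_nonneg E x (hpos i)
      gcongr
    rw [div_le_iff₀ (by positivity)]; linarith
  classical
  have hspec := Nat.find_spec hex
  have hmin := fun m => Nat.find_min hex (m := m)
  set i := Nat.find hex with hidef
  rcases hi : i with _ | j
  · rw [hi] at hspec; simp at hspec; linarith
  have hj := hmin j (by rw [hi]; exact Nat.lt_succ_self j)
  rw [hi] at hspec
  refine ⟨ε / 2 ^ (j + 1), hpos _, ?_, hspec, ?_⟩
  · rw [pow_succ, ← mul_div_assoc, div_le_iff₀ (by positivity)]
    have : (1 : ℝ) ≤ 2 ^ j := one_le_pow₀ (by norm_num)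
    nlinarith
  · have h2 := dens_le_dens E (x := x) (z := x) (hpos (j + 1)) (r := ε / 2 ^ j)
      (by simp only [dist_self, add_zero]; gcongr <;> simp)
    have h3 : ε / 2 ^ j / (ε / 2 ^ (j + 1)) = 2 := by rw [pow_succ]; field_simp
    rw [h3] at h2
    rw [not_le, lt_div_iff₀ (by positivity)] at hj
    linarith

/-- Uniformly in `σ`, the measure `-Div σ` puts little mass on the points of positive upper
density of `E` at which the mollified indicator of `E` is small. -/
lemma BVm.exists_sigM_small {Ω : Set (Eu n)} (hΩ : IsOpen Ω) {E : Set (Eu n)} (hE : MeasurableSet E)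
    {ν : Measure (Eu n)} (h : BVm Ω (ind E) ν) {K : Set (Eu n)} (hK : IsCompact K) (hKΩ : K ⊆ Ω)
    {η : ℝ} (hη : 0 < η) :
    ∃ δ : ℝ, 0 < δ ∧ ∀ᶠ ε in 𝓝[>] (0 : ℝ), ∀ (σ : Eu n → Eu n) (μ : Measure (Eu n)), SigM Ω σ μ →
      μ {x ∈ K | ¬ DensityZeroAt E x ∧ moll (8 * ε) (ind E) x < δ} ≤ ENNReal.ofReal η := by
  obtain ⟨C, hC, H⟩ := exists_sigM_covering n
  obtain ⟨χ, hχ, hχ0, hχ1, U, hU, hKU, hUΩ, hχU⟩ := exists_cutoff hΩ hK hKΩ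
  have hv := unitVol_pos n
  set T := ∫ x, χ x ∂ν with hT
  have hT0 : 0 ≤ T := integral_nonneg hχ0
  set c : ℝ := 1 / (8 * 4 ^ n) with hc
  have hc0 : 0 < c := by positivity
  set D : ℝ := C / (c / 2 ^ n * (unitVol n / 8 ^ n)) with hD
  have hD0 : 0 < D := by positivity
  obtain ⟨m, hm⟩ := exists_nat_gt (max 1 (4 * D * T / η))
  have hm1 : (1 : ℝ) < m := (le_max_left _ _).trans_lt hm
  have hm2 : 4 * D * T / η < m := (le_max_right _ _).trans_lt hm
  have hm0 : (0 : ℝ) < m := by linarith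
  refine ⟨1 / (16 * m * 64 ^ n), by positivity, ?_⟩
  filter_upwards [h.eventually_lintegral_badSet_le hΩ (m := m) (by exact_mod_cast hm1.le) hχ hχ0
      (η := η / (2 * D)) (by positivity), self_mem_nhdsWithin,
    (tendsto_const_mul_nhdsGT (show (0 : ℝ) < 16 by norm_num)).eventually
      (eventually_forall_closedBall_subset hU hK hKU)] with ε hbad hε hsub σ μ hσ
  have hε : 0 < ε := hε
  set Bad := badSet (ind E) ε (1 / (2 * m)) with hBad
  have hνB : ν (Bad ∩ U) ≤ ENNReal.ofReal (2 / m * T + η / (2 * D)) := by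
    refine le_trans ?_ hbad
    rw [inter_comm, ← Measure.restrict_apply hU.measurableSet, ← setLIntegral_one]
    refine (setLIntegral_mono' (g := fun y => ENNReal.ofReal (χ y)) hU.measurableSet
      fun y hy => ?_).trans (setLIntegral_le_lintegral U _)
    rw [hχU y hy]; simp
  have hcov := H Ω σ μ hσ ν {x ∈ K | (∃ᶠ r in 𝓝[>] (0 : ℝ), c ≤ dens E x r) ∧
      moll (8 * ε) (ind E) x < 1 / (16 * m * 64 ^ n)} (Bad ∩ U) (c / 2 ^ n * (unitVol n / 8 ^ n))
      (2 * ε) (by positivity) ?_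
  · calc _ ≤ μ ({x ∈ Ω | ¬ DensityZeroAt E x ∧ ∀ᶠ r in 𝓝[>] (0 : ℝ), dens E x r < c} ∪
          {x ∈ K | (∃ᶠ r in 𝓝[>] (0 : ℝ), c ≤ dens E x r) ∧
            moll (8 * ε) (ind E) x < 1 / (16 * m * 64 ^ n)}) := by
          refine measure_mono ?_
          rintro x ⟨hxK, hx, hxm⟩
          by_cases hfr : ∃ᶠ r in 𝓝[>] (0 : ℝ), c ≤ dens E x r
          · exact Or.inr ⟨hxK, hfr, hxm⟩
          · exact Or.inl ⟨hKΩ hxK, hx, (not_frequently.1 hfr).mono fun r hr => not_le.1 hr⟩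
      _ ≤ 0 + ENNReal.ofReal D * ν (Bad ∩ U) := by
          refine (measure_union_le _ _).trans (add_le_add ?_ hcov)
          exact (hσ.measure_eventually_dens_lt hΩ hE h).le
      _ ≤ ENNReal.ofReal D * ENNReal.ofReal (2 / m * T + η / (2 * D)) := by
          rw [zero_add]; exact mul_le_mul_right hνB _
      _ ≤ ENNReal.ofReal η := by
          rw [← ENNReal.ofReal_mul hD0.le]
          refine ENNReal.ofReal_le_ofReal ?_
          rw [div_lt_iff₀ hη] at hm2
          have : D * (2 / m * T + η / (2 * D)) = 2 * D * T / m + η / 2 := by field_simp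
          rw [this]
          have : 2 * D * T / m ≤ η / 2 := by
            rw [div_le_iff₀ hm0]; linarith
          linarith
  · rintro x ⟨hxK, hfr, hxm⟩
    have h8 : (8 : ℝ) ^ n = 4 ^ n * 2 ^ n := by rw [← mul_pow]; norm_num
    have h64 : (64 : ℝ) ^ n = 4 ^ n * 4 ^ n * 2 ^ n * 2 ^ n := by simp only [← mul_pow]; norm_num
    have p2 : (1 : ℝ) ≤ 2 ^ n := one_le_pow₀ (by norm_num)
    have p4 : (1 : ℝ) ≤ 4 ^ n := one_le_pow₀ (by norm_num)
    have hd4 : dens E x (4 * ε) < 2 ^ n / (16 * m * 64 ^ n) := by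
      have := dens_le_moll_ind hE (ε := 8 * ε) (by positivity) x
      rw [show 8 * ε / 2 = 4 * ε by ring] at this
      refine this.trans_lt ?_
      rw [div_eq_mul_one_div]
      gcongr
    have hd1 : dens E x ε < c / 2 ^ n := by
      have := dens_le_dens E (x := x) (z := x) hε (r := 4 * ε) (by simp; linarith)
      rw [show 4 * ε / ε = 4 by field_simp] at this
      refine this.trans_lt ((mul_lt_mul_of_pos_left hd4 (by positivity)).trans_le ?_)
      rw [hc, div_div, h64, ← mul_div_assoc, div_le_div_iff₀ (by positivity) (by positivity)]
      have : (1 : ℝ) ≤ m * 2 := by linarith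
      calc (4 : ℝ) ^ n * 2 ^ n * (8 * 4 ^ n * 2 ^ n) = 8 * (4 ^ n * 4 ^ n * 2 ^ n * 2 ^ n) * 1 := by ring
        _ ≤ 8 * (4 ^ n * 4 ^ n * 2 ^ n * 2 ^ n) * (m * 2) := by gcongr
        _ = _ := by ring
    obtain ⟨s, hs0, hsε, hs1, hs2⟩ := exists_dyadic_dens hε hd1 hfr
    have hxs := hsub x hxK
    have hsubU : closedBall x (4 * s) ⊆ U := (closedBall_subset_closedBall (by linarith)).trans hxs
    refine ⟨4 * s, by positivity, by linarith, subset_inter (fun y hy => ?_) hsubU, ?_, ?_⟩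
    · refine mem_badSet hE hε (R := 4 * ε) (x := x) (by rw [mem_closedBall] at hy; linarith) ?_
      rw [show 2 * (4 * ε / ε) = 8 by field_simp; norm_num]
      refine (mul_lt_mul_of_pos_left hd4 (by positivity)).trans_le ?_
      rw [h64, h8, ← mul_div_assoc, div_le_div_iff₀ (by positivity) (by positivity)]
      calc (4 : ℝ) ^ n * 2 ^ n * 2 ^ n * (2 * m) = 2 * m * (4 ^ n * 2 ^ n * 2 ^ n) * 1 := by ring
        _ ≤ 2 * m * (4 ^ n * 2 ^ n * 2 ^ n) * (8 * 4 ^ n) := by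
          refine mul_le_mul_of_nonneg_left ?_ (by positivity); linarith
        _ = _ := by ring
    · exact ((closedBall_subset_closedBall (by linarith)).trans hxs).trans hUΩ
    · refine h.le_measure_closedBall hΩ hE hs0 (hsubU.trans hUΩ) (by positivity) hs1 (hs2.le.trans ?_)
      rw [hc, div_le_div_iff₀ (by positivity) (by norm_num)]; linarith

/-- The set of points at which `E` does not have density zero. -/
def posDens (E : Set (Eu n)) : Set (Eu n) := {x | ¬ DensityZeroAt E x}

lemma densityZeroAt_iff_dyadic (E : Set (Eu n)) (x : Eu n) :
    DensityZeroAt E x ↔ Tendsto (fun j : ℕ => dens E x ((1 / 2) ^ j)) atTop (𝓝 0) := by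
  rw [densityZeroAt_iff]
  have hpos : ∀ i : ℕ, (0 : ℝ) < (1 / 2) ^ i := fun i => by positivity
  constructor
  · intro h
    refine h.comp (tendsto_nhdsWithin_iff.2 ⟨?_, Eventually.of_forall fun j => hpos j⟩)
    exact tendsto_pow_atTop_nhds_zero_of_lt_one (by norm_num) (by norm_num)
  · intro h
    refine Metric.tendsto_nhds.2 fun e he => ?_
    obtain ⟨J, hJ⟩ := eventually_atTop.1 (Metric.tendsto_nhds.1 h (e / 2 ^ n) (by positivity))
    filter_upwards [Ioo_mem_nhdsGT (hpos J)] with r hr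
    obtain ⟨hr0, hrJ⟩ := hr
    have hr1 : r ≤ 1 := hrJ.le.trans (pow_le_one₀ (by norm_num) (by norm_num))
    obtain ⟨j, hj1, hj2⟩ := exists_nat_pow_near (x := 1 / r) (y := 2) ((one_le_div hr0).2 hr1)
      one_lt_two
    have hJj : J ≤ j := by
      have h1 : (2 : ℝ) ^ J < 2 ^ (j + 1) := by
        refine lt_trans ?_ hj2
        rw [one_div_pow, lt_div_iff₀ (by positivity)] at hrJ
        rw [lt_div_iff₀ hr0]; linarith
      exact Nat.lt_succ_iff.1 ((pow_lt_pow_iff_right₀ one_lt_two).1 h1)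
    have h1 : r ≤ (1 / 2) ^ j := by
      rw [one_div_pow, le_div_iff₀ (by positivity)]; rw [le_div_iff₀ hr0] at hj1; linarith
    have h2 := dens_le_dens E (x := x) (z := x) hr0 (r := (1 / 2) ^ j) (by simpa using h1)
    have h3 : (1 / 2) ^ j / r ≤ 2 := by
      rw [div_lt_iff₀ hr0, pow_succ] at hj2
      rw [one_div_pow, div_le_iff₀ hr0, div_le_iff₀ (by positivity)]; linarith
    have hd := dens_nonneg E x (hpos j)
    have h4 : ((1 / 2) ^ j / r) ^ n * dens E x ((1 / 2) ^ j) ≤ 2 ^ n * dens E x ((1 / 2) ^ j) := by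
      gcongr
    have h5 := hJ j hJj
    rw [Real.dist_eq, sub_zero, abs_of_nonneg hd, lt_div_iff₀ (by positivity)] at h5
    rw [Real.dist_eq, sub_zero, abs_of_nonneg (dens_nonneg E x hr0)]
    linarith

lemma measurable_dens {E : Set (Eu n)} (hE : MeasurableSet E) (r : ℝ) :
    Measurable fun x => dens E x r := by
  have hs : MeasurableSet {p : Eu n × Eu n | p.2 ∈ E ∧ dist p.2 p.1 < r} :=
    (measurable_snd hE).inter
      (measurableSet_lt (measurable_snd.dist measurable_fst) measurable_const)
  exact (measurable_measure_prodMk_left (ν := volume) hs).ennreal_toReal.div_const _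

lemma measurableSet_posDens {E : Set (Eu n)} (hE : MeasurableSet E) : MeasurableSet (posDens E) := by
  have : posDens E = {x | Tendsto (fun j : ℕ => dens E x ((1 / 2) ^ j)) atTop (𝓝 0)}ᶜ := by
    ext x; simp only [posDens, densityZeroAt_iff_dyadic]; rfl
  rw [this]
  exact (measurableSet_tendsto (𝓝 0) fun j => measurable_dens hE _).compl

lemma SigM.integral_le {Ω : Set (Eu n)} {σ : Eu n → Eu n} {μ : Measure (Eu n)} (h : SigM Ω σ μ)
    {φ : Eu n → ℝ} (hφ : IsTest Ω φ) : ∫ x, φ x ∂μ ≤ ∫ x, ‖gradient φ x‖ := by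
  rw [h.integral_eq hφ]
  exact (h.setIntegral_inner_le hφ.integrable_gradient).trans
    (setIntegral_le_integral hφ.integrable_gradient.norm (Eventually.of_forall fun _ => norm_nonneg _))

lemma isTest_mul_cpol {Ω E : Set (Eu n)} (hE : MeasurableSet E) {φ : Eu n → ℝ} (hφ : IsTest Ω φ)
    (m : ℕ) (ε : ℝ) : IsTest Ω fun x => φ x * cpol m (moll ε (ind E) x) :=
  hφ.mul_smooth ((contDiff_cpol m).comp (contDiff_moll ε (locallyIntegrable_ind hE)))

/-- Uniformly in `σ`, the measure `-Div σ` restricted to the points of positive upper density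
is controlled by mollified indicators. -/
lemma BVm.exists_setIntegral_posDens_le {Ω : Set (Eu n)} (hΩ : IsOpen Ω) {E : Set (Eu n)}
    (hE : MeasurableSet E) {ν : Measure (Eu n)} (h : BVm Ω (ind E) ν) {φ : Eu n → ℝ}
    (hφ : IsTest Ω φ) (hφ0 : ∀ x, 0 ≤ φ x) {η : ℝ} (hη : 0 < η) :
    ∃ m : ℕ, 1 ≤ m ∧ ∀ᶠ ε in 𝓝[>] (0 : ℝ), ∀ (σ : Eu n → Eu n) (μ : Measure (Eu n)), SigM Ω σ μ →
      ∫ x in posDens E, φ x ∂μ ≤ (∫ x, φ x * cpol m (moll ε (ind E) x) ∂μ) + η := by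
  obtain ⟨M, hM0, hM⟩ := hφ.exists_bound
  set G := ∫ x, ‖gradient φ x‖ with hG
  have hG0 : 0 ≤ G := integral_nonneg fun _ => norm_nonneg _
  obtain ⟨δ', hδ', hU⟩ := h.exists_sigM_small hΩ hE hφ.2.1.isCompact hφ.2.2
    (η := η / (2 * (M + 1))) (by positivity)
  set δ := min δ' (1 / 2) with hδdef
  have hδ : 0 < δ := by positivity
  have hδ1 : δ ≤ 1 / 2 := min_le_right _ _
  obtain ⟨m, hm⟩ := exists_pow_lt_of_lt_one (show 0 < η / (2 * (G + 1)) by positivity)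
    (show 1 - δ < 1 by linarith)
  set m' := m + 1 with hm'
  have hpow : (1 - δ) ^ m' ≤ η / (2 * (G + 1)) :=
    (pow_le_pow_of_le_one (by linarith) (by linarith) (Nat.le_succ m)).trans hm.le
  refine ⟨m', by lia, ?_⟩
  have hU' := (tendsto_const_mul_nhdsGT (show (0 : ℝ) < 1 / 8 by norm_num)).eventually hU
  filter_upwards [hU'] with ε hε σ μ hσ
  have hsmall := hε σ μ hσ
  rw [show 8 * (1 / 8 * ε) = ε by ring] at hsmall
  set v : Eu n → ℝ := fun x => cpol m' (moll ε (ind E) x) with hv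
  set A : Set (Eu n) := {x ∈ tsupport φ | ¬ DensityZeroAt E x ∧ moll ε (ind E) x < δ'} with hA
  have hAm : MeasurableSet A := by
    have h1 : A = tsupport φ ∩ (posDens E ∩ {x | moll ε (ind E) x < δ'}) := rfl
    rw [h1]
    exact (isClosed_tsupport φ).measurableSet.inter ((measurableSet_posDens hE).inter
      (measurableSet_lt (contDiff_moll ε (locallyIntegrable_ind hE)).continuous.measurable
        measurable_const))
  have hAfin : μ A < ⊤ := hsmall.trans_lt ENNReal.ofReal_lt_top
  have hiφ : Integrable φ μ := hσ.locFin.integrable_test hφ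
  have hiv : Integrable (fun x => φ x * v x) μ :=
    hσ.locFin.integrable_test (isTest_mul_cpol hE hφ m' ε)
  have hiA : Integrable (A.indicator fun _ => M) μ :=
    (integrable_indicator_iff hAm).2 (integrableOn_const hAfin.ne)
  have hv01 : ∀ x, v x ∈ Icc (0 : ℝ) 1 := fun x => cpol_mem m' (moll_ind_mem hE ε x)
  have hpt : ∀ x, (posDens E).indicator φ x ≤
      φ x * v x + η / (2 * (G + 1)) * φ x + A.indicator (fun _ => M) x := by
    intro x
    have e1 : 0 ≤ φ x * v x := mul_nonneg (hφ0 x) (hv01 x).1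
    have e2 : 0 ≤ η / (2 * (G + 1)) * φ x := mul_nonneg (by positivity) (hφ0 x)
    have e3 : 0 ≤ A.indicator (fun _ => M) x := indicator_nonneg (fun _ _ => hM0) x
    by_cases hx : x ∈ posDens E
    · rw [indicator_of_mem hx]
      by_cases hxt : x ∈ tsupport φ
      · by_cases hxm : moll ε (ind E) x < δ'
        · have : x ∈ A := ⟨hxt, hx, hxm⟩
          rw [indicator_of_mem this]
          have := (le_abs_self _).trans (hM x)
          linarith
        · have hm2 : δ ≤ moll ε (ind E) x := (min_le_left _ _).trans (not_lt.1 hxm)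
          have h1 : 1 - η / (2 * (G + 1)) ≤ v x := by
            have : (1 - moll ε (ind E) x) ^ m' ≤ (1 - δ) ^ m' :=
              pow_le_pow_left₀ (by linarith [(moll_ind_mem hE ε x).2]) (by linarith) _
            simp only [hv, cpol]; linarith
          nlinarith [mul_le_mul_of_nonneg_left h1 (hφ0 x)]
      · rw [image_eq_zero_of_notMem_tsupport hxt] at *
        linarith
    · rw [indicator_of_notMem hx]; linarith
  rw [← integral_indicator (measurableSet_posDens hE)]
  calc _ ≤ ∫ x, (φ x * v x + η / (2 * (G + 1)) * φ x + A.indicator (fun _ => M) x) ∂μ :=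
        integral_mono (hiφ.indicator (measurableSet_posDens hE))
          ((hiv.fun_add (hiφ.const_mul _)).fun_add hiA) hpt
    _ = (∫ x, φ x * v x ∂μ) + η / (2 * (G + 1)) * (∫ x, φ x ∂μ) + M * (μ A).toReal := by
        rw [integral_add (hiv.fun_add (hiφ.const_mul _)) hiA, integral_add hiv (hiφ.const_mul _),
          integral_const_mul, integral_indicator hAm, setIntegral_const]
        simp [Measure.real, mul_comm]
    _ ≤ _ := by
        have h1 : (μ A).toReal ≤ η / (2 * (M + 1)) := ENNReal.toReal_le_of_le_ofReal (by positivity) hsmall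
        have h2 : M * (μ A).toReal ≤ η / 2 := by
          calc M * (μ A).toReal ≤ (M + 1) * (η / (2 * (M + 1))) := by gcongr; linarith
            _ = η / 2 := by field_simp
        have h3 : η / (2 * (G + 1)) * (∫ x, φ x ∂μ) ≤ η / 2 := by
          calc _ ≤ η / (2 * (G + 1)) * (G + 1) := by
                gcongr; linarith [hσ.integral_le hφ]
            _ = η / 2 := by field_simp
        linarith

/-- Leibniz-type inequality for the pairing of `σ` with a set of finite perimeter. -/
lemma BVm.setIntegral_posDens_le {Ω : Set (Eu n)} (hΩ : IsOpen Ω) {E : Set (Eu n)}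
    (hE : MeasurableSet E) {ν : Measure (Eu n)} (h : BVm Ω (ind E) ν) {φ : Eu n → ℝ}
    (hφ : IsTest Ω φ) (hφ0 : ∀ x, 0 ≤ φ x) {σ : Eu n → Eu n} {μ : Measure (Eu n)} (hσ : SigM Ω σ μ) :
    ∫ x in posDens E, φ x ∂μ ≤ (∫ x in Ω, ind E x * ⟪σ x, gradient φ x⟫) + ∫ x, φ x ∂ν := by
  refine le_of_forall_pos_le_add fun η hη => ?_
  obtain ⟨m, hm, hev⟩ := h.exists_setIntegral_posDens_le hΩ hE hφ hφ0 (η := η / 3) (by positivity)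
  obtain ⟨D, hD0, hD⟩ := hφ.exists_bound_gradient
  have hconv : Tendsto (fun ε => D * ∫ x in tsupport φ, |cpol m (moll ε (ind E) x) - cpol m (ind E x)|)
      (𝓝[>] 0) (𝓝 (D * 0)) := (tendsto_integral_comp_moll (measurable_ind hE) (abs_ind_le E)
        (contDiff_cpol m).continuous hφ.2.1.isCompact).const_mul D
  rw [mul_zero] at hconv
  obtain ⟨ε, h1, h2, h3⟩ := (hev.and ((h.eventually_integral_cpol_le hΩ hm hφ hφ0
    (η := η / 3) (by positivity)).and (hconv.eventually (gt_mem_nhds (show 0 < η / 3 by positivity))))).exists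
  have h1 := h1 σ μ hσ
  set v : Eu n → ℝ := fun x => cpol m (moll ε (ind E) x) with hv
  have hvs : ContDiff ℝ (⊤ : ℕ∞) v :=
    (contDiff_cpol m).comp (contDiff_moll ε (locallyIntegrable_ind hE))
  have hT : IsTest Ω fun x => φ x * v x := isTest_mul_cpol hE hφ m ε
  have hv1 : ∀ x, |v x| ≤ 1 := fun x => by
    have := cpol_mem m (moll_ind_mem hE ε x)
    exact abs_le.2 ⟨by linarith [this.1], this.2⟩
  have hσi := hσ.integrableOn_inner hφ.integrable_gradient
  have hi1 : IntegrableOn (fun x => v x * ⟪σ x, gradient φ x⟫) Ω :=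
    hσi.bdd_mul hvs.continuous.aestronglyMeasurable (Eventually.of_forall hv1)
  have hi0 : IntegrableOn (fun x => ind E x * ⟪σ x, gradient φ x⟫) Ω :=
    hσi.bdd_mul (measurable_ind hE).aestronglyMeasurable (Eventually.of_forall (abs_ind_le E))
  have hφg : Integrable fun x => φ x • gradient v x :=
    (hφ.continuous.smul (continuous_gradient hvs)).integrable_of_hasCompactSupport hφ.2.1.smul_right
  have hi2 : IntegrableOn (fun x => ⟪σ x, φ x • gradient v x⟫) Ω := hσ.integrableOn_inner hφg
  have e1 : ∫ x, φ x * v x ∂μ = (∫ x in Ω, ⟪σ x, φ x • gradient v x⟫) +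
      ∫ x in Ω, v x * ⟪σ x, gradient φ x⟫ := by
    rw [hσ.integral_eq hT, ← integral_add hi2 hi1]
    congr 1; ext x
    rw [gradient_mul hφ.1 hvs, inner_add_right, inner_smul_right _ _ (v x)]
  have e2 : ∫ x in Ω, ⟪σ x, φ x • gradient v x⟫ ≤ ∫ x, φ x * ‖gradient v x‖ := by
    refine (hσ.setIntegral_inner_le hφg).trans ((setIntegral_le_integral hφg.norm
      (Eventually.of_forall fun _ => norm_nonneg _)).trans_eq ?_)
    congr 1; ext x; rw [norm_smul, Real.norm_of_nonneg (hφ0 x)]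
  have e3 : (∫ x in Ω, v x * ⟪σ x, gradient φ x⟫) - ∫ x in Ω, ind E x * ⟪σ x, gradient φ x⟫ ≤
      D * ∫ x in tsupport φ, |v x - cpol m (ind E x)| := by
    rw [← integral_sub hi1 hi0, ← integral_const_mul]
    have hvi : IntegrableOn (fun x => D * |v x - cpol m (ind E x)|) (tsupport φ) := by
      refine Measure.integrableOn_of_bounded (M := D * 2) hφ.2.1.isCompact.measure_lt_top.ne ?_ ?_
      · exact (measurable_const.mul (hvs.continuous.measurable.sub
          ((contDiff_cpol m).continuous.measurable.comp
            (measurable_ind hE))).abs).aestronglyMeasurable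
      · refine Eventually.of_forall fun x => ?_
        rw [Real.norm_eq_abs, abs_mul, abs_abs, abs_of_nonneg hD0]
        gcongr
        rw [cpol_ind hm]
        have := abs_sub (v x) (ind E x)
        linarith [hv1 x, abs_ind_le E x]
    rw [← integral_indicator (isClosed_tsupport φ).measurableSet]
    have hvi' := (integrable_indicator_iff (isClosed_tsupport φ).measurableSet).2 hvi
    refine (integral_mono_ae (hi1.fun_sub hi0) hvi'.integrableOn ?_).trans
      (setIntegral_le_integral hvi' ?_)
    · filter_upwards [hσ.bdd.2] with x hx
      by_cases hxt : x ∈ tsupport φ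
      · rw [indicator_of_mem hxt, cpol_ind hm, ← sub_mul]
        have h4 : |⟪σ x, gradient φ x⟫| ≤ D := by
          refine (abs_real_inner_le_norm _ _).trans ?_
          calc ‖σ x‖ * ‖gradient φ x‖ ≤ 1 * D := by gcongr; exact hD x
            _ = D := one_mul D
        refine (le_abs_self _).trans ?_
        rw [abs_mul, mul_comm]; gcongr
      · rw [indicator_of_notMem hxt, gradient_eq_zero_of_notMem hxt]; simp
    · exact Eventually.of_forall fun x => indicator_nonneg (fun _ _ => by positivity) x
  linarith

/-- Upper semicontinuity of the mass of points of positive density. -/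
lemma BVm.eventually_setIntegral_posDens_le {Ω : Set (Eu n)} (hΩ : IsOpen Ω) {E : Set (Eu n)}
    (hE : MeasurableSet E) {ν : Measure (Eu n)} (h : BVm Ω (ind E) ν) {φ : Eu n → ℝ}
    (hφ : IsTest Ω φ) (hφ0 : ∀ x, 0 ≤ φ x) {ι : Type*} {l : Filter ι} {σk : ι → Eu n → Eu n}
    {μk : ι → Measure (Eu n)} (hσk : ∀ k, SigM Ω (σk k) (μk k)) {μ : Measure (Eu n)}
    (hμ : LocFinOn Ω μ)
    (hconv : ∀ ψ, IsTest Ω ψ → Tendsto (fun k => ∫ x, ψ x ∂(μk k)) l (𝓝 (∫ x, ψ x ∂μ)))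
    {η : ℝ} (hη : 0 < η) :
    ∀ᶠ k in l, ∫ x in posDens E, φ x ∂(μk k) ≤ (∫ x in posDens E, φ x ∂μ) + η := by
  obtain ⟨m, hm, hev⟩ := h.exists_setIntegral_posDens_le hΩ hE hφ hφ0 (η := η / 3) (by positivity)
  have hm1 := measurableSet_posDens hE
  have hiφ := hμ.integrable_test hφ
  have hdom : Tendsto (fun ε => ∫ x in (posDens E)ᶜ, φ x * cpol m (moll ε (ind E) x) ∂μ) (𝓝[>] 0)
      (𝓝 (∫ x in (posDens E)ᶜ, (0 : ℝ) ∂μ)) := by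
    refine tendsto_integral_filter_of_dominated_convergence φ ?_ ?_ hiφ.integrableOn ?_
    · exact Eventually.of_forall fun ε =>
        (isTest_mul_cpol hE hφ m ε).continuous.aestronglyMeasurable
    · refine Eventually.of_forall fun ε => Eventually.of_forall fun x => ?_
      have := cpol_mem m (moll_ind_mem hE ε x)
      rw [norm_mul, Real.norm_of_nonneg (hφ0 x), Real.norm_of_nonneg this.1]
      exact mul_le_of_le_one_right (hφ0 x) this.2
    · filter_upwards [ae_restrict_mem hm1.compl] with x hx
      have hx : DensityZeroAt E x := not_not.1 hx
      have h0 := ((densityZeroAt_iff E x).1 hx).const_mul (2 ^ n)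
      rw [mul_zero] at h0
      have h1 : Tendsto (fun ε => moll ε (ind E) x) (𝓝[>] 0) (𝓝 0) := by
        refine tendsto_of_tendsto_of_tendsto_of_le_of_le' tendsto_const_nhds h0
          (Eventually.of_forall fun ε => (moll_ind_mem hE ε x).1) ?_
        filter_upwards [self_mem_nhdsWithin] with ε hε using moll_ind_le hE hε x
      have h2 := (((contDiff_cpol m).continuous.tendsto 0).comp h1).const_mul (φ x)
      simpa [cpol] using h2
  rw [integral_zero] at hdom
  obtain ⟨ε, h1, h2⟩ := (hev.and (hdom.eventually (gt_mem_nhds (show 0 < η / 3 by positivity)))).exists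
  have hT := isTest_mul_cpol hE hφ m ε
  have hi := hμ.integrable_test hT
  have h3 : ∫ x, φ x * cpol m (moll ε (ind E) x) ∂μ ≤ (∫ x in posDens E, φ x ∂μ) + η / 3 := by
    rw [← integral_add_compl hm1 hi]
    refine add_le_add (setIntegral_mono hi.integrableOn hiφ.integrableOn fun x => ?_) h2.le
    exact mul_le_of_le_one_right (hφ0 x) (cpol_mem m (moll_ind_mem hE ε x)).2
  filter_upwards [(hconv _ hT).eventually (gt_mem_nhds (lt_add_of_pos_right _ (show 0 < η / 3 by positivity)))] with k hk
  have := h1 _ _ (hσk k)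
  linarith

/-- A smooth approximation of `min s t`. -/
def softmin (t h s : ℝ) : ℝ := (s + t - √((s - t) ^ 2 + h ^ 2)) / 2

lemma sqrt_sq_add_pos {h : ℝ} (hh : 0 < h) (a : ℝ) : 0 < √(a ^ 2 + h ^ 2) :=
  Real.sqrt_pos.2 (by positivity)

lemma abs_le_sqrt_sq_add (h a : ℝ) : |a| ≤ √(a ^ 2 + h ^ 2) :=
  Real.abs_le_sqrt (by nlinarith [sq_nonneg h])

lemma contDiff_softmin (t : ℝ) {h : ℝ} (hh : 0 < h) : ContDiff ℝ (⊤ : ℕ∞) (softmin t h) := by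
  refine ContDiff.div_const (ContDiff.sub (by fun_prop) (ContDiff.sqrt (by fun_prop) fun s => ?_)) 2
  positivity

lemma deriv_softmin_mem (t : ℝ) {h : ℝ} (hh : 0 < h) (s : ℝ) :
    deriv (softmin t h) s ∈ Icc (0 : ℝ) 1 := by
  have h1 : HasDerivAt (fun s : ℝ => (s - t) ^ 2 + h ^ 2) (2 * (s - t)) s := by
    have := ((((hasDerivAt_id s).sub_const t).pow 2).add_const (h ^ 2))
    simpa using this
  have h2 := h1.sqrt (by positivity)
  have h3 : HasDerivAt (softmin t h) ((1 - 2 * (s - t) / (2 * √((s - t) ^ 2 + h ^ 2))) / 2) s :=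
    (((hasDerivAt_id s).add_const t).sub h2).div_const 2
  rw [h3.deriv]
  have h4 : |2 * (s - t) / (2 * √((s - t) ^ 2 + h ^ 2))| ≤ 1 := by
    have hp := sqrt_sq_add_pos hh (s - t)
    rw [abs_div, abs_mul, abs_of_pos (by positivity : 0 < 2 * √((s - t) ^ 2 + h ^ 2)),
      div_le_one (by positivity), abs_two]
    linarith [abs_le_sqrt_sq_add h (s - t)]
  have := abs_le.1 h4
  constructor <;> linarith [this.1, this.2]

lemma abs_softmin_sub_le (t : ℝ) {h : ℝ} (hh : 0 < h) (s : ℝ) : |softmin t h s - min s t| ≤ h := by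
  have h1 : √((s - t) ^ 2 + h ^ 2) ≤ |s - t| + h := by
    refine Real.sqrt_le_iff.2 ⟨by positivity, ?_⟩
    nlinarith [sq_abs (s - t), abs_nonneg (s - t)]
  have h2 := abs_le_sqrt_sq_add h (s - t)
  have h3 : min s t = (s + t - |s - t|) / 2 := by
    rcases le_total s t with hst | hst
    · rw [min_eq_left hst, abs_of_nonpos (by linarith)]; ring
    · rw [min_eq_right hst, abs_of_nonneg (by linarith)]; ring
  rw [h3, softmin, abs_le]
  constructor <;> linarith

lemma ENNReal.add_le_of_forall_lt {a b C : ℝ≥0∞}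
    (H : ∀ c d, (c < a ∨ c = 0) → (d < b ∨ d = 0) → c + d ≤ C) : a + b ≤ C := by
  rcases eq_or_ne a 0 with rfl | ha
  · rw [zero_add]
    exact le_of_forall_lt_imp_le_of_dense fun d hd => by
      simpa using H 0 d (Or.inr rfl) (Or.inl hd)
  rcases eq_or_ne b 0 with rfl | hb
  · rw [add_zero]
    exact le_of_forall_lt_imp_le_of_dense fun d hd => by
      simpa using H d 0 (Or.inl hd) (Or.inr rfl)
  refine le_of_forall_lt_imp_le_of_dense fun x hx => ?_
  obtain ⟨c, hc, d, hd, hcd⟩ := ENNReal.exists_lt_add_of_lt_add hx ha hb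
  exact hcd.le.trans (H c d (Or.inl hc) (Or.inl hd))

lemma ENNReal.le_ofReal_of_forall_add {X : ℝ≥0∞} {a : ℝ}
    (h : ∀ η : ℝ, 0 < η → X ≤ ENNReal.ofReal (a + η)) : X ≤ ENNReal.ofReal a := by
  have h1 : Tendsto (fun η : ℝ => ENNReal.ofReal (a + η)) (𝓝[>] 0) (𝓝 (ENNReal.ofReal a)) := by
    refine ((ENNReal.continuous_ofReal.comp (continuous_const.add continuous_id)).tendsto'
      0 _ ?_).mono_left nhdsWithin_le_nhds
    simp
  exact ge_of_tendsto h1 (eventually_mem_nhdsWithin.mono fun η hη => h η hη)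

lemma tendsto_setIntegral_abs_sub_of_le {K : Set (Eu n)} (hK : IsCompact K) {w : Eu n → ℝ}
    {v : ℝ → Eu n → ℝ} (hv : ∀ᶠ h in 𝓝[>] (0 : ℝ), ∀ x, |v h x - w x| ≤ h) :
    Tendsto (fun h => ∫ x in K, |v h x - w x|) (𝓝[>] 0) (𝓝 0) := by
  have h1 : Tendsto (fun h : ℝ => h * volume.real K) (𝓝[>] 0) (𝓝 0) :=
    ((continuous_id.mul continuous_const).tendsto' 0 _ (by simp)).mono_left nhdsWithin_le_nhds
  refine squeeze_zero' (Eventually.of_forall fun h => by positivity) ?_ h1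
  filter_upwards [hv] with h hh
  refine (le_abs_self _).trans ?_
  exact norm_setIntegral_le_of_norm_le_const (f := fun x => |v h x - w x|) hK.measure_lt_top
    fun x _ => by simpa using hh x

namespace BVm
variable {Ω : Set (Eu n)} {w : Eu n → ℝ} {ν : Measure (Eu n)}

lemma TV_min_add_le (hΩ : IsOpen Ω) (h : BVm Ω w ν) (t : ℝ) {φ : Eu n → ℝ} (hφ : IsTest Ω φ)
    (hφ0 : ∀ x, 0 ≤ φ x) :
    TV (fun x => min (w x) t) φ + TV (fun x => w x - min (w x) t) φ ≤ TV w φ := by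
  refine ENNReal.add_le_of_forall_lt fun c d hc hd => ?_
  have hK := hφ.2.1.isCompact
  have hm : Continuous fun s : ℝ => min s t := continuous_id.min continuous_const
  have e1 : ∀ᶠ k in 𝓝[>] (0 : ℝ), c < TV (fun x => softmin t k (w x)) φ ∨ c = 0 := by
    rcases hc with hc | hc
    · refine (TV_lsc hφ.2.1 (h.integrableOn_comp hm hK) ?_
        (tendsto_setIntegral_abs_sub_of_le hK ?_) hc).mono fun _ => Or.inl
      · exact eventually_mem_nhdsWithin.mono fun k hk =>
          h.integrableOn_comp (contDiff_softmin t hk).continuous hK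
      · exact eventually_mem_nhdsWithin.mono fun k hk x => abs_softmin_sub_le t hk _
    · exact Eventually.of_forall fun _ => Or.inr hc
  have e2 : ∀ᶠ k in 𝓝[>] (0 : ℝ), d < TV (fun x => w x - softmin t k (w x)) φ ∨ d = 0 := by
    rcases hd with hd | hd
    · refine (TV_lsc hφ.2.1 (h.integrableOn_comp (continuous_id.sub hm) hK) ?_
        (tendsto_setIntegral_abs_sub_of_le hK ?_) hd).mono fun _ => Or.inl
      · exact eventually_mem_nhdsWithin.mono fun k hk =>
          h.integrableOn_comp (continuous_id.sub (contDiff_softmin t hk).continuous) hK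
      · refine eventually_mem_nhdsWithin.mono fun k hk x => ?_
        have := abs_softmin_sub_le t hk (w x)
        rw [abs_sub_comm] at this
        simpa using this
    · exact Eventually.of_forall fun _ => Or.inr hd
  obtain ⟨k, ⟨hk1, hk2⟩, hk⟩ := ((e1.and e2).and eventually_mem_nhdsWithin).exists
  rw [h.tv φ hφ hφ0]
  refine ENNReal.le_ofReal_of_forall_add fun η hη => ?_
  obtain ⟨M, hM⟩ := h.bdd
  have hcd := contDiff_softmin t hk
  have e3 : ∀ᶠ ε in 𝓝[>] (0 : ℝ), c ≤ TV (fun x => softmin t k (moll ε w x)) φ := by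
    rcases hk1 with hk1 | rfl
    · exact (h.lt_of_lt_TV_comp hcd.continuous hφ.2.1 hk1).mono fun _ => le_of_lt
    · exact Eventually.of_forall fun _ => zero_le
  obtain ⟨ε, hε1, hε2⟩ := (e3.and (h.eventually_split hΩ (fun x => abs_le.1 (hM x)) hcd
    (fun s _ => deriv_softmin_mem t hk s) hφ hφ0 hk2 hη)).exists
  refine le_trans ?_ hε2
  gcongr
  exact hε1.trans (TV_le_of_smooth (hcd.comp (contDiff_moll ε h.locallyIntegrable)) hφ.continuous
    hφ.2.1)

lemma exists_min (hΩ : IsOpen Ω) (h : BVm Ω w ν) (t : ℝ) :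
    ∃ ν', BVm Ω (fun x => min (w x) t) ν' := by
  have hm : Continuous fun s : ℝ => min s t := continuous_id.min continuous_const
  have hf : FinTV Ω (fun x => min (w x) t) :=
    ⟨fun K _ hK => h.integrableOn_comp hm hK, fun φ hφ hφ0 =>
      ne_top_of_le_ne_top (h.finTV.finite φ hφ hφ0)
        (le_self_add.trans (h.TV_min_add_le hΩ t hφ hφ0))⟩
  obtain ⟨ν', hν', htv⟩ := hf.exists_measure hΩ
  obtain ⟨M, hM⟩ := h.bdd
  refine ⟨ν', hm.measurable.comp h.meas, ⟨M + |t|, fun x => ?_⟩, hν', htv⟩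
  have := hM x
  exact (abs_min_le_max_abs_abs).trans
    (max_le (by linarith [abs_nonneg t]) (by linarith [abs_nonneg (w x)]))

/-- The variation of the truncation `min w t`, as a function of the level `t`. -/
def _root_.levelVar (w φ : Eu n → ℝ) (t : ℝ) : ℝ := (TV (fun x => min (w x) t) φ).toReal

lemma TV_slice_le (hΩ : IsOpen Ω) (h : BVm Ω w ν) {t s : ℝ} (hts : t ≤ s) {φ : Eu n → ℝ}
    (hφ : IsTest Ω φ) (hφ0 : ∀ x, 0 ≤ φ x) :
    levelVar w φ t ≤ levelVar w φ s ∧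
    TV (fun x => min (w x) s - min (w x) t) φ ≤
      ENNReal.ofReal (levelVar w φ s - levelVar w φ t) := by
  obtain ⟨ν', h'⟩ := h.exists_min hΩ s
  have h1 := h'.TV_min_add_le hΩ t hφ hφ0
  have h2 : ∀ x, min (min (w x) s) t = min (w x) t := fun x => by rw [min_assoc, min_eq_right hts]
  simp only [h2] at h1
  have hf := h'.finTV.finite φ hφ hφ0
  have h3 := ne_top_of_le_ne_top hf (le_self_add.trans h1)
  have h4 := ne_top_of_le_ne_top hf (le_add_self.trans h1)
  have h5 := ENNReal.toReal_mono hf h1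
  rw [ENNReal.toReal_add h3 h4] at h5
  constructor
  · exact le_trans (le_add_of_nonneg_right ENNReal.toReal_nonneg) h5
  · rw [ENNReal.le_ofReal_iff_toReal_le h4]
    · unfold levelVar; linarith
    · unfold levelVar; linarith [ENNReal.toReal_nonneg (a := TV (fun x => min (w x) s - min (w x) t) φ)]

lemma monotone_levelVar (hΩ : IsOpen Ω) (h : BVm Ω w ν) {φ : Eu n → ℝ}
    (hφ : IsTest Ω φ) (hφ0 : ∀ x, 0 ≤ φ x) : Monotone (levelVar w φ) :=
  fun _ _ hts => (h.TV_slice_le hΩ hts hφ hφ0).1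

lemma levelVar_le (hΩ : IsOpen Ω) (h : BVm Ω w ν) {φ : Eu n → ℝ}
    (hφ : IsTest Ω φ) (hφ0 : ∀ x, 0 ≤ φ x) (t : ℝ) : levelVar w φ t ≤ ∫ x, φ x ∂ν := by
  have h1 := le_self_add.trans (h.TV_min_add_le hΩ t hφ hφ0)
  rw [h.tv φ hφ hφ0] at h1
  exact ENNReal.toReal_le_of_le_ofReal (integral_nonneg hφ0) h1

end BVm

lemma tendsto_slice_ind (w t : ℝ) :
    Tendsto (fun s : ℝ => s⁻¹ * (min w (t + s) - min w t)) (𝓝[>] 0)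
      (𝓝 (if t < w then 1 else 0)) := by
  refine tendsto_const_nhds.congr' ?_
  split_ifs with h
  · filter_upwards [Ioo_mem_nhdsGT (sub_pos.2 h)] with s hs
    rw [min_eq_right (by linarith [hs.2]), min_eq_right h.le, add_sub_cancel_left,
      inv_mul_cancel₀ hs.1.ne']
  · filter_upwards [self_mem_nhdsWithin] with s hs
    have : (0 : ℝ) < s := hs
    push Not at h
    rw [min_eq_left (by linarith), min_eq_left h]; simp

lemma slice_mem_Icc (w t : ℝ) {s : ℝ} (hs : 0 < s) :
    s⁻¹ * (min w (t + s) - min w t) ∈ Icc (0 : ℝ) 1 := by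
  have h1 : min w t ≤ min w (t + s) := min_le_min_left _ (by linarith)
  have h2 : min w (t + s) ≤ min w t + s := by
    rw [← min_add_add_right]; exact min_le_min_right _ (by linarith)
  constructor
  · exact mul_nonneg (inv_nonneg.2 hs.le) (by linarith)
  · rw [inv_mul_le_iff₀ hs]; linarith

lemma tendsto_setIntegral_slice_sub_ind {w : Eu n → ℝ} (hw : Measurable w) (t : ℝ) {K : Set (Eu n)}
    (hK : IsCompact K) :
    Tendsto (fun s : ℝ => ∫ x in K, |s⁻¹ * (min (w x) (t + s) - min (w x) t) - ind {y | t < w y} x|)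
      (𝓝[>] 0) (𝓝 0) := by
  have key := tendsto_integral_filter_of_dominated_convergence (μ := volume.restrict K)
    (l := 𝓝[>] (0 : ℝ)) (F := fun (s : ℝ) x =>
      |s⁻¹ * (min (w x) (t + s) - min (w x) t) - ind {y | t < w y} x|) (f := fun _ => (0 : ℝ))
    (fun _ => (1 : ℝ)) ?_ ?_ ?_ ?_
  · simpa using key
  · refine Eventually.of_forall fun s => Measurable.aestronglyMeasurable ?_
    have := measurable_ind (measurableSet_lt measurable_const hw : MeasurableSet {y | t < w y})
    have h1 : Measurable fun x => s⁻¹ * (min (w x) (t + s) - min (w x) t) := by fun_prop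
    exact (h1.sub this).abs
  · filter_upwards [self_mem_nhdsWithin] with s hs
    refine Eventually.of_forall fun x => ?_
    have h1 := slice_mem_Icc (w x) t hs
    have h2 := ind_mem {y | t < w y} x
    rw [Real.norm_eq_abs, abs_abs, abs_le]
    constructor <;> linarith [h1.1, h1.2, h2.1, h2.2]
  · exact integrableOn_const (hs := hK.measure_lt_top.ne)
  · refine Eventually.of_forall fun x => ?_
    have h1 := tendsto_slice_ind (w x) t
    have h2 : (if t < w x then (1 : ℝ) else 0) = ind {y | t < w y} x := by
      simp [ind, indicator]
    rw [h2] at h1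
    have h3 := (h1.sub_const (ind {y | t < w y} x)).abs
    simpa using h3

lemma isTest_sum {Ω : Set (Eu n)} {χ : ℕ → Eu n → ℝ} (h : ∀ i, IsTest Ω (χ i)) (m : ℕ) :
    IsTest Ω fun x => ∑ i ∈ Finset.range m, χ i x := by
  induction m with
  | zero =>
    simp only [Finset.range_zero, Finset.sum_empty]
    exact ⟨contDiff_const, HasCompactSupport.zero, by simp [tsupport]⟩
  | succ m ih => simp only [Finset.sum_range_succ]; exact ih.add (h m)

/-- A countable family of nonnegative test functions dominating all others up to constants. -/
lemma exists_dominating_tests {Ω : Set (Eu n)} (hΩ : IsOpen Ω) :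
    ∃ Ψ : ℕ → Eu n → ℝ, (∀ m, IsTest Ω (Ψ m)) ∧ (∀ m x, 0 ≤ Ψ m x) ∧
      ∀ φ, IsTest Ω φ → ∃ m, ∃ C : ℝ, 0 ≤ C ∧ ∀ x, φ x ≤ C * Ψ m x := by
  obtain ⟨K, hK, hKΩ, -, hKU⟩ := exists_compact_exhaustion hΩ
  choose χ hχ h0 h1 U hU hKU' hUΩ hχU using fun m => exists_cutoff hΩ (hK m) (hKΩ m)
  refine ⟨fun m x => ∑ i ∈ Finset.range m, χ i x, isTest_sum hχ,
    fun m x => Finset.sum_nonneg fun i _ => h0 i x, fun φ hφ => ?_⟩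
  obtain ⟨F, hF⟩ := hφ.2.1.isCompact.elim_finite_subcover U hU (by
    refine hφ.2.2.trans (hKU ▸ ?_)
    exact iUnion_mono hKU')
  obtain ⟨C, hC0, hC⟩ := hφ.exists_bound
  refine ⟨F.sup id + 1, C, hC0, fun x => ?_⟩
  by_cases hx : x ∈ tsupport φ
  · obtain ⟨i, hi, hxi⟩ := mem_iUnion₂.1 (hF hx)
    have h2 : χ i x ≤ ∑ i ∈ Finset.range (F.sup id + 1), χ i x :=
      Finset.single_le_sum (f := fun i => χ i x) (fun i _ => h0 i x)
        (Finset.mem_range.2 (Nat.lt_succ_of_le (Finset.le_sup (f := id) hi)))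
    rw [hχU i x hxi] at h2
    have := (abs_le.1 (hC x)).2
    nlinarith
  · rw [image_eq_zero_of_notMem_tsupport hx]
    exact mul_nonneg hC0 (Finset.sum_nonneg fun i _ => h0 i x)

namespace BVm
variable {Ω : Set (Eu n)} {w : Eu n → ℝ} {ν : Measure (Eu n)}

lemma TV_superlevel_le (hΩ : IsOpen Ω) (h : BVm Ω w ν) {φ : Eu n → ℝ}
    (hφ : IsTest Ω φ) (hφ0 : ∀ x, 0 ≤ φ x) {t : ℝ} (ht : DifferentiableAt ℝ (levelVar w φ) t) :
    TV (ind {x | t < w x}) φ ≤ ENNReal.ofReal (deriv (levelVar w φ) t) := by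
  refine le_of_forall_lt_imp_le_of_dense fun c hc => ?_
  have hK := hφ.2.1.isCompact
  have hE : MeasurableSet {y | t < w y} := measurableSet_lt measurable_const h.meas
  have e1 := TV_lsc hφ.2.1 ((locallyIntegrable_ind hE).integrableOn_isCompact hK)
    (Eventually.of_forall fun s => ?_) (tendsto_setIntegral_slice_sub_ind h.meas t hK) hc
  · have hsub : 𝓝[>] (0 : ℝ) ≤ 𝓝[≠] 0 := nhdsWithin_mono _ fun s hs => ne_of_gt hs
    have h1 := (hasDerivAt_iff_tendsto_slope_zero.1 ht.hasDerivAt).mono_left hsub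
    have h2 := (ENNReal.continuous_ofReal.tendsto _).comp h1
    refine ge_of_tendsto h2 ?_
    filter_upwards [e1, self_mem_nhdsWithin] with s hs hs0
    have hs0' : 0 < s := hs0
    refine hs.le.trans ?_
    rw [TV_const_mul (inv_nonneg.2 hs0'.le)]
    simp only [Function.comp_apply, smul_eq_mul]
    rw [ENNReal.ofReal_mul (inv_nonneg.2 hs0'.le)]
    gcongr
    exact (h.TV_slice_le hΩ (by linarith : t ≤ t + s) hφ hφ0).2
  · have : Continuous fun r : ℝ => s⁻¹ * (min r (t + s) - min r t) := by fun_prop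
    exact h.integrableOn_comp this hK

/-- Almost every superlevel set of a function of bounded variation has locally finite perimeter. -/
lemma ae_superlevel (hΩ : IsOpen Ω) (h : BVm Ω w ν) :
    ∀ᵐ t : ℝ, ∃ ν', BVm Ω (ind {x | t < w x}) ν' := by
  obtain ⟨Ψ, hΨ, hΨ0, hdom⟩ := exists_dominating_tests hΩ
  have h1 : ∀ᵐ t : ℝ, ∀ m, DifferentiableAt ℝ (levelVar w (Ψ m)) t :=
    ae_all_iff.2 fun m => (h.monotone_levelVar hΩ (hΨ m) (hΨ0 m)).ae_differentiableAt
  filter_upwards [h1] with t ht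
  have hE : MeasurableSet {y | t < w y} := measurableSet_lt measurable_const h.meas
  have hf : FinTV Ω (ind {x | t < w x}) := by
    refine ⟨fun K _ hK => (locallyIntegrable_ind hE).integrableOn_isCompact hK, fun φ hφ _ => ?_⟩
    obtain ⟨m, C, hC, hle⟩ := hdom φ hφ
    refine ne_top_of_le_ne_top ?_ (TV_mono hle)
    rw [TV_weight_const_mul hC]
    exact ENNReal.mul_ne_top ENNReal.ofReal_ne_top (ne_top_of_le_ne_top ENNReal.ofReal_ne_top
      (h.TV_superlevel_le hΩ (hΨ m) (hΨ0 m) (ht m)))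
  obtain ⟨ν', hν', htv⟩ := hf.exists_measure hΩ
  exact ⟨ν', measurable_ind hE, ⟨1, abs_ind_le _⟩, hν', htv⟩

/-- In every interval there is a level whose superlevel set has perimeter bounded by the mean
increase of the truncated variation. -/
lemma exists_level (hΩ : IsOpen Ω) (h : BVm Ω w ν) {φ : Eu n → ℝ}
    (hφ : IsTest Ω φ) (hφ0 : ∀ x, 0 ≤ φ x) {a b : ℝ} (hab : a < b) :
    ∃ t ∈ Icc a b, ∃ ν', BVm Ω (ind {x | t < w x}) ν' ∧
      (b - a) * ∫ x, φ x ∂ν' ≤ levelVar w φ b - levelVar w φ a := by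
  have hm := h.monotone_levelVar hΩ hφ hφ0
  have hi : IntervalIntegrable (deriv (levelVar w φ)) volume a b :=
    (hm.monotoneOn _).intervalIntegrable_deriv
  have hmem := (hm.monotoneOn (uIcc a b)).intervalIntegral_deriv_mem_uIcc
  have hle : ∫ x in a..b, deriv (levelVar w φ) x ≤ levelVar w φ b - levelVar w φ a := by
    rw [uIcc_of_le (by linarith [hm hab.le])] at hmem; exact hmem.2
  have hgood : ∀ᵐ t : ℝ, (∃ ν', BVm Ω (ind {x | t < w x}) ν') ∧
      DifferentiableAt ℝ (levelVar w φ) t := (h.ae_superlevel hΩ).and hm.ae_differentiableAt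
  suffices hex : ∃ t ∈ Icc a b, ((∃ ν', BVm Ω (ind {x | t < w x}) ν') ∧
      DifferentiableAt ℝ (levelVar w φ) t) ∧
      (b - a) * deriv (levelVar w φ) t ≤ levelVar w φ b - levelVar w φ a by
    obtain ⟨t, ht, ⟨⟨ν', h'⟩, hd⟩, hle'⟩ := hex
    refine ⟨t, ht, ν', h', le_trans ?_ hle'⟩
    have h1 := h.TV_superlevel_le hΩ hφ hφ0 hd
    rw [h'.tv φ hφ hφ0] at h1
    have h2 : 0 ≤ deriv (levelVar w φ) t := hm.deriv_nonneg
    have h3 := (ENNReal.ofReal_le_ofReal_iff h2).1 h1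
    exact mul_le_mul_of_nonneg_left h3 (by linarith)
  by_contra! H
  set D := levelVar w φ b - levelVar w φ a
  have h1 : ∀ᵐ t ∂(volume.restrict (Ioc a b)), D / (b - a) < deriv (levelVar w φ) t := by
    rw [ae_restrict_iff' measurableSet_Ioc]
    filter_upwards [hgood] with t ht htm
    rw [div_lt_iff₀ (by linarith), mul_comm]
    exact H t (Ioc_subset_Icc_self htm) ht
  have h2 : ∫ x in a..b, (D / (b - a)) < ∫ x in a..b, deriv (levelVar w φ) x := by
    refine intervalIntegral.integral_lt_integral_of_ae_le_of_measure_setOfPred_lt_ne_zero hab.le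
      intervalIntegrable_const hi (h1.mono fun _ => le_of_lt) ?_
    have h3 : (volume.restrict (Ioc a b)) {x | D / (b - a) < deriv (levelVar w φ) x}ᶜ = 0 := h1
    intro h4
    have h5 : (volume.restrict (Ioc a b)) univ ≤ 0 := by
      rw [← union_compl_self {x | D / (b - a) < deriv (levelVar w φ) x}]
      refine (measure_union_le _ _).trans ?_
      rw [h3]; simpa using h4.le
    rw [Measure.restrict_apply_univ, Real.volume_Ioc] at h5
    simp at h5; linarith
  rw [intervalIntegral.integral_const, smul_eq_mul, mul_div_cancel₀ _ (by linarith)] at h2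
  linarith

end BVm

lemma DensityZeroAt.mono_ae {A B : Set (Eu n)} {x : Eu n} {r : ℝ} (hr : 0 < r)
    (hAB : ∀ᵐ y, y ∈ ball x r → y ∈ A → y ∈ B) (hB : DensityZeroAt B x) : DensityZeroAt A x := by
  refine tendsto_of_tendsto_of_tendsto_of_le_of_le' tendsto_const_nhds hB
    (Eventually.of_forall fun _ => zero_le) ?_
  filter_upwards [Ioo_mem_nhdsGT hr] with s hs
  gcongr ?_ / _
  refine measure_mono_ae ?_
  filter_upwards [hAB] with y hy hyA
  exact ⟨hy (ball_subset_ball hs.2.le hyA.2) hyA.1, hyA.2⟩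

lemma not_densityZeroAt_of_ae {A : Set (Eu n)} {x : Eu n} {r : ℝ} (hr : 0 < r)
    (hA : ∀ᵐ y, y ∈ ball x r → y ∈ A) : ¬ DensityZeroAt A x := by
  intro h
  have h1 : DensityZeroAt univ x := h.mono_ae hr (by simpa using hA)
  have h2 : Tendsto (fun _ : ℝ => (1 : ℝ≥0∞)) (𝓝[>] 0) (𝓝 0) := by
    refine h1.congr' ?_
    filter_upwards [self_mem_nhdsWithin] with s hs
    have hs' : (0 : ℝ) < s := hs
    rw [univ_inter]
    exact ENNReal.div_self (measure_ball_pos volume x hs').ne' measure_ball_lt_top.ne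
  exact one_ne_zero (tendsto_nhds_unique tendsto_const_nhds h2)

/-- `w` is bounded by `M` in the ball `B_r(x)`, up to a null set. -/
def NearBdd (w : Eu n → ℝ) (x : Eu n) (r M : ℝ) : Prop :=
  0 < r ∧ ∀ᵐ y, y ∈ ball x r → |w y| ≤ M

lemma NearBdd.mem_of_lt {w : Eu n → ℝ} {x : Eu n} {r M t : ℝ} (h : NearBdd w x r M) (ht : M ≤ t) :
    DensityZeroAt {y | t < w y} x := by
  have h0 : DensityZeroAt (∅ : Set (Eu n)) x := by simp [DensityZeroAt]
  refine h0.mono_ae h.1 ?_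
  filter_upwards [h.2] with y hy hyb (hyt : t < w y)
  exact absurd (abs_le.1 (hy hyb)).2 (by push Not; linarith)

lemma NearBdd.le_of_mem {w : Eu n → ℝ} {x : Eu n} {r M t : ℝ} (h : NearBdd w x r M)
    (ht : DensityZeroAt {y | t < w y} x) : -M ≤ t := by
  by_contra! hlt
  refine not_densityZeroAt_of_ae h.1 ?_ ht
  filter_upwards [h.2] with y hy hyb
  exact hlt.trans_le (abs_le.1 (hy hyb)).1

lemma NearBdd.bddBelow {w : Eu n → ℝ} {x : Eu n} {r M : ℝ} (h : NearBdd w x r M) :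
    BddBelow {t : ℝ | DensityZeroAt {y | t < w y} x} := ⟨-M, fun _ ht => h.le_of_mem ht⟩

lemma NearBdd.upperRep_le {w : Eu n → ℝ} {x : Eu n} {r M t : ℝ} (h : NearBdd w x r M)
    (ht : DensityZeroAt {y | t < w y} x) : upperRep w x ≤ t :=
  csInf_le h.bddBelow ht

lemma NearBdd.le_upperRep {w : Eu n → ℝ} {x : Eu n} {r M t : ℝ} (h : NearBdd w x r M)
    (ht : ¬ DensityZeroAt {y | t < w y} x) : t ≤ upperRep w x := by
  refine le_csInf ⟨M, h.mem_of_lt le_rfl⟩ fun s hs => ?_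
  by_contra! hst
  refine ht (hs.mono_ae zero_lt_one ?_)
  exact Eventually.of_forall fun y _ (hy : t < w y) => hst.trans hy

lemma NearBdd.abs_upperRep_le {w : Eu n → ℝ} {x : Eu n} {r M : ℝ} (h : NearBdd w x r M) :
    |upperRep w x| ≤ M :=
  abs_le.2 ⟨le_csInf ⟨M, h.mem_of_lt le_rfl⟩ fun _ hs => h.le_of_mem hs,
    h.upperRep_le (h.mem_of_lt le_rfl)⟩

lemma upperRep_congr {w v : Eu n → ℝ} {x : Eu n} {r : ℝ} (hr : 0 < r)
    (h : ∀ᵐ y, y ∈ ball x r → w y = v y) : upperRep w x = upperRep v x := by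
  unfold upperRep
  congr 1
  ext t
  constructor
  · refine fun ht => DensityZeroAt.mono_ae hr ?_ ht
    filter_upwards [h] with y hy hyb (hyt : t < v y)
    show t < w y
    rwa [hy hyb]
  · refine fun ht => DensityZeroAt.mono_ae hr ?_ ht
    filter_upwards [h] with y hy hyb (hyt : t < w y)
    show t < v y
    rwa [← hy hyb]

lemma upperRep_mono {w v : Eu n → ℝ} {x : Eu n} {r s M M' : ℝ} (hw : NearBdd w x r M)
    (hv : NearBdd v x s M') (h : ∀ᵐ y, y ∈ ball x r → w y ≤ v y) : upperRep w x ≤ upperRep v x := by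
  refine le_csInf ⟨M', hv.mem_of_lt le_rfl⟩ fun t ht => hw.upperRep_le ?_
  refine DensityZeroAt.mono_ae hw.1 ?_ ht
  filter_upwards [h] with y hy hyb (hyt : t < w y)
  exact hyt.trans_le (hy hyb)

lemma measurable_upperRep {w : Eu n → ℝ} (hw : Measurable w) {M : ℝ} (hM : ∀ x, |w x| ≤ M) :
    Measurable (upperRep w) := by
  have hb : ∀ x, NearBdd w x 1 M := fun x => ⟨one_pos, Eventually.of_forall fun y _ => hM y⟩
  refine measurable_of_Iio fun c => ?_
  have : upperRep w ⁻¹' Iio c =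
      ⋃ q : ℚ, ⋃ _ : (q : ℝ) < c, (posDens {y | (q : ℝ) < w y})ᶜ := by
    ext x
    simp only [mem_preimage, mem_Iio, mem_iUnion, mem_compl_iff, posDens]
    constructor
    · intro h
      obtain ⟨q, hq1, hq2⟩ := exists_rat_btwn h
      refine ⟨q, hq2, fun hq => ?_⟩
      exact absurd ((hb x).le_upperRep hq) (by push Not; exact hq1)
    · rintro ⟨q, hq, hx⟩
      exact lt_of_le_of_lt ((hb x).upperRep_le (not_not.1 hx)) hq
  rw [this]
  exact MeasurableSet.iUnion fun q => MeasurableSet.iUnion fun _ =>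
    (measurableSet_posDens (measurableSet_lt measurable_const hw)).compl

open Classical in
/-- Counting the levels below `v` in a grid of mesh `h` recovers `v` up to `h`. -/
lemma abs_min_sub_count_le {a h v : ℝ} (hh : 0 ≤ h) (hv : a ≤ v) {t : ℕ → ℝ} {p : ℕ → Prop}
    (ht : ∀ j : ℕ, t j ∈ Icc (a + j * h) (a + (j + 1) * h)) (hp : ∀ j, p j → t j ≤ v)
    (hp' : ∀ j, ¬ p j → v ≤ t j) (N : ℕ) :
    |min v (a + N * h) - (a + h * ∑ j ∈ Finset.range N, if p j then (1 : ℝ) else 0)| ≤ h := by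
  have htriv : ∀ N : ℕ, ∑ j ∈ Finset.range N, (if p j then (1 : ℝ) else 0) ≤ N := fun N => by
    refine (Finset.sum_le_sum (g := fun _ => (1 : ℝ)) fun j _ => by split_ifs <;> norm_num).trans ?_
    simp
  induction N with
  | zero => simp [min_eq_right hv, hh]
  | succ N ih =>
    rw [Finset.sum_range_succ, abs_le] at *
    have hb := mul_le_mul_of_nonneg_left (htriv N) hh
    have hmono : min v (a + N * h) ≤ min v (a + (N + 1 : ℕ) * h) :=
      min_le_min_left _ (by push_cast; nlinarith)
    have hstep : min v (a + (N + 1 : ℕ) * h) ≤ min v (a + N * h) + h := by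
      rw [← min_add_add_right]
      exact min_le_min (by linarith) (by push_cast; linarith)
    by_cases hN : p N
    · simp only [hN, if_true]
      have h1 : a + N * h ≤ v := (ht N).1.trans (hp N hN)
      have h2 : a + N * h ≤ min v (a + (N + 1 : ℕ) * h) := le_min h1 (by push_cast; nlinarith)
      constructor <;> linarith [ih.1, ih.2]
    · simp only [hN, if_false]
      refine ⟨by linarith [ih.1, ih.2], ?_⟩
      have h1 : v ≤ a + (N + 1) * h := (hp' N hN).trans (ht N).2
      rcases le_or_gt v (a + N * h) with h2 | h2
      · have h3 : min v (a + (N + 1 : ℕ) * h) ≤ v := min_le_left _ _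
        rw [min_eq_left h2] at ih
        linarith [ih.2]
      · have h3 : ∑ j ∈ Finset.range N, (if p j then (1 : ℝ) else 0) = N := by
          rw [Finset.sum_congr rfl (g := fun _ => (1 : ℝ))]
          · simp
          · intro j hj
            have hjN : (j : ℝ) + 1 ≤ N := by exact_mod_cast Finset.mem_range.1 hj
            by_cases hpj : p j
            · simp [hpj]
            · have := hp' j hpj
              have := (ht j).2
              nlinarith
        have h4 : min v (a + (N + 1 : ℕ) * h) ≤ v := min_le_left _ _
        rw [h3]; linarith

namespace BVm
variable {Ω : Set (Eu n)} {w : Eu n → ℝ} {ν : Measure (Eu n)}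

/-- A layer-cake approximation of a bounded function of bounded variation and of its upper
representative, with control of the total perimeter. -/
lemma exists_grid (hΩ : IsOpen Ω) (h : BVm Ω w ν) {φ : Eu n → ℝ} (hφ : IsTest Ω φ)
    (hφ0 : ∀ x, 0 ≤ φ x) {M : ℝ} (hM : ∀ x, |w x| ≤ M) {δ : ℝ} (hδ : 0 < δ) :
    ∃ (N : ℕ) (E : ℕ → Set (Eu n)) (νj : ℕ → Measure (Eu n)),
      (∀ j, MeasurableSet (E j)) ∧ (∀ j, BVm Ω (ind (E j)) (νj j)) ∧
      δ * ∑ j ∈ Finset.range N, ∫ x, φ x ∂(νj j) ≤ ∫ x, φ x ∂ν ∧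
      (∀ x, |w x - (-M + δ * ∑ j ∈ Finset.range N, ind (E j) x)| ≤ δ) ∧
      ∀ x, |upperRep w x - (-M + δ * ∑ j ∈ Finset.range N, ind (posDens (E j)) x)| ≤ δ := by
  classical
  choose t ht νj hνj hle using fun j : ℕ => h.exists_level hΩ hφ hφ0
    (a := -M + j * δ) (b := -M + (j + 1) * δ) (by linarith)
  obtain ⟨N, hN⟩ := exists_nat_ge (2 * M / δ)
  have hNM : M ≤ -M + N * δ := by rw [div_le_iff₀ hδ] at hN; linarith
  refine ⟨N, fun j => {x | t j < w x}, νj, fun j => measurableSet_lt measurable_const h.meas,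
    hνj, ?_, fun x => ?_, fun x => ?_⟩
  · have h1 : ∀ N : ℕ, δ * ∑ j ∈ Finset.range N, ∫ x, φ x ∂(νj j) ≤
        levelVar w φ (-M + N * δ) - levelVar w φ (-M) := by
      intro N
      induction N with
      | zero => simp
      | succ N ih =>
        have := hle N
        rw [Finset.sum_range_succ, mul_add]
        push_cast
        have e : -M + (N + 1 : ℝ) * δ - (-M + N * δ) = δ := by ring
        rw [e] at this
        linarith
    have h2 := h.levelVar_le hΩ hφ hφ0 (-M + N * δ)
    have h3 : 0 ≤ levelVar w φ (-M) := ENNReal.toReal_nonneg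
    linarith [h1 N]
  · have h1 := abs_le.1 (hM x)
    have := abs_min_sub_count_le hδ.le h1.1 ht (p := fun j => t j < w x) (fun j hj => hj.le)
      (fun j hj => not_lt.1 hj) N
    rw [min_eq_left (h1.2.trans hNM)] at this
    simpa [ind, indicator] using this
  · have hb : NearBdd w x 1 M := ⟨one_pos, Eventually.of_forall fun y _ => hM y⟩
    have h1 := abs_le.1 hb.abs_upperRep_le
    have := abs_min_sub_count_le hδ.le h1.1 ht (p := fun j => x ∈ posDens {y | t j < w y})
      (fun j hj => hb.le_upperRep hj)
      (fun j hj => hb.upperRep_le (not_not.1 hj)) N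
    rw [min_eq_left (h1.2.trans hNM)] at this
    simpa [ind, indicator] using this

end BVm

lemma integral_mul_layers {Ω : Set (Eu n)} {μ : Measure (Eu n)} (hμ : LocFinOn Ω μ) {φ : Eu n → ℝ}
    (hφ : IsTest Ω φ) (M δ : ℝ) {N : ℕ} {P : ℕ → Set (Eu n)} (hP : ∀ j, MeasurableSet (P j)) :
    Integrable (fun x => φ x * (-M + δ * ∑ j ∈ Finset.range N, ind (P j) x)) μ ∧
    ∫ x, φ x * (-M + δ * ∑ j ∈ Finset.range N, ind (P j) x) ∂μ =
      -M * (∫ x, φ x ∂μ) + δ * ∑ j ∈ Finset.range N, ∫ x in P j, φ x ∂μ := by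
  have hi := hμ.integrable_test hφ
  have hind : ∀ j x, φ x * ind (P j) x = (P j).indicator φ x := fun j x => by
    by_cases hx : x ∈ P j <;> simp [ind, hx]
  have e : (fun x => φ x * (-M + δ * ∑ j ∈ Finset.range N, ind (P j) x)) =
      fun x => -M * φ x + δ * ∑ j ∈ Finset.range N, (P j).indicator φ x := by
    ext x
    simp_rw [← hind, ← Finset.mul_sum]; ring
  have hs : Integrable (fun x => ∑ j ∈ Finset.range N, (P j).indicator φ x) μ :=
    integrable_finsetSum _ fun j _ => hi.indicator (hP j)
  rw [e]
  refine ⟨(hi.const_mul _).add (hs.const_mul _), ?_⟩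
  rw [integral_add (hi.const_mul _) (hs.const_mul _), integral_const_mul, integral_const_mul,
    integral_finsetSum _ fun j _ => hi.indicator (hP j)]
  simp_rw [integral_indicator (hP _)]

lemma LocFinOn.integrable_mul_upperRep {Ω : Set (Eu n)} {μ : Measure (Eu n)} (hμ : LocFinOn Ω μ)
    {w φ : Eu n → ℝ} (hφ : IsTest Ω φ) (hw : Measurable w) {M : ℝ} (hM : ∀ x, |w x| ≤ M) :
    Integrable (fun x => φ x * upperRep w x) μ :=
  hμ.integrable_mul_bdd hφ (measurable_upperRep hw hM).aestronglyMeasurable (C := M)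
    (Eventually.of_forall fun _ =>
      NearBdd.abs_upperRep_le (r := 1) ⟨one_pos, Eventually.of_forall fun y _ => hM y⟩)

lemma integral_mul_le_of_abs_sub_le {μ : Measure (Eu n)} {φ f g : Eu n → ℝ} {δ : ℝ}
    (hφ0 : ∀ x, 0 ≤ φ x) (hφ : Integrable φ μ) (hf : Integrable (fun x => φ x * f x) μ)
    (hg : Integrable (fun x => φ x * g x) μ) (h : ∀ x, |f x - g x| ≤ δ) :
    ∫ x, φ x * f x ∂μ ≤ (∫ x, φ x * g x ∂μ) + δ * ∫ x, φ x ∂μ := by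
  rw [← integral_const_mul, ← integral_add hg (hφ.const_mul δ)]
  refine integral_mono hf (hg.add (hφ.const_mul δ)) fun x => ?_
  have := mul_le_mul_of_nonneg_left (abs_le.1 (h x)).2 (hφ0 x)
  beta_reduce
  linarith

namespace BVm
variable {Ω : Set (Eu n)} {w : Eu n → ℝ} {ν : Measure (Eu n)}

/-- The pairing `⟨σ, Dw⁺⟩` is dominated by `|Dw|`. -/
lemma integral_upperRep_le (hΩ : IsOpen Ω) (h : BVm Ω w ν) {φ : Eu n → ℝ} (hφ : IsTest Ω φ)
    (hφ0 : ∀ x, 0 ≤ φ x) {σ : Eu n → Eu n} {μ : Measure (Eu n)} (hσ : SigM Ω σ μ) :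
    ∫ x, φ x * upperRep w x ∂μ ≤ (∫ x in Ω, w x * ⟪σ x, gradient φ x⟫) + ∫ x, φ x ∂ν := by
  obtain ⟨M, hM⟩ := h.bdd
  have hg := hφ.integrable_gradient
  have hσi := hσ.integrableOn_inner hg
  have hiφ := hσ.locFin.integrable_test hφ
  set A := ∫ x, φ x ∂μ
  set B := ∫ x in Ω, |⟪σ x, gradient φ x⟫|
  have key : ∀ δ : ℝ, 0 < δ → ∫ x, φ x * upperRep w x ∂μ ≤
      (∫ x in Ω, w x * ⟪σ x, gradient φ x⟫) + (∫ x, φ x ∂ν) + δ * (A + B) := by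
    intro δ hδ
    obtain ⟨N, E, νj, hE, hB, hsum, hw, hw'⟩ := h.exists_grid hΩ hφ hφ0 hM hδ
    obtain ⟨hi1, he1⟩ := integral_mul_layers hσ.locFin hφ M δ (N := N)
      fun j => measurableSet_posDens (hE j)
    have h1 := integral_mul_le_of_abs_sub_le hφ0 hiφ
      (hσ.locFin.integrable_mul_upperRep hφ h.meas hM) hi1 hw'
    rw [he1] at h1
    have h2 : ∑ j ∈ Finset.range N, ∫ x in posDens (E j), φ x ∂μ ≤
        ∑ j ∈ Finset.range N, ((∫ x in Ω, ind (E j) x * ⟪σ x, gradient φ x⟫) + ∫ x, φ x ∂(νj j)) :=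
      Finset.sum_le_sum fun j _ => (hB j).setIntegral_posDens_le hΩ (hE j) hφ hφ0 hσ
    rw [Finset.sum_add_distrib] at h2
    have hij : ∀ j, IntegrableOn (fun x => ind (E j) x * ⟪σ x, gradient φ x⟫) Ω := fun j =>
      hσi.bdd_mul (measurable_ind (hE j)).aestronglyMeasurable
        (Eventually.of_forall fun x => abs_ind_le _ x)
    have hsi : IntegrableOn (fun x => ∑ j ∈ Finset.range N, ind (E j) x * ⟪σ x, gradient φ x⟫) Ω :=
      integrable_finsetSum _ fun j _ => hij j
    have hiw : IntegrableOn (fun x => w x * ⟪σ x, gradient φ x⟫) Ω :=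
      hσi.bdd_mul h.meas.aestronglyMeasurable (Eventually.of_forall hM)
    have h3 : -M * A + δ * ∑ j ∈ Finset.range N, ∫ x in Ω, ind (E j) x * ⟪σ x, gradient φ x⟫ ≤
        (∫ x in Ω, w x * ⟪σ x, gradient φ x⟫) + δ * B := by
      rw [show A = ∫ x in Ω, ⟪σ x, gradient φ x⟫ from hσ.integral_eq hφ,
        ← integral_finsetSum _ fun j _ => hij j, ← integral_const_mul, ← integral_const_mul,
        ← integral_const_mul, ← integral_add (hσi.const_mul _) (hsi.const_mul _),
        ← integral_add hiw (hσi.abs.const_mul _)]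
      refine integral_mono ((hσi.const_mul _).add (hsi.const_mul _))
        (hiw.add (hσi.abs.const_mul _)) fun x => ?_
      beta_reduce
      set s := ⟪σ x, gradient φ x⟫
      rw [← Finset.sum_mul]
      have h4 : ((-M + δ * ∑ j ∈ Finset.range N, ind (E j) x) - w x) * s ≤ δ * |s| := by
        refine (le_abs_self _).trans ?_
        rw [abs_mul, abs_sub_comm]
        exact mul_le_mul_of_nonneg_right (hw x) (abs_nonneg _)
      linarith
    have h5 := mul_le_mul_of_nonneg_left h2 hδ.le
    linarith
  refine le_of_forall_pos_le_add fun e he => ?_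
  have hpos : 0 < |A + B| + 1 := by positivity
  refine (key (e / (|A + B| + 1)) (by positivity)).trans ?_
  have : e / (|A + B| + 1) * (A + B) ≤ e := by
    rw [div_mul_eq_mul_div, div_le_iff₀ hpos]
    nlinarith [le_abs_self (A + B)]
  linarith

/-- Upper semicontinuity of `μ ↦ ∫ φ w⁺ dμ` along measures `-Div σ_k` with `|σ_k| ≤ 1`. -/
lemma eventually_integral_upperRep_le (hΩ : IsOpen Ω) (h : BVm Ω w ν) {φ : Eu n → ℝ}
    (hφ : IsTest Ω φ) (hφ0 : ∀ x, 0 ≤ φ x) {ι : Type*} {l : Filter ι} {σk : ι → Eu n → Eu n}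
    {μk : ι → Measure (Eu n)} (hσk : ∀ k, SigM Ω (σk k) (μk k)) {μ : Measure (Eu n)}
    (hμ : LocFinOn Ω μ)
    (hconv : ∀ ψ, IsTest Ω ψ → Tendsto (fun k => ∫ x, ψ x ∂(μk k)) l (𝓝 (∫ x, ψ x ∂μ)))
    {η : ℝ} (hη : 0 < η) :
    ∀ᶠ k in l, ∫ x, φ x * upperRep w x ∂(μk k) ≤ (∫ x, φ x * upperRep w x ∂μ) + η := by
  obtain ⟨M, hM⟩ := h.bdd
  have hA0 : 0 ≤ ∫ x, φ x ∂μ := integral_nonneg hφ0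
  set A := ∫ x, φ x ∂μ with hA
  set δ := η / (2 * A + 3) with hδ'
  have hδ : 0 < δ := by positivity
  have hδe : δ * (2 * A + 3) = η := by rw [hδ']; field_simp
  obtain ⟨N, E, νj, hE, hB, -, hw, hw'⟩ := h.exists_grid hΩ hφ hφ0 hM hδ
  have hP := fun j => measurableSet_posDens (hE j)
  have e1 : ∀ᶠ k in l, ∀ j ∈ Finset.range N, ∫ x in posDens (E j), φ x ∂(μk k) ≤
      (∫ x in posDens (E j), φ x ∂μ) + 1 / (N + 1) :=
    (Filter.eventually_all_finset _).2 fun j _ =>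
      (hB j).eventually_setIntegral_posDens_le hΩ (hE j) hφ hφ0 hσk hμ hconv (by positivity)
  have hcφ : Tendsto (fun k => (-M + δ) * ∫ x, φ x ∂(μk k)) l (𝓝 ((-M + δ) * A)) :=
    (hconv φ hφ).const_mul _
  have e2 := hcφ.eventually_le_const (show (-M + δ) * A < (-M + δ) * A + δ by linarith)
  filter_upwards [e1, e2] with k hk1 hk2
  obtain ⟨hi1, he1⟩ := integral_mul_layers (hσk k).locFin hφ M δ (N := N) hP
  obtain ⟨hi2, he2⟩ := integral_mul_layers hμ hφ M δ (N := N) hP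
  have h1 := integral_mul_le_of_abs_sub_le hφ0 ((hσk k).locFin.integrable_test hφ)
    ((hσk k).locFin.integrable_mul_upperRep hφ h.meas hM) hi1 hw'
  have h2 := integral_mul_le_of_abs_sub_le hφ0 (hμ.integrable_test hφ) hi2
    (hμ.integrable_mul_upperRep hφ h.meas hM) (fun x => (abs_sub_comm _ _).trans_le (hw' x))
  rw [he1] at h1
  rw [he2] at h2
  have h3 := Finset.sum_le_sum hk1
  rw [Finset.sum_add_distrib, Finset.sum_const, Finset.card_range, nsmul_eq_mul] at h3
  have h4 : (N : ℝ) * (1 / (N + 1)) ≤ 1 := by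
    rw [mul_one_div, div_le_one (by positivity)]; linarith
  have h5 := mul_le_mul_of_nonneg_left (h3.trans (add_le_add_right h4 _)) hδ.le
  linarith

end BVm

lemma locFinOn_volume_restrict {Ω : Set (Eu n)} (hΩ : IsOpen Ω) :
    LocFinOn Ω ((volume : Measure (Eu n)).restrict Ω) := by
  refine ⟨fun K _ hK => (Measure.restrict_apply_le _ _).trans_lt hK.measure_lt_top, ?_⟩
  rw [Measure.restrict_apply hΩ.measurableSet.compl]
  simp

lemma sum_stdVec (v : Eu n) : v = ∑ i, v i • stdVec i := by
  ext j
  simp [Finset.sum_apply, Pi.single_apply]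

/-- The pairings of `σ` with a direction are bounded by the norm of the direction. -/
lemma Bdd.integrable_mul_inner {Ω : Set (Eu n)} (hΩ : IsOpen Ω) {σ : Eu n → Eu n}
    (h : Bdd Ω σ 1) {φ : Eu n → ℝ} (hφ : IsTest Ω φ) (v : Eu n) :
    Integrable (fun x => φ x * ⟪σ x, v⟫) (volume.restrict Ω) := by
  refine (locFinOn_volume_restrict hΩ).integrable_mul_bdd hφ (C := ‖v‖)
    (h.1.inner aestronglyMeasurable_const) ?_
  filter_upwards [h.2] with x hx
  exact (abs_real_inner_le_norm _ _).trans (mul_le_of_le_one_left (norm_nonneg _) hx)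

lemma Bdd.abs_setIntegral_mul_inner_le {Ω : Set (Eu n)} (hΩ : IsOpen Ω) {σ : Eu n → Eu n}
    (h : Bdd Ω σ 1) {φ : Eu n → ℝ} (hφ : IsTest Ω φ) {v : Eu n} (hv : ‖v‖ ≤ 1) :
    |∫ x in Ω, φ x * ⟪σ x, v⟫| ≤ ∫ x in Ω, |φ x| := by
  rw [← Real.norm_eq_abs]
  refine norm_integral_le_of_norm_le
    ((locFinOn_volume_restrict hΩ).integrable_test hφ).abs ?_
  filter_upwards [h.2] with x hx
  rw [norm_mul, Real.norm_eq_abs, Real.norm_eq_abs]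
  exact mul_le_of_le_one_right (abs_nonneg _)
    ((abs_real_inner_le_norm _ _).trans (mul_le_one₀ hx (norm_nonneg _) hv))

/-- Weak* compactness of the unit ball of `L^∞(Ω, ℝⁿ)`, along an ultrafilter. -/
lemma exists_weakStar_limit {Ω : Set (Eu n)} (hΩ : IsOpen Ω) {σk : ℕ → Eu n → Eu n}
    (h : ∀ k, Bdd Ω (σk k) 1) : ∃ σ : Eu n → Eu n, Bdd Ω σ 1 ∧ ∀ φ, IsTest Ω φ → ∀ v,
      Tendsto (fun k => ∫ x in Ω, φ x * ⟪σk k x, v⟫) (hyperfilter ℕ)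
        (𝓝 (∫ x in Ω, φ x * ⟪σ x, v⟫)) := by
  have hvol := locFinOn_volume_restrict hΩ
  have hL : ∀ φ, IsTest Ω φ → ∀ i, Tendsto (fun k => ∫ x in Ω, φ x * ⟪σk k x, stdVec i⟫)
      (hyperfilter ℕ) (𝓝 (ulim fun k => ∫ x in Ω, φ x * ⟪σk k x, stdVec i⟫)) := fun φ hφ i =>
    tendsto_ulim (Eventually.of_forall fun k =>
      (h k).abs_setIntegral_mul_inner_le hΩ hφ (by simp : ‖stdVec i‖ ≤ 1))
  have hd : ∀ i : Fin n, ∃ g : Eu n → ℝ, Measurable g ∧ (∀ x, |g x| ≤ 1) ∧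
      ∀ φ, IsTest Ω φ → (∀ x, 0 ≤ φ x) →
        (ulim fun k => ∫ x in Ω, φ x * ⟪σk k x, stdVec i⟫) = ∫ x in Ω, φ x * g x := by
    intro i
    refine hvol.exists_density hΩ
      (L := fun φ => ulim fun k => ∫ x in Ω, φ x * ⟪σk k x, stdVec i⟫) (fun φ hφ hφ0 => ?_)
      (fun φ ψ hφ hψ => ?_) fun c φ hφ => ?_
    · refine le_of_tendsto (hL φ hφ i).abs (Eventually.of_forall fun k => ?_)
      refine ((h k).abs_setIntegral_mul_inner_le hΩ hφ (by simp : ‖stdVec i‖ ≤ 1)).trans_eq ?_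
      simp only [abs_of_nonneg (hφ0 _)]
    · refine ulim_eq (((hL φ hφ i).add (hL ψ hψ i)).congr fun k => ?_)
      rw [← integral_add ((h k).integrable_mul_inner hΩ hφ _) ((h k).integrable_mul_inner hΩ hψ _)]
      simp only [add_mul]
    · refine ulim_eq (((hL φ hφ i).const_mul c).congr fun k => ?_)
      rw [← integral_const_mul]
      simp only [mul_assoc]
  choose g hgm hg1 hg using hd
  have hgi : ∀ i φ, IsTest Ω φ → Integrable (fun x => φ x * g i x) (volume.restrict Ω) :=
    fun i φ hφ => hvol.integrable_mul_bdd hφ (hgm i).aestronglyMeasurable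
      (Eventually.of_forall (hg1 i))
  have hg' : ∀ i φ, IsTest Ω φ → Tendsto (fun k => ∫ x in Ω, φ x * ⟪σk k x, stdVec i⟫)
      (hyperfilter ℕ) (𝓝 (∫ x in Ω, φ x * g i x)) := by
    intro i φ hφ
    obtain ⟨χ, hχ, hχ0, hs⟩ := hφ.exists_sub_nonneg hΩ
    have a := (hL _ (hφ.add hχ) i).sub (hL χ hχ i)
    rw [hg i _ (hφ.add hχ) hs, hg i χ hχ hχ0] at a
    simp only [add_mul] at a
    rw [integral_add (hgi i φ hφ) (hgi i χ hχ), add_sub_cancel_right] at a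
    refine a.congr fun k => ?_
    rw [integral_add ((h k).integrable_mul_inner hΩ hφ _) ((h k).integrable_mul_inner hΩ hχ _)]
    ring
  set σ : Eu n → Eu n := fun x => WithLp.toLp 2 fun i => g i x with hσ
  have hσm : Measurable σ :=
    (WithLp.measurable_toLp 2 _).comp (measurable_pi_lambda _ hgm)
  have hσi : ∀ x i, ⟪σ x, stdVec i⟫ = g i x := fun x i => by
    rw [EuclideanSpace.inner_single_right]; simp [hσ]
  have hin : ∀ (s : Eu n) v, ⟪s, v⟫ = ∑ i, v i * ⟪s, stdVec i⟫ := fun s v => by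
    conv_lhs => rw [sum_stdVec v, inner_sum]
    simp only [inner_smul_right]
  have hconv : ∀ φ, IsTest Ω φ → ∀ v, Tendsto (fun k => ∫ x in Ω, φ x * ⟪σk k x, v⟫)
      (hyperfilter ℕ) (𝓝 (∫ x in Ω, φ x * ⟪σ x, v⟫)) := by
    intro φ hφ v
    have e1 : ∫ x in Ω, φ x * ⟪σ x, v⟫ = ∑ i, v i * ∫ x in Ω, φ x * g i x := by
      simp only [hin _ v, hσi, Finset.mul_sum, mul_left_comm (φ _) (v _)]
      rw [integral_finsetSum _ fun i _ => (hgi i φ hφ).const_mul _]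
      simp only [integral_const_mul]
    have e2 : ∀ k, ∫ x in Ω, φ x * ⟪σk k x, v⟫
        = ∑ i, v i * ∫ x in Ω, φ x * ⟪σk k x, stdVec i⟫ := by
      intro k
      simp only [hin _ v, Finset.mul_sum, mul_left_comm (φ _) (v _)]
      rw [integral_finsetSum _ fun i _ => ((h k).integrable_mul_inner hΩ hφ _).const_mul _]
      simp only [integral_const_mul]
    rw [e1]
    simp only [e2]
    exact tendsto_finsetSum _ fun i _ => (hg' i φ hφ).const_mul _
  refine ⟨σ, ⟨hσm.aestronglyMeasurable, ae_norm_le_one_of_inner fun v hv => ?_⟩, hconv⟩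
  have hm : Measurable fun x => ⟪σ x, v⟫ := hσm.inner measurable_const
  have hb : ∀ x, |⟪σ x, v⟫| ≤ ∑ i, |v i| := fun x => by
    rw [hin]
    refine (Finset.abs_sum_le_sum_abs _ _).trans (Finset.sum_le_sum fun i _ => ?_)
    rw [abs_mul, hσi]
    exact mul_le_of_le_one_right (abs_nonneg _) (hg1 i x)
  refine hvol.ae_nonneg_of_integral hΩ (C := 1 + ∑ i, |v i|) (measurable_const.sub hm)
    (fun x => ?_) fun φ hφ hφ0 => ?_
  · have := abs_le.1 (hb x)
    exact abs_le.2 ⟨by linarith [this.2], by linarith [this.1]⟩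
  · simp only [mul_sub, mul_one]
    rw [integral_sub (hvol.integrable_test hφ)
      (hvol.integrable_mul_bdd hφ hm.aestronglyMeasurable (Eventually.of_forall hb)), sub_nonneg]
    refine le_of_tendsto (hconv φ hφ v) (Eventually.of_forall fun k => ?_)
    refine (le_abs_self _).trans
      (((h k).abs_setIntegral_mul_inner_le hΩ hφ hv).trans_eq ?_)
    simp only [abs_of_nonneg (hφ0 _)]

lemma IsTest.coord_gradient {Ω : Set (Eu n)} {φ : Eu n → ℝ} (hφ : IsTest Ω φ) (i : Fin n) :
    IsTest Ω fun x => gradient φ x i := by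
  have hs : Function.support (fun x => gradient φ x i) ⊆ tsupport φ := fun x hx => by
    by_contra h
    exact hx (by simp [gradient_eq_zero_of_notMem h])
  have hs' : tsupport (fun x => gradient φ x i) ⊆ tsupport φ :=
    closure_minimal hs (isClosed_tsupport _)
  refine ⟨?_, hφ.2.1.of_isClosed_subset (isClosed_tsupport _) hs', hs'.trans hφ.2.2⟩
  simp only [gradient_coord]
  exact (hφ.1.fderiv_right (m := (⊤ : ℕ∞)) (by simp)).clm_apply contDiff_const

section
variable {Ω : Set (Eu n)} {σ : Eu n → Eu n} {φ f : Eu n → ℝ}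

lemma Bdd.integrable_mul_inner_gradient (h : Bdd Ω σ 1) (hφ : IsTest Ω φ)
    (hf : IntegrableOn f (tsupport φ)) :
    Integrable (fun x => f x * ⟪σ x, gradient φ x⟫) (volume.restrict Ω) := by
  have hg : Integrable (fun x => f x • gradient φ x) := by
    have h1 : IntegrableOn (fun x => f x • gradient φ x) (tsupport φ) :=
      hf.smul_continuousOn (continuous_gradient hφ.1).continuousOn hφ.2.1
    refine (integrableOn_iff_integrable_of_support_subset fun x hx => ?_).1 h1
    by_contra h
    exact hx (by simp [gradient_eq_zero_of_notMem h])
  have e : (fun x => f x * ⟪σ x, gradient φ x⟫) = fun x => ⟪σ x, f x • gradient φ x⟫ := by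
    ext x; rw [inner_smul_right]
  rw [e]
  refine hg.integrableOn.norm.mono' (h.1.inner hg.integrableOn.aestronglyMeasurable) ?_
  filter_upwards [h.2] with x hx
  exact (norm_inner_le_norm _ _).trans (mul_le_of_le_one_left (norm_nonneg _) hx)

lemma Bdd.abs_setIntegral_mul_inner_gradient_le (h : Bdd Ω σ 1) (hφ : IsTest Ω φ)
    (hf : IntegrableOn f (tsupport φ)) {C : ℝ} (hC : ∀ x, ‖gradient φ x‖ ≤ C) :
    |∫ x in Ω, f x * ⟪σ x, gradient φ x⟫| ≤ C * ∫ x in tsupport φ, |f x| := by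
  have hC0 : 0 ≤ C := (norm_nonneg _).trans (hC 0)
  have e : ∫ x in Ω, f x * ⟪σ x, gradient φ x⟫
      = ∫ x in tsupport φ, f x * ⟪σ x, gradient φ x⟫ := by
    have hz : ∀ x, x ∉ tsupport φ → f x * ⟪σ x, gradient φ x⟫ = 0 := fun x hx => by
      simp [gradient_eq_zero_of_notMem hx]
    rw [setIntegral_eq_of_tsupport hφ.2.2 hz,
      setIntegral_eq_integral_of_forall_compl_eq_zero hz]
  rw [e, ← integral_const_mul, ← Real.norm_eq_abs]
  refine norm_integral_le_of_norm_le (hf.abs.const_mul C) ?_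
  filter_upwards [ae_restrict_of_ae_restrict_of_subset hφ.2.2 h.2] with x hx
  rw [norm_mul, mul_comm, Real.norm_eq_abs, Real.norm_eq_abs]
  refine mul_le_mul_of_nonneg_right ?_ (abs_nonneg _)
  exact (abs_real_inner_le_norm _ _).trans
    ((mul_le_of_le_one_left (norm_nonneg _) hx).trans (hC x))

end

section
variable {Ω : Set (Eu n)} {σ : Eu n → Eu n} {σk : ℕ → Eu n → Eu n} {l : Filter ℕ}

lemma tendsto_setIntegral_mul_inner_gradient_of_smooth (hΩ : IsOpen Ω)
    (hk : ∀ k, Bdd Ω (σk k) 1) (hσ : Bdd Ω σ 1)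
    (hconv : ∀ φ, IsTest Ω φ → ∀ v, Tendsto (fun k => ∫ x in Ω, φ x * ⟪σk k x, v⟫) l
        (𝓝 (∫ x in Ω, φ x * ⟪σ x, v⟫)))
    {w φ : Eu n → ℝ} (hw : ContDiff ℝ (⊤ : ℕ∞) w) (hφ : IsTest Ω φ) :
    Tendsto (fun k => ∫ x in Ω, w x * ⟪σk k x, gradient φ x⟫) l
      (𝓝 (∫ x in Ω, w x * ⟪σ x, gradient φ x⟫)) := by
  have ht : ∀ i, IsTest Ω fun x => gradient φ x i * w x := fun i =>
    (hφ.coord_gradient i).mul_smooth hw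
  have e : ∀ s : Eu n → Eu n, Bdd Ω s 1 → ∫ x in Ω, w x * ⟪s x, gradient φ x⟫
      = ∑ i, ∫ x in Ω, (gradient φ x i * w x) * ⟪s x, stdVec i⟫ := by
    intro s hs
    rw [← integral_finsetSum _ fun i _ => hs.integrable_mul_inner hΩ (ht i) _]
    congr 1; ext x
    conv_lhs => rw [sum_stdVec (gradient φ x), inner_sum, Finset.mul_sum]
    refine Finset.sum_congr rfl fun i _ => ?_
    rw [inner_smul_right]; ring
  rw [e σ hσ]
  simp only [e _ (hk _)]
  exact tendsto_finsetSum _ fun i _ => hconv _ (ht i) _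

lemma tendsto_setIntegral_mul_inner_gradient (hΩ : IsOpen Ω)
    (hk : ∀ k, Bdd Ω (σk k) 1) (hσ : Bdd Ω σ 1)
    (hconv : ∀ φ, IsTest Ω φ → ∀ v, Tendsto (fun k => ∫ x in Ω, φ x * ⟪σk k x, v⟫) l
        (𝓝 (∫ x in Ω, φ x * ⟪σ x, v⟫)))
    {w φ : Eu n → ℝ} (hw : Measurable w) {M : ℝ} (hM : ∀ x, |w x| ≤ M) (hφ : IsTest Ω φ) :
    Tendsto (fun k => ∫ x in Ω, w x * ⟪σk k x, gradient φ x⟫) l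
      (𝓝 (∫ x in Ω, w x * ⟪σ x, gradient φ x⟫)) := by
  have hl := locallyIntegrable_of_bdd hw hM
  obtain ⟨C, hC0, hC⟩ := hφ.exists_bound_gradient
  have hK := hφ.2.1
  rw [Metric.tendsto_nhds]
  intro η hη
  obtain ⟨ε, hε⟩ := ((tendsto_integral_comp_moll hw hM continuous_id hK).eventually
    (gt_mem_nhds (show 0 < η / (3 * (C + 1)) by positivity))).exists
  simp only [id] at hε
  have hs := contDiff_moll ε hl
  have hwi : IntegrableOn w (tsupport φ) := hl.integrableOn_isCompact hK
  have hmi : IntegrableOn (moll ε w) (tsupport φ) := hs.continuous.continuousOn.integrableOn_compact hK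
  have hb : ∀ s : Eu n → Eu n, Bdd Ω s 1 →
      |(∫ x in Ω, moll ε w x * ⟪s x, gradient φ x⟫) - ∫ x in Ω, w x * ⟪s x, gradient φ x⟫|
        < η / 3 := by
    intro s hsb
    rw [← integral_sub (hsb.integrable_mul_inner_gradient hφ hmi)
      (hsb.integrable_mul_inner_gradient hφ hwi)]
    simp only [← sub_mul]
    refine (hsb.abs_setIntegral_mul_inner_gradient_le hφ (hmi.sub hwi) hC).trans_lt ?_
    rw [lt_div_iff₀ (by positivity)] at hε
    have h0 : 0 ≤ ∫ x in tsupport φ, |moll ε w x - w x| :=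
      integral_nonneg fun x => abs_nonneg _
    simp only [Pi.sub_apply]
    nlinarith
  have h1 := tendsto_setIntegral_mul_inner_gradient_of_smooth hΩ hk hσ hconv hs hφ
  filter_upwards [Metric.tendsto_nhds.1 h1 (η / 3) (by positivity)] with k hkη
  rw [Real.dist_eq] at hkη ⊢
  have a1 := abs_lt.1 (hb _ (hk k))
  have a2 := abs_lt.1 (hb _ hσ)
  have a3 := abs_lt.1 hkη
  exact abs_lt.2 ⟨by linarith [a1.2, a2.1, a3.1], by linarith [a1.1, a2.2, a3.2]⟩

end

/-- Weak* compactness for the vector fields calibrating super-1-harmonic functions. -/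
lemma exists_sigM_limit {Ω : Set (Eu n)} (hΩ : IsOpen Ω) {σk : ℕ → Eu n → Eu n}
    {μk : ℕ → Measure (Eu n)} (h : ∀ k, SigM Ω (σk k) (μk k)) :
    ∃ σ μ, SigM Ω σ μ ∧
      (∀ φ, IsTest Ω φ → Tendsto (fun k => ∫ x, φ x ∂μk k) (hyperfilter ℕ) (𝓝 (∫ x, φ x ∂μ))) ∧
      ∀ (w φ : Eu n → ℝ) (M : ℝ), Measurable w → (∀ x, |w x| ≤ M) → IsTest Ω φ →
        Tendsto (fun k => ∫ x in Ω, w x * ⟪σk k x, gradient φ x⟫) (hyperfilter ℕ)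
          (𝓝 (∫ x in Ω, w x * ⟪σ x, gradient φ x⟫)) := by
  obtain ⟨σ, hσ, hconv⟩ := exists_weakStar_limit hΩ fun k => (h k).bdd
  have hw : ∀ (w φ : Eu n → ℝ) (M : ℝ), Measurable w → (∀ x, |w x| ≤ M) → IsTest Ω φ →
      Tendsto (fun k => ∫ x in Ω, w x * ⟪σk k x, gradient φ x⟫) (hyperfilter ℕ)
        (𝓝 (∫ x in Ω, w x * ⟪σ x, gradient φ x⟫)) := fun w φ M hw hM hφ =>
    tendsto_setIntegral_mul_inner_gradient hΩ (fun k => (h k).bdd) hσ hconv hw hM hφ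
  have h1 : ∀ φ, IsTest Ω φ → Tendsto (fun k => ∫ x, φ x ∂μk k) (hyperfilter ℕ)
      (𝓝 (∫ x in Ω, ⟪σ x, gradient φ x⟫)) := by
    intro φ hφ
    have := hw (fun _ => 1) φ 1 measurable_const (by simp) hφ
    simp only [one_mul] at this
    exact this.congr fun k => by simpa using (h k).rep φ hφ
  have hi : ∀ φ, IsTest Ω φ → Integrable (fun x => ⟪σ x, gradient φ x⟫) (volume.restrict Ω) :=
    fun φ hφ => by
      simpa using hσ.integrable_mul_inner_gradient hφ (f := fun _ => 1)
        (continuous_const.continuousOn.integrableOn_compact hφ.2.1)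
  have hadd : ∀ φ ψ, IsTest Ω φ → IsTest Ω ψ →
      ∫ x in Ω, ⟪σ x, gradient (fun x => φ x + ψ x) x⟫
        = (∫ x in Ω, ⟪σ x, gradient φ x⟫) + ∫ x in Ω, ⟪σ x, gradient ψ x⟫ := by
    intro φ ψ hφ hψ
    rw [← integral_add (hi φ hφ) (hi ψ hψ)]
    simp only [gradient_add hφ.1 hψ.1, inner_add_right]
  have hP : PosFun Ω fun φ => ∫ x in Ω, ⟪σ x, gradient φ x⟫ := by
    refine ⟨fun φ hφ hφ0 => ?_, fun φ ψ hφ hψ _ _ => hadd φ ψ hφ hψ, fun c φ hc hφ _ => ?_⟩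
    · exact ge_of_tendsto (h1 φ hφ) (Eventually.of_forall fun k => integral_nonneg hφ0)
    · rw [← integral_const_mul]
      simp only [gradient_const_mul hφ.1, inner_smul_right]
  obtain ⟨μ, hμ, hμP⟩ := hP.exists_measure hΩ
  have hrep : ∀ φ, IsTest Ω φ → ∫ x in Ω, ⟪σ x, gradient φ x⟫ = ∫ x, φ x ∂μ := by
    intro φ hφ
    obtain ⟨χ, hχ, hχ0, hs⟩ := hφ.exists_sub_nonneg hΩ
    have a := hμP _ (hφ.add hχ) hs
    have b := hμP χ hχ hχ0
    rw [hadd φ χ hφ hχ, integral_add (hμ.integrable_test hφ) (hμ.integrable_test hχ)] at a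
    linarith
  refine ⟨σ, μ, ⟨hσ, fun φ hφ => by simpa using hrep φ hφ, hμ⟩, fun φ hφ => ?_, hw⟩
  rw [← hrep φ hφ]
  exact h1 φ hφ

lemma IsTest.exists_nhd {Ω : Set (Eu n)} (hΩ : IsOpen Ω) {φ : Eu n → ℝ} (hφ : IsTest Ω φ) :
    ∃ U K, IsOpen U ∧ IsCompact K ∧ U ⊆ K ∧ K ⊆ Ω ∧ IsTest U φ := by
  obtain ⟨K, hK, h1, h2⟩ := exists_compact_between hφ.2.1.isCompact hΩ hφ.2.2
  exact ⟨interior K, K, isOpen_interior, hK, interior_subset, h2, hφ.1, hφ.2.1, h1⟩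

lemma LocBddFun.exists_rep {Ω : Set (Eu n)} {u : Eu n → ℝ} (hu : LocBddFun Ω u)
    {K : Set (Eu n)} (hK : IsCompact K) (hKΩ : K ⊆ Ω) :
    ∃ (w : Eu n → ℝ) (M : ℝ), Measurable w ∧ (∀ x, |w x| ≤ M) ∧ ∀ᵐ x, x ∈ K → u x = w x := by
  obtain ⟨C, hC⟩ := hu.2 K hKΩ hK
  have hm : AEStronglyMeasurable u (volume.restrict K) := hu.1.mono_set hKΩ
  set M := max C 0
  refine ⟨fun x => max (-M) (min (hm.mk u x) M), M,
    measurable_const.max (hm.stronglyMeasurable_mk.measurable.min measurable_const),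
    fun x => ?_, ?_⟩
  · have h0 : 0 ≤ M := le_max_right _ _
    exact abs_le.2 ⟨le_max_left _ _, max_le (by linarith) (min_le_right _ _)⟩
  · rw [← ae_restrict_iff' hK.measurableSet]
    filter_upwards [hm.ae_eq_mk, hC] with x hx hxC
    have := abs_le.1 (hxC.trans (le_max_left C 0 : C ≤ M))
    rw [← hx, min_eq_left this.2, max_eq_right this.1]

lemma LocBddFun.integrableOn {Ω : Set (Eu n)} {u : Eu n → ℝ} (hu : LocBddFun Ω u)
    {K : Set (Eu n)} (hKΩ : K ⊆ Ω) (hK : IsCompact K) : IntegrableOn u K := by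
  obtain ⟨C, hC⟩ := hu.2 K hKΩ hK
  exact ⟨hu.1.mono_set hKΩ, HasFiniteIntegral.restrict_of_bounded C hK.measure_lt_top hC⟩

section restrict
variable {Ω U : Set (Eu n)} {μ : Measure (Eu n)}

lemma LocFinOn.restrict (hμ : LocFinOn Ω μ) (hU : IsOpen U) (hUΩ : U ⊆ Ω) :
    LocFinOn U (μ.restrict U) := by
  refine ⟨fun K hKU hK => (Measure.restrict_apply_le _ _).trans_lt (hμ.1 K (hKU.trans hUΩ) hK), ?_⟩
  rw [Measure.restrict_apply hU.measurableSet.compl]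
  simp

lemma IsTest.setIntegral_mul {φ : Eu n → ℝ} (hφ : IsTest U φ) (f : Eu n → ℝ) :
    ∫ x in U, φ x * f x ∂μ = ∫ x, φ x * f x ∂μ :=
  setIntegral_eq_integral_of_forall_compl_eq_zero fun x hx => by
    rw [image_eq_zero_of_notMem_tsupport fun h => hx (hφ.2.2 h), zero_mul]

lemma IsTest.setIntegral {φ : Eu n → ℝ} (hφ : IsTest U φ) : ∫ x in U, φ x ∂μ = ∫ x, φ x ∂μ := by
  simpa using hφ.setIntegral_mul (μ := μ) fun _ => 1

lemma SigM.restrict {σ : Eu n → Eu n} (h : SigM Ω σ μ) (hU : IsOpen U) (hUΩ : U ⊆ Ω) :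
    SigM U σ (μ.restrict U) where
  bdd := ⟨h.bdd.1.mono_set hUΩ, ae_restrict_of_ae_restrict_of_subset hUΩ h.bdd.2⟩
  rep φ hφ := by
    have hz : ∀ x, x ∉ tsupport φ → ⟪σ x, gradient φ x⟫ = 0 := fun x hx => by
      simp [gradient_eq_zero_of_notMem hx]
    rw [setIntegral_eq_of_tsupport hφ.2.2 hz, ← setIntegral_eq_of_tsupport (hφ.2.2.trans hUΩ) hz,
      h.rep φ (hφ.mono hUΩ), hφ.setIntegral]
  locFin := h.locFin.restrict hU hUΩ

end restrict

/-- Locally bounded functions whose variation measure is `ν`. -/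
structure BVl (Ω : Set (Eu n)) (u : Eu n → ℝ) (ν : Measure (Eu n)) : Prop where
  bdd : LocBddFun Ω u
  locFin : LocFinOn Ω ν
  tv : ∀ φ, IsTest Ω φ → (∀ x, 0 ≤ φ x) → TV u φ = ENNReal.ofReal (∫ x, φ x ∂ν)

lemma BVl.bvm {Ω U : Set (Eu n)} {u w : Eu n → ℝ} {ν : Measure (Eu n)} (h : BVl Ω u ν)
    (hU : IsOpen U) (hUΩ : U ⊆ Ω) (hw : Measurable w) {M : ℝ} (hM : ∀ x, |w x| ≤ M)
    (huw : ∀ᵐ x, x ∈ U → u x = w x) : BVm U w (ν.restrict U) where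
  meas := hw
  bdd := ⟨M, hM⟩
  locFin := h.locFin.restrict hU hUΩ
  tv φ hφ hφ0 := by
    rw [hφ.setIntegral, ← h.tv φ (hφ.mono hUΩ) hφ0]
    refine TV_congr ?_
    filter_upwards [huw] with x hx hxφ using (hx (hφ.2.2 hxφ)).symm

lemma integral_mul_upperRep_congr {U : Set (Eu n)} (hU : IsOpen U) {u w φ : Eu n → ℝ}
    {μ : Measure (Eu n)} (huw : ∀ᵐ x, x ∈ U → u x = w x) (hφ : IsTest U φ) :
    ∫ x, φ x * upperRep u x ∂μ = ∫ x in U, φ x * upperRep w x ∂μ := by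
  rw [← hφ.setIntegral_mul]
  refine setIntegral_congr_fun hU.measurableSet fun x hx => ?_
  obtain ⟨r, hr, hb⟩ := Metric.isOpen_iff.1 hU x hx
  rw [upperRep_congr hr]
  filter_upwards [huw] with y hy hyb using hy (hb hyb)

lemma integral_mul_upperRep_mono {Ω : Set (Eu n)} (hΩ : IsOpen Ω) {u v φ : Eu n → ℝ}
    {μ : Measure (Eu n)} (hμ : LocFinOn Ω μ) (hu : LocBddFun Ω u) (hv : LocBddFun Ω v)
    (huv : ∀ᵐ x ∂(volume.restrict Ω), u x ≤ v x) (hφ : IsTest Ω φ) (hφ0 : ∀ x, 0 ≤ φ x) :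
    ∫ x, φ x * upperRep u x ∂μ ≤ ∫ x, φ x * upperRep v x ∂μ := by
  obtain ⟨U, K, hU, hK, hUK, hKΩ, hφU⟩ := hφ.exists_nhd hΩ
  obtain ⟨w, M, hw, hM, huw⟩ := hu.exists_rep hK hKΩ
  obtain ⟨z, N, hz, hN, hvz⟩ := hv.exists_rep hK hKΩ
  have huw' : ∀ᵐ x, x ∈ U → u x = w x := by filter_upwards [huw] with x hx hxU using hx (hUK hxU)
  have hvz' : ∀ᵐ x, x ∈ U → v x = z x := by filter_upwards [hvz] with x hx hxU using hx (hUK hxU)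
  rw [integral_mul_upperRep_congr hU huw' hφU, integral_mul_upperRep_congr hU hvz' hφU]
  have hμU := hμ.restrict hU (hUK.trans hKΩ)
  refine setIntegral_mono_on (hμU.integrable_mul_upperRep hφU hw hM)
    (hμU.integrable_mul_upperRep hφU hz hN) hU.measurableSet fun x hx => ?_
  refine mul_le_mul_of_nonneg_left ?_ (hφ0 x)
  obtain ⟨r, hr, hb⟩ := Metric.isOpen_iff.1 hU x hx
  refine upperRep_mono (r := r) (M := M) ⟨hr, Eventually.of_forall fun y _ => hM y⟩
    (s := r) (M' := N) ⟨hr, Eventually.of_forall fun y _ => hN y⟩ ?_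
  filter_upwards [huw', hvz', (ae_restrict_iff' hΩ.measurableSet).1 huv] with y h1 h2 h3 hy
  rw [← h1 (hb hy), ← h2 (hb hy)]
  exact h3 (hKΩ (hUK (hb hy)))

lemma setIntegral_mul_inner_gradient_congr {Ω U V : Set (Eu n)} {σ : Eu n → Eu n}
    {u w φ : Eu n → ℝ} (huw : ∀ᵐ x, x ∈ U → u x = w x) (hφ : IsTest U φ) (hUΩ : U ⊆ Ω)
    (hUV : U ⊆ V) :
    ∫ x in Ω, u x * ⟪σ x, gradient φ x⟫ = ∫ x in V, w x * ⟪σ x, gradient φ x⟫ := by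
  have hz : ∀ x, x ∉ tsupport φ → ⟪σ x, gradient φ x⟫ = 0 := fun x hx => by
    simp [gradient_eq_zero_of_notMem hx]
  rw [setIntegral_eq_of_tsupport (hφ.2.2.trans hUΩ) fun x hx => by rw [hz x hx, mul_zero],
    setIntegral_eq_of_tsupport (hφ.2.2.trans hUV) fun x hx => by rw [hz x hx, mul_zero]]
  refine integral_congr_ae ?_
  filter_upwards [huw] with x hx
  by_cases h : x ∈ tsupport φ
  · rw [hx (hφ.2.2 h)]
  · rw [hz x h, mul_zero, mul_zero]

/-- The pairing of a divergence-measure field with a function of locally bounded variation is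
dominated by the variation measure. -/
lemma BVl.integral_upperRep_le {Ω : Set (Eu n)} (hΩ : IsOpen Ω) {u φ : Eu n → ℝ}
    {ν μ : Measure (Eu n)} {σ : Eu n → Eu n} (h : BVl Ω u ν) (hφ : IsTest Ω φ)
    (hφ0 : ∀ x, 0 ≤ φ x) (hσ : SigM Ω σ μ) :
    ∫ x, φ x * upperRep u x ∂μ ≤ (∫ x in Ω, u x * ⟪σ x, gradient φ x⟫) + ∫ x, φ x ∂ν := by
  obtain ⟨U, K, hU, hK, hUK, hKΩ, hφU⟩ := hφ.exists_nhd hΩ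
  obtain ⟨w, M, hw, hM, huw⟩ := h.bdd.exists_rep hK hKΩ
  have huw' : ∀ᵐ x, x ∈ U → u x = w x := by filter_upwards [huw] with x hx hxU using hx (hUK hxU)
  have hUΩ := hUK.trans hKΩ
  rw [integral_mul_upperRep_congr hU huw' hφU,
    setIntegral_mul_inner_gradient_congr huw' hφU hUΩ subset_rfl, ← hφU.setIntegral]
  exact (h.bvm hU hUΩ hw hM huw').integral_upperRep_le hU hφU hφ0 (hσ.restrict hU hUΩ)

lemma BVl.eventually_integral_upperRep_le {Ω : Set (Eu n)} (hΩ : IsOpen Ω) {u φ : Eu n → ℝ}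
    {ν μ : Measure (Eu n)} {σk : ℕ → Eu n → Eu n} {μk : ℕ → Measure (Eu n)} {l : Filter ℕ}
    (h : BVl Ω u ν) (hφ : IsTest Ω φ)
    (hφ0 : ∀ x, 0 ≤ φ x) (hσk : ∀ k, SigM Ω (σk k) (μk k)) (hμ : LocFinOn Ω μ)
    (hconv : ∀ ψ, IsTest Ω ψ → Tendsto (fun k => ∫ x, ψ x ∂μk k) l (𝓝 (∫ x, ψ x ∂μ)))
    {η : ℝ} (hη : 0 < η) :
    ∀ᶠ k in l, ∫ x, φ x * upperRep u x ∂μk k ≤ (∫ x, φ x * upperRep u x ∂μ) + η := by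
  obtain ⟨U, K, hU, hK, hUK, hKΩ, hφU⟩ := hφ.exists_nhd hΩ
  obtain ⟨w, M, hw, hM, huw⟩ := h.bdd.exists_rep hK hKΩ
  have huw' : ∀ᵐ x, x ∈ U → u x = w x := by filter_upwards [huw] with x hx hxU using hx (hUK hxU)
  have hUΩ := hUK.trans hKΩ
  simp only [integral_mul_upperRep_congr hU huw' hφU]
  refine (h.bvm hU hUΩ hw hM huw').eventually_integral_upperRep_le hU hφU hφ0
    (fun k => (hσk k).restrict hU hUΩ) (hμ.restrict hU hUΩ) (fun ψ hψ => ?_) hη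
  simp only [hψ.setIntegral]
  exact hconv ψ (hψ.mono hUΩ)

/-- Uniform approximation by test functions supported where `φ` does not vanish. -/
lemma exists_isTest_approx {φ : Eu n → ℝ} (hφ : Continuous φ) (hc : HasCompactSupport φ) {δ : ℝ}
    (hδ : 0 < δ) : ∃ ψ, IsTest {x | φ x ≠ 0} ψ ∧ ∀ x, |φ x - ψ x| ≤ δ := by
  have hδ2 : 0 < δ / 2 := by positivity
  set g : Eu n → ℝ := fun x => φ x - max (-(δ / 2)) (min (φ x) (δ / 2)) with hg
  have hgc : Continuous g := hφ.sub (continuous_const.max (hφ.min continuous_const))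
  have hcl : IsClosed {x | δ / 2 ≤ |φ x|} := isClosed_le continuous_const hφ.abs
  have hsub : {x | δ / 2 ≤ |φ x|} ⊆ {x | φ x ≠ 0} := fun x (hx : δ / 2 ≤ |φ x|) h => by
    rw [h, abs_zero] at hx; linarith
  have hK : IsCompact {x | δ / 2 ≤ |φ x|} :=
    hc.isCompact.of_isClosed_subset hcl (hsub.trans subset_closure)
  have hs : tsupport g ⊆ {x | δ / 2 ≤ |φ x|} := by
    refine closure_minimal (fun x hx => ?_) hcl
    by_contra h
    have h' := abs_lt.1 (not_le.1 (show ¬ δ / 2 ≤ |φ x| from h))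
    exact hx (by simp [hg, min_eq_left h'.2.le, max_eq_right h'.1.le])
  have hgs : HasCompactSupport g := hK.of_isClosed_subset (isClosed_tsupport _) hs
  obtain ⟨_, -, -, -, -, hev⟩ := exists_cutoff_moll (isOpen_ne_fun hφ continuous_const) hK hsub
  obtain ⟨ε, h1, h2⟩ := (hev.and (moll_uniform hgc hgs hδ2)).exists
  refine ⟨moll ε g, (h1 g hgc hs).1, fun x => ?_⟩
  have h3 : |φ x - g x| ≤ δ / 2 := by
    have : φ x - g x = max (-(δ / 2)) (min (φ x) (δ / 2)) := by simp only [hg]; ring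
    rw [this]
    exact abs_le.2 ⟨le_max_left _ _, max_le (by linarith) (min_le_right _ _)⟩
  have h4 := abs_le.1 (h2 x)
  have h5 := abs_le.1 h3
  exact abs_le.2 ⟨by linarith [h4.2, h5.1], by linarith [h4.1, h5.2]⟩

lemma HasGradMeasure.norm_integral_sub_le {Ω : Set (Eu n)} (hΩ : IsOpen Ω) {u : Eu n → ℝ}
    {ν : Measure (Eu n)} {θ : Eu n → Eu n} (hu : ∀ K ⊆ Ω, IsCompact K → IntegrableOn u K)
    (hν : LocFinOn Ω ν) (h : HasGradMeasure Ω u ν θ) {φ ψ : Eu n → ℝ} (hφ : Continuous φ)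
    (hc : HasCompactSupport φ) (hs : tsupport φ ⊆ Ω) (hψ : IsTest {x | φ x ≠ 0} ψ) {δ : ℝ}
    (hδ : ∀ x, |φ x - ψ x| ≤ δ) :
    ‖(∫ x, φ x • θ x ∂ν) - ∫ x, ψ x • θ x ∂ν‖ ≤ δ * (ν (tsupport φ)).toReal := by
  have hδ0 : 0 ≤ δ := (abs_nonneg _).trans (hδ 0)
  have hψΩ : IsTest Ω ψ := hψ.mono (subset_closure.trans hs)
  by_cases hm : AEStronglyMeasurable (fun x => φ x • θ x) ν
  · have hψm : AEStronglyMeasurable (fun x => ψ x • θ x) ν := by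
      have h1 : AEStronglyMeasurable (fun x => (ψ x / φ x) • (φ x • θ x)) ν :=
        ((hψ.1.continuous.measurable.div hφ.measurable).aestronglyMeasurable).smul hm
      refine h1.congr (Eventually.of_forall fun x => ?_)
      by_cases hx : φ x = 0
      · have : ψ x = 0 := image_eq_zero_of_notMem_tsupport fun hx' => hψ.2.2 hx' hx
        simp [hx, this]
      · simp only [smul_smul, div_mul_cancel₀ _ hx]
    have i1 := integrable_smul_polar h.1 (hν.integrable hφ hc hs) hm
    have i2 := integrable_smul_polar h.1 (hν.integrable_test hψΩ) hψm
    rw [← integral_sub i1 i2]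
    have hz : ∀ x, x ∉ tsupport φ → φ x • θ x - ψ x • θ x = 0 := fun x hx => by
      have h1 : φ x = 0 := image_eq_zero_of_notMem_tsupport hx
      have h2 : ψ x = 0 := image_eq_zero_of_notMem_tsupport fun hx' => hψ.2.2 hx' h1
      simp [h1, h2]
    rw [← setIntegral_eq_integral_of_forall_compl_eq_zero hz]
    refine norm_setIntegral_le_of_norm_le_const_ae' (hν.1 _ hs hc) ?_
    filter_upwards [h.1] with x hx _
    rw [← sub_smul, norm_smul, hx, mul_one]
    exact hδ x
  · obtain ⟨χ, hχ, -, -, V, -, hKV, -, hχV⟩ := exists_cutoff hΩ hc.isCompact hs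
    have hχm : ¬ AEStronglyMeasurable (fun x => χ x • θ x) ν := fun h1 => by
      refine hm ((hφ.aestronglyMeasurable.smul h1).congr (Eventually.of_forall fun x => ?_))
      by_cases hx : x ∈ tsupport φ
      · simp [hχV x (hKV hx)]
      · simp [image_eq_zero_of_notMem_tsupport hx]
    have h2 := h.eq_zero_of_not_measurable hu hχ hχm hψΩ
    rw [h.2.2 ψ hψΩ, neg_eq_zero] at h2
    rw [integral_undef fun hi => hm hi.1, h2, sub_zero, norm_zero]
    positivity

/-- Weak* convergence of gradient measures from `L¹_loc` convergence and local bounds. -/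
lemma tendsto_integral_smul_polar {Ω : Set (Eu n)} (hΩ : IsOpen Ω) {u : Eu n → ℝ}
    {uk : ℕ → Eu n → ℝ} {ν : Measure (Eu n)} {θ : Eu n → Eu n} {νk : ℕ → Measure (Eu n)}
    {θk : ℕ → Eu n → Eu n}
    (hu : ∀ K ⊆ Ω, IsCompact K → IntegrableOn u K)
    (huk : ∀ k, ∀ K ⊆ Ω, IsCompact K → IntegrableOn (uk k) K)
    (hν : LocFinOn Ω ν) (h : HasGradMeasure Ω u ν θ) (hνk : ∀ k, LocFinOn Ω (νk k))
    (hk : ∀ k, HasGradMeasure Ω (uk k) (νk k) (θk k))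
    (hbdd : ∀ K ⊆ Ω, IsCompact K → ∃ C : ℝ, ∀ k, νk k K ≤ ENNReal.ofReal C)
    (hlim : ∀ K ⊆ Ω, IsCompact K → Tendsto (fun k => ∫ x in K, |uk k x - u x|) atTop (𝓝 0))
    {φ : Eu n → ℝ} (hφ : Continuous φ) (hc : HasCompactSupport φ) (hs : tsupport φ ⊆ Ω) :
    Tendsto (fun k => ∫ x, φ x • θk k x ∂(νk k)) atTop (𝓝 (∫ x, φ x • θ x ∂ν)) := by
  obtain ⟨C₀, hC₀⟩ := hbdd _ hs hc
  obtain ⟨C, hC0, hCk, hCν⟩ : ∃ C : ℝ, 0 ≤ C ∧ (∀ k, (νk k (tsupport φ)).toReal ≤ C) ∧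
      (ν (tsupport φ)).toReal ≤ C := by
    refine ⟨max (max C₀ 0) (ν (tsupport φ)).toReal, le_max_of_le_left (le_max_right _ _),
      fun k => le_max_of_le_left ?_, le_max_right _ _⟩
    have := ENNReal.toReal_mono ENNReal.ofReal_ne_top (hC₀ k)
    rwa [ENNReal.toReal_ofReal'] at this
  have htest : ∀ ψ, IsTest Ω ψ →
      Tendsto (fun k => ∫ x, ψ x • θk k x ∂(νk k)) atTop (𝓝 (∫ x, ψ x • θ x ∂ν)) := by
    intro ψ hψ
    obtain ⟨D, hD0, hD⟩ := hψ.exists_bound_gradient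
    have e : ∀ k, ‖(∫ x, ψ x • θk k x ∂(νk k)) - ∫ x, ψ x • θ x ∂ν‖
        ≤ D * ∫ x in tsupport ψ, |uk k x - u x| := by
      intro k
      have h1 := (hk k).2.2 ψ hψ
      have h2 := h.2.2 ψ hψ
      have h3 : (∫ x, ψ x • θk k x ∂(νk k)) - ∫ x, ψ x • θ x ∂ν
          = (∫ x in Ω, u x • gradient ψ x) - ∫ x in Ω, uk k x • gradient ψ x := by
        rw [h1, h2]; abel
      have hz : ∀ v : Eu n → ℝ, ∀ x, x ∉ tsupport ψ → v x • gradient ψ x = 0 := fun v x hx => by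
        simp [gradient_eq_zero_of_notMem hx]
      rw [h3, setIntegral_eq_of_tsupport hψ.2.2 (hz _), setIntegral_eq_of_tsupport hψ.2.2 (hz _),
        norm_sub_rev, ← integral_sub (integrable_smul_gradient (huk k) hψ)
          (integrable_smul_gradient hu hψ)]
      simp only [← sub_smul]
      rw [← setIntegral_eq_integral_of_forall_compl_eq_zero (hz fun x => uk k x - u x),
        ← integral_const_mul]
      refine norm_integral_le_of_norm_le
        (((huk k _ hψ.2.2 hψ.2.1).sub (hu _ hψ.2.2 hψ.2.1)).abs.const_mul D)
        (Eventually.of_forall fun x => ?_)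
      rw [norm_smul, mul_comm]
      exact mul_le_mul_of_nonneg_right (hD x) (norm_nonneg _)
    rw [tendsto_iff_norm_sub_tendsto_zero]
    refine squeeze_zero (fun _ => norm_nonneg _) e ?_
    simpa using (hlim _ hψ.2.2 hψ.2.1).const_mul D
  rw [Metric.tendsto_nhds]
  intro η hη
  obtain ⟨ψ, hψ, hδ⟩ := exists_isTest_approx hφ hc (show 0 < η / (3 * (C + 1)) by positivity)
  have hψΩ : IsTest Ω ψ := hψ.mono (subset_closure.trans hs)
  have hsmall : ∀ t : ℝ, t ≤ C → η / (3 * (C + 1)) * t < η / 3 := fun t ht => by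
    rw [div_mul_eq_mul_div, div_lt_div_iff₀ (by positivity) (by positivity)]
    nlinarith
  filter_upwards [Metric.tendsto_nhds.1 (htest ψ hψΩ) (η / 3) (by positivity)] with k hkη
  have a1 := ((hk k).norm_integral_sub_le hΩ (huk k) (hνk k) hφ hc hs hψ hδ).trans_lt
    (hsmall _ (hCk k))
  have a2 := (h.norm_integral_sub_le hΩ hu hν hφ hc hs hψ hδ).trans_lt (hsmall _ hCν)
  rw [← dist_eq_norm] at a1 a2
  rw [dist_comm] at a2
  have t1 := dist_triangle4 (∫ x, φ x • θk k x ∂(νk k)) (∫ x, ψ x • θk k x ∂(νk k))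
    (∫ x, ψ x • θ x ∂ν) (∫ x, φ x • θ x ∂ν)
  linarith

lemma LocBddFun.locallyIntegrableOn {Ω : Set (Eu n)} (hΩ : IsOpen Ω) {u : Eu n → ℝ}
    (hu : LocBddFun Ω u) : LocallyIntegrableOn u Ω :=
  (locallyIntegrableOn_iff hΩ.isLocallyClosed).2 fun _ hKΩ hK => hu.integrableOn hKΩ hK

section limit
variable {Ω : Set (Eu n)} {uk : ℕ → Eu n → ℝ} {u : Eu n → ℝ}

lemma ae_le_of_monotone_tendsto
    (hmono : ∀ k, ∀ᵐ x ∂(volume.restrict Ω), uk k x ≤ uk (k + 1) x)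
    (hlim : ∀ᵐ x ∂(volume.restrict Ω), Tendsto (fun k => uk k x) atTop (𝓝 (u x))) (k : ℕ) :
    ∀ᵐ x ∂(volume.restrict Ω), uk k x ≤ u x := by
  filter_upwards [ae_all_iff.2 hmono, hlim] with x h1 h2
  exact (monotone_nat_of_le_succ h1).ge_of_tendsto h2 k

lemma ae_abs_le_of_tendsto {K : Set (Eu n)} {C : ℝ} (hKΩ : K ⊆ Ω)
    (hC : ∀ k, ∀ᵐ x ∂(volume.restrict K), |uk k x| ≤ C)
    (hlim : ∀ᵐ x ∂(volume.restrict Ω), Tendsto (fun k => uk k x) atTop (𝓝 (u x))) :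
    ∀ᵐ x ∂(volume.restrict K), |u x| ≤ C := by
  filter_upwards [ae_all_iff.2 hC, ae_restrict_of_ae_restrict_of_subset hKΩ hlim] with x h1 h2
  exact le_of_tendsto h2.abs (Eventually.of_forall h1)

lemma tendsto_setIntegral_abs_sub
    (huk : ∀ k, LocBddFun Ω (uk k)) (hu : LocBddFun Ω u)
    (hbdd : ∀ K : Set (Eu n), K ⊆ Ω → IsCompact K → ∃ C : ℝ,
      ∀ k, ∀ᵐ x ∂(volume.restrict K), |uk k x| ≤ C)
    (hlim : ∀ᵐ x ∂(volume.restrict Ω), Tendsto (fun k => uk k x) atTop (𝓝 (u x)))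
    {K : Set (Eu n)} (hKΩ : K ⊆ Ω) (hK : IsCompact K) :
    Tendsto (fun k => ∫ x in K, |uk k x - u x|) atTop (𝓝 0) := by
  obtain ⟨C, hC⟩ := hbdd K hKΩ hK
  have h0 : Tendsto (fun k => ∫ x in K, |uk k x - u x|) atTop (𝓝 (∫ _x in K, (0 : ℝ))) := by
    have hKf : IsFiniteMeasure ((volume : Measure (Eu n)).restrict K) :=
      ⟨by simpa using hK.measure_lt_top⟩
    refine tendsto_integral_of_dominated_convergence (fun _ => C + C)
      (fun k => (((huk k).1.mono_set hKΩ).sub (hu.1.mono_set hKΩ)).norm)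
      (integrable_const _) (fun k => ?_) ?_
    · filter_upwards [hC k, ae_abs_le_of_tendsto hKΩ hC hlim] with x h1 h2
      rw [Real.norm_eq_abs, abs_abs]
      exact (abs_sub _ _).trans (add_le_add h1 h2)
    · filter_upwards [ae_restrict_of_ae_restrict_of_subset hKΩ hlim] with x hx
      simpa using (hx.sub_const (u x)).abs
  simpa using h0

lemma tendsto_setIntegral_mul (huk : ∀ k, LocBddFun Ω (uk k))
    (hbdd : ∀ K : Set (Eu n), K ⊆ Ω → IsCompact K → ∃ C : ℝ,
      ∀ k, ∀ᵐ x ∂(volume.restrict K), |uk k x| ≤ C)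
    (hlim : ∀ᵐ x ∂(volume.restrict Ω), Tendsto (fun k => uk k x) atTop (𝓝 (u x)))
    {g : Eu n → ℝ} (hg : Integrable g (volume.restrict Ω)) (hgc : HasCompactSupport g)
    (hgs : tsupport g ⊆ Ω) :
    Tendsto (fun k => ∫ x in Ω, uk k x * g x) atTop (𝓝 (∫ x in Ω, u x * g x)) := by
  obtain ⟨C, hC⟩ := hbdd _ hgs hgc
  refine tendsto_integral_of_dominated_convergence (fun x => C * |g x|)
    (fun k => (huk k).1.mul hg.1) (hg.abs.const_mul C) (fun k => ?_) ?_
  · refine ae_restrict_of_ae ?_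
    filter_upwards [(ae_restrict_iff' hgc.isCompact.measurableSet).1 (hC k)] with x hx
    rw [norm_mul, Real.norm_eq_abs, Real.norm_eq_abs]
    by_cases h : x ∈ tsupport g
    · exact mul_le_mul_of_nonneg_right (hx h) (abs_nonneg _)
    · simp [image_eq_zero_of_notMem_tsupport h]
  · filter_upwards [hlim] with x hx using hx.mul_const _

lemma LocFinOn.integral_le_mul {ν : Measure (Eu n)} (hν : LocFinOn Ω ν) {φ : Eu n → ℝ}
    (hφ : IsTest Ω φ) {M : ℝ} (hM : ∀ x, |φ x| ≤ M) :
    ∫ x, φ x ∂ν ≤ M * (ν (tsupport φ)).toReal := by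
  rw [← setIntegral_eq_integral_of_forall_compl_eq_zero
    fun x (hx : x ∉ tsupport φ) => image_eq_zero_of_notMem_tsupport hx]
  exact (Real.le_norm_self _).trans
    (norm_setIntegral_le_of_norm_le_const (hν.1 _ hφ.2.2 hφ.2.1) fun x _ => hM x)

/-- Limits in `L¹_loc` of functions with locally bounded variations have locally bounded
variation. -/
lemma finTV_of_tendsto {νk : ℕ → Measure (Eu n)} {θk : ℕ → Eu n → Eu n}
    (huk : ∀ k, ∀ K ⊆ Ω, IsCompact K → IntegrableOn (uk k) K)
    (hu : ∀ K ⊆ Ω, IsCompact K → IntegrableOn u K)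
    (hνk : ∀ k, LocFinOn Ω (νk k)) (hk : ∀ k, HasGradMeasure Ω (uk k) (νk k) (θk k))
    (hbdd : ∀ K ⊆ Ω, IsCompact K → ∃ C : ℝ, ∀ k, νk k K ≤ ENNReal.ofReal C)
    (hlim : ∀ K ⊆ Ω, IsCompact K → Tendsto (fun k => ∫ x in K, |uk k x - u x|) atTop (𝓝 0)) :
    FinTV Ω u := by
  refine ⟨hu, fun φ hφ hφ0 htop => ?_⟩
  obtain ⟨C, hC⟩ := hbdd _ hφ.2.2 hφ.2.1
  obtain ⟨M, hM0, hM⟩ := hφ.exists_bound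
  obtain ⟨k, hlt⟩ := (TV_lsc hφ.2.1 (hu _ hφ.2.2 hφ.2.1)
    (Eventually.of_forall fun k => huk k _ hφ.2.2 hφ.2.1) (hlim _ hφ.2.2 hφ.2.1)
    (c := ENNReal.ofReal (M * max C 0)) (by rw [htop]; exact ENNReal.ofReal_lt_top)).exists
  refine absurd ((TV_le_of_hasGradMeasure (huk k) (hνk k) (hk k) hφ hφ0).trans
    (ENNReal.ofReal_le_ofReal ?_)) (not_le.2 hlt)
  refine ((hνk k).integral_le_mul hφ hM).trans (mul_le_mul_of_nonneg_left ?_ hM0)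
  have := ENNReal.toReal_mono ENNReal.ofReal_ne_top (hC k)
  rwa [ENNReal.toReal_ofReal'] at this

/-- The variation of a limit of super-1-harmonic functions is dominated by its pairing with the
limit field. -/
lemma BVl.integral_le_of_tendsto (hΩ : IsOpen Ω) {ν : Measure (Eu n)} (h : BVl Ω u ν)
    (huk : ∀ k, LocBddFun Ω (uk k)) (hle : ∀ k, ∀ᵐ x ∂(volume.restrict Ω), uk k x ≤ u x)
    (hlim : ∀ K ⊆ Ω, IsCompact K → Tendsto (fun k => ∫ x in K, |uk k x - u x|) atTop (𝓝 0))
    {νk : ℕ → Measure (Eu n)} {θk : ℕ → Eu n → Eu n}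
    (hνk : ∀ k, LocFinOn Ω (νk k)) (hk : ∀ k, HasGradMeasure Ω (uk k) (νk k) (θk k))
    {σk : ℕ → Eu n → Eu n} {μk : ℕ → Measure (Eu n)} (hσk : ∀ k, SigM Ω (σk k) (μk k))
    (heq : ∀ k, ∀ φ : Eu n → ℝ, IsTest Ω φ →
        (- ∫ x in Ω, uk k x * ⟪σk k x, gradient φ x⟫) + (∫ x, φ x * upperRep (uk k) x ∂μk k)
          = ∫ x, φ x ∂νk k)
    {σ : Eu n → Eu n} {μ : Measure (Eu n)} (hμ : LocFinOn Ω μ)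
    (hμk : ∀ φ, IsTest Ω φ →
      Tendsto (fun k => ∫ x, φ x ∂μk k) (hyperfilter ℕ) (𝓝 (∫ x, φ x ∂μ)))
    (hpair : ∀ (w φ : Eu n → ℝ) (M : ℝ), Measurable w → (∀ x, |w x| ≤ M) → IsTest Ω φ →
      Tendsto (fun k => ∫ x in Ω, w x * ⟪σk k x, gradient φ x⟫) (hyperfilter ℕ)
        (𝓝 (∫ x in Ω, w x * ⟪σ x, gradient φ x⟫)))
    {φ : Eu n → ℝ} (hφ : IsTest Ω φ) (hφ0 : ∀ x, 0 ≤ φ x) :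
    ∫ x, φ x ∂ν ≤ (- ∫ x in Ω, u x * ⟪σ x, gradient φ x⟫) + ∫ x, φ x * upperRep u x ∂μ := by
  have hK := hφ.2.1
  have hKΩ := hφ.2.2
  have hup : Tendsto (fun k => ∫ x in Ω, uk k x * ⟪σk k x, gradient φ x⟫) (hyperfilter ℕ)
      (𝓝 (∫ x in Ω, u x * ⟪σ x, gradient φ x⟫)) := by
    obtain ⟨U, K, hU, hKc, hUK, hKΩ', hφU⟩ := hφ.exists_nhd hΩ
    obtain ⟨w, M, hw, hM, huw⟩ := h.bdd.exists_rep hKc hKΩ'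
    have huw' : ∀ᵐ x, x ∈ U → u x = w x := by
      filter_upwards [huw] with x hx hxU using hx (hUK hxU)
    have hUΩ := hUK.trans hKΩ'
    have h1 := hpair w φ M hw hM hφ
    simp only [← setIntegral_mul_inner_gradient_congr huw' hφU hUΩ hUΩ] at h1
    obtain ⟨C, hC0, hC⟩ := hφ.exists_bound_gradient
    have h2 : Tendsto (fun k => ∫ x in Ω, (uk k x - u x) * ⟪σk k x, gradient φ x⟫)
        (hyperfilter ℕ) (𝓝 0) := by
      have h3 := ((hlim _ hKΩ hK).mono_left Nat.hyperfilter_le_atTop).const_mul C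
      rw [mul_zero] at h3
      exact squeeze_zero_norm (fun k => (hσk k).bdd.abs_setIntegral_mul_inner_gradient_le hφ
        (((huk k).integrableOn hKΩ hK).sub (h.bdd.integrableOn hKΩ hK)) hC) h3
    have h4 := h2.add h1
    rw [zero_add] at h4
    refine h4.congr fun k => ?_
    rw [← integral_add ((hσk k).bdd.integrable_mul_inner_gradient hφ
        (f := fun x => uk k x - u x) (((huk k).integrableOn hKΩ hK).sub (h.bdd.integrableOn hKΩ hK)))
      ((hσk k).bdd.integrable_mul_inner_gradient hφ (h.bdd.integrableOn hKΩ hK))]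
    congr 1; ext x
    ring
  refine le_of_forall_lt_imp_le_of_dense fun c hc => ?_
  by_contra! hcon
  set B := (- ∫ x in Ω, u x * ⟪σ x, gradient φ x⟫) + ∫ x, φ x * upperRep u x ∂μ
  have hη : 0 < (c - B) / 3 := by linarith
  have hνpos : 0 ≤ ∫ x, φ x ∂ν := integral_nonneg hφ0
  have htv : ENNReal.ofReal c < TV u φ ∨ c < 0 := by
    rcases lt_or_ge c 0 with h0 | h0
    · exact Or.inr h0
    · left
      rw [h.tv φ hφ hφ0]
      exact (ENNReal.ofReal_lt_ofReal_iff_of_nonneg h0).2 hc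
  have hev : ∀ᶠ k in (hyperfilter ℕ : Filter ℕ), c ≤ ∫ x, φ x ∂νk k := by
    rcases htv with h1 | h1
    · filter_upwards [Nat.hyperfilter_le_atTop (TV_lsc hK (h.bdd.integrableOn hKΩ hK)
        (Eventually.of_forall fun k => (huk k).integrableOn hKΩ hK) (hlim _ hKΩ hK) h1)] with k hk1
      have h2 := hk1.trans_le (TV_le_of_hasGradMeasure
        (fun K h1 h2 => (huk k).integrableOn h1 h2) (hνk k) (hk k) hφ hφ0)
      exact ((ENNReal.ofReal_lt_ofReal_iff').1 h2).1.le
    · exact Eventually.of_forall fun k => h1.le.trans (integral_nonneg hφ0)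
  obtain ⟨k, h1, h2, h3⟩ := (hev.and ((Metric.tendsto_nhds.1 hup _ hη).and
    (h.eventually_integral_upperRep_le hΩ hφ hφ0 hσk hμ hμk hη))).exists
  rw [← heq k φ hφ] at h1
  rw [Real.dist_eq] at h2
  have h4 := (abs_lt.1 h2).1
  have h5 := integral_mul_upperRep_mono hΩ (hσk k).locFin (huk k) h.bdd (hle k) hφ hφ0
  have hB : B = (- ∫ x in Ω, u x * ⟪σ x, gradient φ x⟫) + ∫ x, φ x * upperRep u x ∂μ := rfl
  linarith

end limit

/-- An identity for nonnegative test functions extends to signed test functions. -/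
lemma BVl.pairing_eq {Ω : Set (Eu n)} (hΩ : IsOpen Ω) {u : Eu n → ℝ} {ν μ : Measure (Eu n)}
    {σ : Eu n → Eu n} (h : BVl Ω u ν) (hσ : SigM Ω σ μ)
    (heq : ∀ φ, IsTest Ω φ → (∀ x, 0 ≤ φ x) →
      (- ∫ x in Ω, u x * ⟪σ x, gradient φ x⟫) + (∫ x, φ x * upperRep u x ∂μ) = ∫ x, φ x ∂ν)
    {φ : Eu n → ℝ} (hφ : IsTest Ω φ) :
    (- ∫ x in Ω, u x * ⟪σ x, gradient φ x⟫) + (∫ x, φ x * upperRep u x ∂μ) = ∫ x, φ x ∂ν := by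
  have hi : ∀ φ, IsTest Ω φ → Integrable (fun x => φ x * upperRep u x) μ := by
    intro φ hφ
    obtain ⟨U, K, hU, hK, hUK, hKΩ, hφU⟩ := hφ.exists_nhd hΩ
    obtain ⟨w, M, hw, hM, huw⟩ := h.bdd.exists_rep hK hKΩ
    have h1 := (hσ.locFin.restrict hU (hUK.trans hKΩ)).integrable_mul_upperRep hφU hw hM
    have h2 : IntegrableOn (fun x => φ x * upperRep u x) U μ := by
      refine IntegrableOn.congr_fun h1 (fun x hx => ?_) hU.measurableSet
      obtain ⟨r, hr, hb⟩ := Metric.isOpen_iff.1 hU x hx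
      rw [upperRep_congr hr]
      filter_upwards [huw] with y hy hyb using (hy (hUK (hb hyb))).symm
    refine (integrableOn_iff_integrable_of_support_subset fun x hx => ?_).1 h2
    by_contra hxU
    exact hx (by simp [image_eq_zero_of_notMem_tsupport fun h => hxU (hφU.2.2 h)])
  have hj : ∀ φ, IsTest Ω φ →
      Integrable (fun x => u x * ⟪σ x, gradient φ x⟫) (volume.restrict Ω) := fun φ hφ =>
    hσ.bdd.integrable_mul_inner_gradient hφ (h.bdd.integrableOn hφ.2.2 hφ.2.1)
  obtain ⟨χ, hχ, hχ0, hs⟩ := hφ.exists_sub_nonneg hΩ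
  have a := heq _ (hφ.add hχ) hs
  have b := heq χ hχ hχ0
  simp only [gradient_add hφ.1 hχ.1, inner_add_right, mul_add, add_mul] at a
  rw [integral_add (hj φ hφ) (hj χ hχ), integral_add (hi φ hφ) (hi χ hχ),
    integral_add (h.locFin.integrable_test hφ) (h.locFin.integrable_test hχ)] at a
  linarith

end

/-- increasing sequences of super-1-harmonic functions: if `u_k` is
an increasing sequence of weakly super-1-harmonic functions on `Ω`, bounded in
`BV_loc(Ω)` and `L^∞_loc(Ω)` (with gradient measures `Du_k = θ_k ν_k`), converging
pointwise a.e. to `u`, then `u ∈ BV_loc(Ω) ∩ L^∞_loc(Ω)`, `u_k → u` locally weakly* in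
`BV_loc(Ω)` and `L^∞_loc(Ω)` with `u_k ≤ u` a.e., and `u` is weakly super-1-harmonic. -/
theorem stmt18 {n : ℕ} (Ω : Set (Eu n)) (hΩ : IsOpen Ω)
    (uk : ℕ → Eu n → ℝ) (u : Eu n → ℝ)
    (hsup : ∀ k, SuperOneHarmonic Ω (uk k))
    (hmono : ∀ k, ∀ᵐ x ∂(volume.restrict Ω), uk k x ≤ uk (k + 1) x)
    (νk : ℕ → Measure (Eu n)) (θk : ℕ → Eu n → Eu n)
    (hgradk : ∀ k, LocFinOn Ω (νk k) ∧ HasGradMeasure Ω (uk k) (νk k) (θk k))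
    -- boundedness in `BV_loc(Ω)` and `L^∞_loc(Ω)`
    (hbddBV : ∀ K : Set (Eu n), K ⊆ Ω → IsCompact K → ∃ C : ℝ,
      ∀ k, (∫ x in K, |uk k x|) ≤ C ∧ νk k K ≤ ENNReal.ofReal C)
    (hbddInf : ∀ K : Set (Eu n), K ⊆ Ω → IsCompact K → ∃ C : ℝ,
      ∀ k, ∀ᵐ x ∂(volume.restrict K), |uk k x| ≤ C)
    -- pointwise a.e. convergence to the limit `u`
    (hlim : ∀ᵐ x ∂(volume.restrict Ω), Tendsto (fun k => uk k x) atTop (𝓝 (u x)))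
    (humeas : AEStronglyMeasurable u (volume.restrict Ω)) :
    MemBVLoc Ω u ∧ LocBddFun Ω u ∧
    (∀ K : Set (Eu n), K ⊆ Ω → IsCompact K →
      Tendsto (fun k => ∫ x in K, |uk k x - u x|) atTop (𝓝 0)) ∧
    (∀ g : Eu n → ℝ, Integrable g (volume.restrict Ω) → HasCompactSupport g →
      tsupport g ⊆ Ω →
      Tendsto (fun k => ∫ x in Ω, uk k x * g x) atTop (𝓝 (∫ x in Ω, u x * g x))) ∧
    (∃ ν θ, LocFinOn Ω ν ∧ HasGradMeasure Ω u ν θ ∧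
      ∀ φ : Eu n → ℝ, Continuous φ → HasCompactSupport φ → tsupport φ ⊆ Ω →
        Tendsto (fun k => ∫ x, φ x • θk k x ∂(νk k)) atTop (𝓝 (∫ x, φ x • θ x ∂ν))) ∧
    (∀ k, ∀ᵐ x ∂(volume.restrict Ω), uk k x ≤ u x) ∧
    SuperOneHarmonic Ω u := by
  have huk : ∀ k, LocBddFun Ω (uk k) := fun k => (hsup k).2.1
  have hle := ae_le_of_monotone_tendsto hmono hlim
  have hu : LocBddFun Ω u := ⟨humeas, fun K hKΩ hK => by
    obtain ⟨C, hC⟩ := hbddInf K hKΩ hK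
    exact ⟨C, ae_abs_le_of_tendsto hKΩ hC hlim⟩⟩
  have hL1 : ∀ K : Set (Eu n), K ⊆ Ω → IsCompact K →
      Tendsto (fun k => ∫ x in K, |uk k x - u x|) atTop (𝓝 0) := fun K hKΩ hK =>
    tendsto_setIntegral_abs_sub huk hu hbddInf hlim hKΩ hK
  have hui : ∀ K ⊆ Ω, IsCompact K → IntegrableOn u K := fun K h1 h2 => hu.integrableOn h1 h2
  have huki : ∀ k, ∀ K ⊆ Ω, IsCompact K → IntegrableOn (uk k) K := fun k K h1 h2 =>
    (huk k).integrableOn h1 h2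
  have hνb : ∀ K ⊆ Ω, IsCompact K → ∃ C : ℝ, ∀ k, νk k K ≤ ENNReal.ofReal C :=
    fun K h1 h2 => (hbddBV K h1 h2).imp fun C hC k => (hC k).2
  have hfin : FinTV Ω u := finTV_of_tendsto huki hui (fun k => (hgradk k).1)
    (fun k => (hgradk k).2) hνb hL1
  obtain ⟨ν, hν, htv⟩ := hfin.exists_measure hΩ
  obtain ⟨θ, -, hθ⟩ := hfin.exists_hasGradMeasure hΩ hν htv
  have hBV : BVl Ω u ν := ⟨hu, hν, htv⟩
  have hmem : MemBVLoc Ω u := ⟨hu.locallyIntegrableOn hΩ, ν, θ, hν, hθ⟩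
  refine ⟨hmem, hu, hL1, fun g hg hgc hgs => tendsto_setIntegral_mul huk hbddInf hlim hg hgc hgs,
    ⟨ν, θ, hν, hθ, fun φ hφ hc hs => tendsto_integral_smul_polar hΩ hui huki hν hθ
      (fun k => (hgradk k).1) (fun k => (hgradk k).2) hνb hL1 hφ hc hs⟩, hle, hmem, hu, ?_⟩
  choose σk μk hσk1 _ hσk2 hσk3 κk ϑk hκk hϑk heqk using fun k => (hsup k).2.2
  have hS : ∀ k, SigM Ω (σk k) (μk k) := fun k => ⟨hσk1 k, hσk2 k, hσk3 k⟩
  obtain ⟨σ, μ, hσ, hμk, hpair⟩ := exists_sigM_limit hΩ hS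
  refine ⟨σ, μ, hσ.bdd, fun φ hφ hφ0 => ?_, hσ.rep, hσ.locFin, ν, θ, hν, hθ, fun φ hφ =>
    hBV.pairing_eq hΩ hσ (fun ψ hψ hψ0 => le_antisymm ?_ ?_) hφ⟩
  · rw [hσ.rep φ hφ, integral_zero_measure, sub_zero]
    exact integral_nonneg hφ0
  · linarith [hBV.integral_upperRep_le hΩ hψ hψ0 hσ]
  · exact hBV.integral_le_of_tendsto hΩ huk hle hL1 hκk hϑk hS heqk hσ.locFin hμk hpair hψ hψ0
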